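/- arXiv:1312.6305 — 3 statements merged into one kernel-verified Lean document; each statement's English description precedes it below -/
import Mathlib

section
/- For every integer d ≥ 3 there is a constant C = C(d) with the following property. Let P be a set of n ≥ 4 points in ℝ^d in general position, all of whose points are 1-shallow in P. Then there exists a partition of P into classes each of size 2 (except possibly one class of size 3 when n is odd) such that every hyperplane h in ℝ^d crosses at most C · n^{1−1/(d−1)} · (log₂ n)^{2/(d−1)} of the classes, where h is said to cross a class S if h intersects the relative interior of the convex hull of S and the convex hull of S is not contained in h. -/
open scoped RealInnerProductSpace
open scoped Classical

noncomputable section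

/-- A closed halfspace in `ℝ^d`. -/
def halfspace {d : ℕ} (a : EuclideanSpace ℝ (Fin d)) (b : ℝ) : Set (EuclideanSpace ℝ (Fin d)) :=
  {x | ⟪x, a⟫ ≤ b}

/-- A hyperplane in `ℝ^d`. -/
def hyperplane {d : ℕ} (a : EuclideanSpace ℝ (Fin d)) (b : ℝ) : Set (EuclideanSpace ℝ (Fin d)) :=
  {x | ⟪x, a⟫ = b}

/-- A point `p` of a finite set `P` is `k`-shallow if some closed halfspace contains `p`
and at most `k` points of `P` (including `p`). -/
def IsShallowPt {d : ℕ} (P : Finset (EuclideanSpace ℝ (Fin d))) (k : ℕ)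
    (p : EuclideanSpace ℝ (Fin d)) : Prop :=
  ∃ a b, a ≠ 0 ∧ p ∈ halfspace a b ∧
    ((P : Set (EuclideanSpace ℝ (Fin d))) ∩ halfspace a b).ncard ≤ k

/-- `P` is in general position: no `d+1` points of `P` lie on a common hyperplane. -/
def GenPos {d : ℕ} (P : Finset (EuclideanSpace ℝ (Fin d))) : Prop :=
  ∀ (a : EuclideanSpace ℝ (Fin d)) (b : ℝ), a ≠ 0 →
    ((P : Set (EuclideanSpace ℝ (Fin d))) ∩ hyperplane a b).ncard ≤ d

section Geometry

variable {E : Type*} [NormedAddCommGroup E] [InnerProductSpace ℝ E]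

theorem StrictConvexOn.map_combo_lt {g : E → ℝ} (hg : StrictConvexOn ℝ Set.univ g) {x y : E}
    (hxy : x ≠ y) {s t : ℝ} (hs : 0 < s) (ht : 0 < t) (hst : s + t = 1) :
    g (s • x + t • y) < s * g x + t * g y :=
  hg.2 (Set.mem_univ x) (Set.mem_univ y) hxy hs ht hst

/-- If `x` is a local minimum of a linear functional on the section of the level set `{g = 0}` of
a strictly convex function by the flat `x + V`, then it is a global minimum or a global maximum
of this functional on the section of the convex body `{g ≤ 0}`. -/
theorem forall_le_or_forall_ge_of_local_min {g : E → ℝ} (hc : Continuous g)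
    (hg : StrictConvexOn ℝ Set.univ g) (V : Submodule ℝ E) (u x : E) (hx : g x = 0)
    (hloc : ∀ᶠ y in nhds x, y - x ∈ V → g y = 0 → ⟪x, u⟫ ≤ ⟪y, u⟫) :
    (∀ y, y - x ∈ V → g y ≤ 0 → ⟪x, u⟫ ≤ ⟪y, u⟫) ∨
      (∀ y, y - x ∈ V → g y ≤ 0 → ⟪y, u⟫ ≤ ⟪x, u⟫) := by
  by_contra! h
  obtain ⟨⟨y, hyV, hgy, hyu⟩, ⟨z, hzV, hgz, hzu⟩⟩ := h
  obtain ⟨ε, hε, hball⟩ := Metric.eventually_nhds_iff.1 hloc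
  have hxy : x ≠ y := by rintro rfl; exact lt_irrefl _ hyu
  have hxz : x ≠ z := by rintro rfl; exact lt_irrefl _ hzu
  set M := ‖y - x‖ + ‖x - z‖ with hM
  have hM0 : 0 ≤ M := by positivity
  obtain ⟨t, ht0, ht1, htε⟩ : ∃ t : ℝ, 0 < t ∧ t < 1 ∧ t * M < ε := by
    refine ⟨min (1 / 2) (ε / (2 * (M + 1))), by positivity, ?_, ?_⟩
    · exact (min_le_left _ _).trans_lt (by norm_num)
    · calc _ ≤ ε / (2 * (M + 1)) * M := by gcongr; exact min_le_right _ _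
        _ < ε := by
          rw [div_mul_eq_mul_div, div_lt_iff₀ (by positivity)]
          nlinarith
  let φ : ℝ → E := fun s => x + t • ((1 - s) • (y - x) + s • (x - z))
  have hφc : Continuous fun s => g (φ s) := hc.comp (by fun_prop)
  have h0 : g (φ 0) < 0 := by
    have := hg.map_combo_lt hxy (sub_pos.2 ht1) ht0 (by ring)
    have e : φ 0 = (1 - t) • x + t • y := by simp only [φ]; module
    rw [e]
    refine this.trans_le ?_
    rw [hx]
    nlinarith
  have h1 : 0 < g (φ 1) := by
    by_contra! hle
    have hne : φ 1 ≠ z := by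
      intro h
      have : (1 + t) • (x - z) = 0 := by
        rw [← sub_eq_zero] at h
        rw [← h]
        simp only [φ]
        module
      rcases smul_eq_zero.1 this with h | h
      · linarith
      · exact hxz (sub_eq_zero.1 h)
    have := hg.map_combo_lt hne (s := 1 / (1 + t)) (t := t / (1 + t))
      (by positivity) (by positivity) (by field_simp)
    have e : (1 / (1 + t)) • φ 1 + (t / (1 + t)) • z = x := by
      have h1t : (1 + t) ≠ 0 := by positivity
      have : (1 / (1 + t)) • φ 1 + (t / (1 + t)) • z = (1 / (1 + t)) • ((1 + t) • x) := by
        rw [div_eq_mul_one_div t, mul_comm t, mul_smul, ← smul_add]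
        congr 1
        simp only [φ]
        module
      rw [this, smul_smul, one_div, inv_mul_cancel₀ h1t, one_smul]
    rw [e, hx] at this
    have h3 : 1 / (1 + t) * g (φ 1) ≤ 0 := mul_nonpos_of_nonneg_of_nonpos (by positivity) hle
    have h4 : t / (1 + t) * g z ≤ 0 := mul_nonpos_of_nonneg_of_nonpos (by positivity) hgz
    linarith
  obtain ⟨s, ⟨hs0, hs1⟩, hs⟩ := intermediate_value_Icc (zero_le_one' ℝ) hφc.continuousOn
    (show (0 : ℝ) ∈ Set.Icc _ _ from ⟨h0.le, h1.le⟩)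
  have hdiff : φ s - x = t • ((1 - s) • (y - x) + s • (x - z)) := by simp [φ]
  have hnorm : dist (φ s) x < ε := by
    rw [dist_eq_norm, hdiff, norm_smul, Real.norm_of_nonneg ht0.le]
    refine lt_of_le_of_lt ?_ htε
    gcongr
    refine (norm_add_le _ _).trans ?_
    rw [norm_smul, norm_smul, Real.norm_of_nonneg hs0, Real.norm_of_nonneg (by linarith)]
    have := norm_nonneg (y - x)
    have := norm_nonneg (x - z)
    nlinarith
  have hV : φ s - x ∈ V := by
    rw [hdiff]
    refine V.smul_mem _ (V.add_mem (V.smul_mem _ hyV) (V.smul_mem _ ?_))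
    rw [← neg_sub]
    exact V.neg_mem hzV
  have hmin := hball hnorm hV hs
  have hval : ⟪φ s, u⟫ = ⟪x, u⟫ + t * ((1 - s) * (⟪y, u⟫ - ⟪x, u⟫) + s * (⟪x, u⟫ - ⟪z, u⟫)) := by
    simp only [φ, inner_add_left, inner_smul_left, inner_sub_left]
    simp
  have hneg : (1 - s) * (⟪y, u⟫ - ⟪x, u⟫) + s * (⟪x, u⟫ - ⟪z, u⟫) < 0 := by
    rcases hs0.eq_or_lt with h | h
    · rw [← h]; linarith
    · have := mul_pos h (sub_pos.2 hzu)
      have := mul_nonneg (sub_nonneg.2 hs1) (sub_nonneg.2 hyu.le)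
      nlinarith
  nlinarith [mul_neg_of_pos_of_neg ht0 hneg]

theorem eq_of_forall_le_on_flat {g : E → ℝ} (hc : Continuous g)
    (hg : StrictConvexOn ℝ Set.univ g) (V : Submodule ℝ E) {u w x x' : E} (hw : w ∈ V)
    (hwu : ⟪w, u⟫ ≠ 0) (hgx : g x ≤ 0) (hgx' : g x' ≤ 0) (hxx : x' - x ∈ V)
    (hmin : ∀ y, y - x ∈ V → g y ≤ 0 → ⟪x, u⟫ ≤ ⟪y, u⟫)
    (hmin' : ∀ y, y - x' ∈ V → g y ≤ 0 → ⟪x', u⟫ ≤ ⟪y, u⟫) : x = x' := by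
  by_contra hne
  have hm := hg.map_combo_lt hne (s := 1 / 2) (t := 1 / 2)
    (by norm_num) (by norm_num) (by norm_num)
  set m := (1 / 2 : ℝ) • x + (1 / 2 : ℝ) • x' with hmdef
  have hm0 : g m < 0 := by linarith
  have hmx : m - x = (1 / 2 : ℝ) • (x' - x) := by rw [hmdef]; module
  have hxeq : ⟪x, u⟫ = ⟪x', u⟫ := by
    refine le_antisymm (hmin x' hxx hgx') (hmin' x ?_ hgx)
    rw [← neg_sub]
    exact V.neg_mem hxx
  have hmu : ⟪m, u⟫ = ⟪x, u⟫ := by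
    rw [hmdef, inner_add_left, inner_smul_left, inner_smul_left, ← hxeq]
    simp only [one_div, map_inv₀, conj_trivial]
    ring
  have hcont : Continuous fun t : ℝ => g (m + t • w) := hc.comp (by fun_prop)
  have hev : ∀ᶠ t in nhds (0 : ℝ), g (m + t • w) < 0 := by
    refine hcont.continuousAt.eventually_lt continuousAt_const ?_
    simpa using hm0
  have key : ∀ t : ℝ, g (m + t • w) < 0 → 0 ≤ t * ⟪w, u⟫ := by
    intro t ht
    have := hmin (m + t • w) ?_ ht.le
    · rw [inner_add_left, hmu, inner_smul_left] at this
      simpa using this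
    · rw [add_sub_right_comm, hmx]
      exact V.add_mem (V.smul_mem _ hxx) (V.smul_mem _ hw)
  obtain ⟨ε, hε, hball⟩ := Metric.eventually_nhds_iff.1 hev
  have h1 := key (ε / 2) (hball (by simp [abs_of_pos hε, hε]))
  have h2 := key (-(ε / 2)) (hball (by simp [abs_of_pos hε, hε]))
  have : ε / 2 * ⟪w, u⟫ = 0 := le_antisymm (by linarith) h1
  rcases mul_eq_zero.1 this with h | h
  · linarith
  · exact hwu h

theorem Set.finite_of_no_three_increasing {S : Set ℝ}
    (h : ∀ x ∈ S, ∀ y ∈ S, ∀ z ∈ S, x < y → y < z → False) : S.Finite := by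
  by_contra hS
  obtain ⟨T, hT, hcard⟩ := Set.Infinite.exists_subset_card_eq hS 3
  let e := T.orderEmbOfFin hcard
  have he : ∀ i, e i ∈ S := fun i => hT (T.orderEmbOfFin_mem hcard i)
  exact h _ (he 0) _ (he 1) _ (he 2) (e.strictMono (by decide)) (e.strictMono (by decide))

theorem finite_level_set_on_line {g : E → ℝ} (hg : StrictConvexOn ℝ Set.univ g)
    (V : Submodule ℝ E) (hV : Module.finrank ℝ V = 1) (x : E) :
    {y | y - x ∈ V ∧ g y = 0}.Finite := by
  obtain ⟨v, hv0, hv⟩ := finrank_eq_one_iff'.1 hV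
  have hvne : (v : E) ≠ 0 := by simpa using hv0
  have hfin : {t : ℝ | g (x + t • (v : E)) = 0}.Finite := by
    refine Set.finite_of_no_three_increasing ?_
    intro r hr s hs t ht hrs hst
    have hrt : 0 < t - r := by linarith
    have hne : x + r • (v : E) ≠ x + t • (v : E) := by
      intro h
      have : (t - r) • (v : E) = 0 := by
        rw [sub_smul, sub_eq_zero]
        exact (add_left_cancel h).symm
      rcases smul_eq_zero.1 this with h | h
      · linarith
      · exact hvne h
    have := hg.map_combo_lt hne (s := (t - s) / (t - r))
      (t := (s - r) / (t - r)) (div_pos (by linarith) hrt) (div_pos (by linarith) hrt)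
      (by field_simp; ring)
    have e : ((t - s) / (t - r)) • (x + r • (v : E)) + ((s - r) / (t - r)) • (x + t • (v : E))
        = x + s • (v : E) := by
      match_scalars <;> field_simp <;> ring
    simp only [Set.mem_ofPred_eq] at hr hs ht
    rw [e, hr, hs, ht] at this
    simp at this
  refine (hfin.image fun t => x + t • (v : E)).subset ?_
  rintro y ⟨hyV, hy⟩
  obtain ⟨c, hc⟩ := hv ⟨y - x, hyV⟩
  have hc' : c • (v : E) = y - x := by simpa using congrArg Subtype.val hc
  have : x + c • (v : E) = y := by rw [hc']; abel
  exact ⟨c, by simp only [Set.mem_ofPred_eq, this, hy], this⟩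


theorem mem_orthogonal_span_image {ι : Type*} (a : ι → E) (A : Set ι) (y : E) :
    y ∈ (Submodule.span ℝ (a '' A))ᗮ ↔ ∀ i ∈ A, ⟪y, a i⟫ = 0 := by
  rw [Submodule.mem_orthogonal']
  constructor
  · exact fun h i hi => h _ (Submodule.subset_span ⟨i, hi, rfl⟩)
  · intro h u hu
    induction hu using Submodule.span_induction with
    | mem x hx => obtain ⟨i, hi, rfl⟩ := hx; exact h i hi
    | zero => exact inner_zero_right _
    | add x z _ _ hx hz => rw [inner_add_right, hx, hz, add_zero]
    | smul c x _ hx => rw [inner_smul_right, hx, mul_zero]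

/-- Hyperplanes with prescribed normal vectors can be shifted by prescribed small amounts so that
the ones through a given point of the level surface `{g = 0}` are always independent and fewer
than the dimension. -/
theorem exists_generic_shift [FiniteDimensional ℝ E] {ι : Type*} {g : E → ℝ}
    (hg : StrictConvexOn ℝ Set.univ g) (hd : 0 < Module.finrank ℝ E) (a : ι → E) (lo hi : ι → ℝ)
    (hlh : ∀ i, lo i < hi i) (s : Finset ι) :
    ∃ b : ι → ℝ, (∀ i ∈ s, lo i < b i ∧ b i < hi i) ∧ ∀ x, g x = 0 →
      LinearIndepOn ℝ a (s.filter fun i => ⟪x, a i⟫ = b i : Finset ι) ∧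
        (s.filter fun i => ⟪x, a i⟫ = b i).card < Module.finrank ℝ E := by
  induction s using Finset.induction_on with
  | empty => exact ⟨0, by simp, fun x _ => by simpa using hd⟩
  | insert j s hj ih =>
    obtain ⟨b, hb, hgen⟩ := ih
    let B : Finset ι → Set ℝ := fun A => {c | ∃ x, g x = 0 ∧ (∀ i ∈ A, ⟪x, a i⟫ = b i) ∧
      c = ⟪x, a j⟫ ∧ (a j ∈ Submodule.span ℝ (a '' (A : Set ι)) ∨
        (LinearIndepOn ℝ a (A : Set ι) ∧ A.card + 1 = Module.finrank ℝ E))}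
    have hB : ∀ A, (B A).Finite := by
      intro A
      by_cases hspan : a j ∈ Submodule.span ℝ (a '' (A : Set ι))
      · refine Set.Subsingleton.finite ?_
        rintro c ⟨x, -, hx, rfl, -⟩ c' ⟨x', -, hx', rfl, -⟩
        have hmem : x - x' ∈ (Submodule.span ℝ (a '' (A : Set ι)))ᗮ := by
          rw [mem_orthogonal_span_image]
          intro i hi
          rw [inner_sub_left, hx i hi, hx' i hi, sub_self]
        have := (Submodule.mem_orthogonal' _ _).1 hmem _ hspan
        rw [inner_sub_left] at this
        linarith
      · by_cases hA : LinearIndepOn ℝ a (A : Set ι) ∧ A.card + 1 = Module.finrank ℝ E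
        · rcases (B A).eq_empty_or_nonempty with h | ⟨c₀, x₀, hx₀, hx₀A, -⟩
          · rw [h]; exact Set.finite_empty
          have hfr : Module.finrank ℝ (Submodule.span ℝ (a '' (A : Set ι))) = A.card := by
            rw [Set.image_eq_range]
            have := finrank_span_eq_card (R := ℝ) hA.1
            simpa using this
          have h1 : Module.finrank ℝ (Submodule.span ℝ (a '' (A : Set ι)))ᗮ = 1 := by
            have := Submodule.finrank_add_finrank_orthogonal
              (Submodule.span ℝ (a '' (A : Set ι)))
            omega
          refine ((finite_level_set_on_line hg _ h1 x₀).image fun x => ⟪x, a j⟫).subset ?_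
          rintro c ⟨x, hx, hxA, rfl, -⟩
          refine ⟨x, ⟨?_, hx⟩, rfl⟩
          rw [mem_orthogonal_span_image]
          intro i hi
          rw [inner_sub_left, hxA i hi, hx₀A i hi, sub_self]
        · convert Set.finite_empty
          ext c
          simp only [B, hspan, hA, or_self, and_false, exists_false, Set.mem_empty_iff_false,
            Set.mem_ofPred_eq]
    have hfin : (⋃ A ∈ s.powerset, B A).Finite :=
      Set.Finite.biUnion s.powerset.finite_toSet fun A _ => hB A
    obtain ⟨c, ⟨hclo, hchi⟩, hc⟩ := ((Set.Ioo_infinite (hlh j)).sdiff hfin).nonempty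
    have hupd : ∀ i ∈ s, Function.update b j c i = b i := by
      intro i hi
      exact Function.update_of_ne (by rintro rfl; exact hj hi) _ _
    refine ⟨Function.update b j c, ?_, ?_⟩
    · intro i hi
      rcases Finset.mem_insert.1 hi with rfl | hi
      · simpa using ⟨hclo, hchi⟩
      · rw [hupd i hi]; exact hb i hi
    · intro x hx
      obtain ⟨hind, hcard⟩ := hgen x hx
      have hfs : s.filter (fun i => ⟪x, a i⟫ = Function.update b j c i)
          = s.filter fun i => ⟪x, a i⟫ = b i := by
        refine Finset.filter_congr fun i hi => ?_
        rw [hupd i hi]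
      rw [Finset.filter_insert, hfs, Function.update_self]
      set A := s.filter fun i => ⟪x, a i⟫ = b i with hA
      split_ifs with hxj
      · have hjA : j ∉ A := fun h => hj (Finset.mem_filter.1 h).1
        have hnot : ¬ (a j ∈ Submodule.span ℝ (a '' (A : Set ι)) ∨
            (LinearIndepOn ℝ a (A : Set ι) ∧ A.card + 1 = Module.finrank ℝ E)) := by
          intro h
          refine hc (Set.mem_biUnion (x := A) ?_ ⟨x, hx, ?_, hxj.symm, h⟩)
          · exact Finset.mem_powerset.2 (Finset.filter_subset _ _)
          · exact fun i hi => (Finset.mem_filter.1 hi).2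
        push Not at hnot
        refine ⟨?_, ?_⟩
        · rw [Finset.coe_insert, linearIndepOn_insert (by exact_mod_cast hjA)]
          exact ⟨hind, hnot.1⟩
        · rw [Finset.card_insert_of_notMem hjA]
          have := hnot.2 hind
          omega
      · exact ⟨hind, hcard⟩

/-- A finite set in strictly convex position lies on the boundary of a strictly convex body. -/
theorem exists_strictConvexOn_eq_zero (P : Finset E) (hne : P.Nonempty)
    (hP : ∀ p ∈ P, ∃ v : E, ∀ q ∈ P, q ≠ p → ⟪p, v⟫ < ⟪q, v⟫) :
    ∃ g : E → ℝ, Continuous g ∧ StrictConvexOn ℝ Set.univ g ∧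
      Bornology.IsBounded {x | g x = 0} ∧ ∀ p ∈ P, g p = 0 := by
  have hscale : ∀ p ∈ P, ∃ v : E, ∀ q ∈ P, ‖q‖ ^ 2 - ‖p‖ ^ 2 + ⟪p - q, v⟫ ≤ 0 := by
    intro p hp
    obtain ⟨v, hv⟩ := hP p hp
    have hev : ∀ᶠ c : ℝ in Filter.atTop,
        ∀ q ∈ P, ‖q‖ ^ 2 - ‖p‖ ^ 2 + c * ⟪p - q, v⟫ ≤ 0 := by
      rw [Filter.eventually_all_finset]
      intro q hq
      by_cases hqp : q = p
      · subst hqp; simp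
      · have hpos : 0 < ⟪q, v⟫ - ⟪p, v⟫ := sub_pos.2 (hv q hq hqp)
        filter_upwards [Filter.eventually_ge_atTop
          ((‖q‖ ^ 2 - ‖p‖ ^ 2) / (⟪q, v⟫ - ⟪p, v⟫))] with c hc
        rw [div_le_iff₀ hpos] at hc
        rw [inner_sub_left]
        linarith
    obtain ⟨c, hc⟩ := hev.exists
    exact ⟨c • v, fun q hq => by rw [inner_smul_right]; exact hc q hq⟩
  choose! v hv using hscale
  let f : E → E → ℝ := fun p x => ‖x‖ ^ 2 - ‖p‖ ^ 2 + ⟪p - x, v p⟫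
  have happ : ∀ x, P.sup' hne f x = P.sup' hne fun p => f p x := fun x => Finset.sup'_apply hne f x
  refine ⟨P.sup' hne f, ?_, ?_, ?_, ?_⟩
  · refine Finset.sup'_induction hne f (p := Continuous) ?_ ?_
    · exact fun _ h₁ _ h₂ => h₁.sup h₂
    · intro p _
      simp only [f]
      fun_prop
  · refine Finset.sup'_induction hne f (p := StrictConvexOn ℝ Set.univ) ?_ ?_
    · exact fun _ h₁ _ h₂ => h₁.sup h₂
    · intro p _
      refine StrongConvexOn.strictConvexOn (m := 2) ?_ two_pos
      rw [strongConvexOn_iff_convex]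
      refine ⟨convex_univ, ?_⟩
      intro x _ y _ s t _ _ hst
      refine le_of_eq ?_
      obtain rfl : s = 1 - t := by linarith
      simp only [f, inner_sub_left, inner_add_left, inner_smul_left, smul_eq_mul,
        conj_trivial]
      ring
  · obtain ⟨p, hp⟩ := hne
    refine (Metric.isBounded_closedBall (x := (0 : E))
      (r := ‖v p‖ + ‖p‖ + 1)).subset ?_
    intro x hx
    have h0 : f p x ≤ 0 := by
      rw [← show P.sup' ⟨p, hp⟩ f x = 0 from hx, happ]
      exact Finset.le_sup' (fun p => f p x) hp
    rw [mem_closedBall_zero_iff]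
    by_contra! hlt
    have h1 : ⟪x, v p⟫ ≤ ‖x‖ * ‖v p‖ := real_inner_le_norm _ _
    have h2 : -(‖p‖ * ‖v p‖) ≤ ⟪p, v p⟫ := neg_le_of_abs_le (abs_real_inner_le_norm _ _)
    simp only [f, inner_sub_left] at h0
    have := norm_nonneg p
    have := norm_nonneg (v p)
    nlinarith
  · intro p hp
    refine le_antisymm ?_ ?_
    · rw [happ]
      exact Finset.sup'_le _ _ fun q hq => hv q hq p hp
    · rw [happ]
      refine le_trans ?_ (Finset.le_sup' (fun q => f q p) hp)
      simp [f]

theorem exists_forall_notMem_span [FiniteDimensional ℝ E] {ι : Type*} [Finite ι] (a : ι → E) :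
    ∃ u : E, ∀ J : Finset ι, J.card < Module.finrank ℝ E →
      u ∉ Submodule.span ℝ (a '' (J : Set ι)) := by
  have := Fintype.ofFinite ι
  let s : Finset (Subspace ℝ E) :=
    ((Finset.univ : Finset (Finset ι)).filter fun J => J.card < Module.finrank ℝ E).image
      fun J : Finset ι => Submodule.span ℝ (a '' (J : Set ι))
  have htop : ⊤ ∉ s := by
    intro h
    obtain ⟨J, hJ, htop⟩ := Finset.mem_image.1 h
    have hJc := (Finset.mem_filter.1 hJ).2
    have hle := finrank_span_le_card (R := ℝ) (a '' (J : Set ι))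
    rw [htop, finrank_top] at hle
    have : (a '' (J : Set ι)).toFinset.card ≤ J.card := by
      rw [show (a '' (J : Set ι)).toFinset = J.image a by ext; simp]
      exact Finset.card_image_le
    omega
  obtain ⟨u, hu⟩ := (Set.ne_univ_iff_exists_notMem _).1
    (Subspace.biUnion_ne_univ_of_top_notMem htop)
  refine ⟨u, fun J hJ hmem => hu (Set.mem_biUnion (Finset.mem_coe.2 ?_) hmem)⟩
  exact Finset.mem_image.2 ⟨J, Finset.mem_filter.2 ⟨Finset.mem_univ _, hJ⟩, rfl⟩

theorem card_filter_card_le {α : Type*} (s : Finset α) (k : ℕ) :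
    (s.powerset.filter fun T => T.card ≤ k).card ≤ (s.card + 1) ^ k := by
  have hsub : (s.powerset.filter fun T => T.card ≤ k)
      ⊆ (Finset.range (k + 1)).biUnion fun i => s.powersetCard i := by
    intro T hT
    obtain ⟨hTs, hTk⟩ := Finset.mem_filter.1 hT
    exact Finset.mem_biUnion.2 ⟨T.card, Finset.mem_range.2 (by omega),
      Finset.mem_powersetCard.2 ⟨Finset.mem_powerset.1 hTs, rfl⟩⟩
  calc _ ≤ ∑ i ∈ Finset.range (k + 1), (s.powersetCard i).card :=
        (Finset.card_le_card hsub).trans Finset.card_biUnion_le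
    _ ≤ ∑ i ∈ Finset.range (k + 1), s.card ^ i * 1 ^ (k - i) * k.choose i := by
        refine Finset.sum_le_sum fun i hi => ?_
        have : 0 < k.choose i := Nat.choose_pos (by have := Finset.mem_range.1 hi; omega)
        rw [Finset.card_powersetCard, one_pow, mul_one]
        exact (Nat.choose_le_pow _ _).trans (Nat.le_mul_of_pos_right _ this)
    _ = (s.card + 1) ^ k := (add_pow _ _ _).symm

theorem exists_gap_above (S : Finset ℝ) (b : ℝ) : ∃ c, b < c ∧ ∀ t ∈ S, b < t → c ≤ t := by
  have hev : ∀ᶠ c in nhdsWithin b (Set.Ioi b), ∀ t ∈ S, b < t → c ≤ t := by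
    rw [Filter.eventually_all_finset]
    intro t _
    by_cases h : b < t
    · filter_upwards [nhdsWithin_le_nhds (eventually_le_nhds h)] with c hc _ using hc
    · exact Filter.Eventually.of_forall fun _ h' => absurd h' h
  obtain ⟨c, hc, hbc⟩ := (hev.and self_mem_nhdsWithin).exists
  exact ⟨c, hbc, hc⟩

/-- A set in strictly convex position meets few cells of a hyperplane arrangement. -/
theorem card_le_of_halfspace_traces_injective [FiniteDimensional ℝ E] {ι : Type*} [Fintype ι]
    (P : Finset E) (hP : ∀ p ∈ P, ∃ v : E, ∀ q ∈ P, q ≠ p → ⟪p, v⟫ < ⟪q, v⟫)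
    (hd : 0 < Module.finrank ℝ E) (a : ι → E) (b : ι → ℝ)
    (hinj : ∀ p ∈ P, ∀ q ∈ P, (∀ i, b i < ⟪p, a i⟫ ↔ b i < ⟪q, a i⟫) → p = q) :
    P.card ≤ 2 * (2 * Fintype.card ι + 1) ^ (Module.finrank ℝ E - 1) := by
  rcases P.eq_empty_or_nonempty with rfl | hne
  · simp
  obtain ⟨g, hc, hg, hbdd, hgP⟩ := exists_strictConvexOn_eq_zero P hne hP
  choose hi hbhi hhi using fun i => exists_gap_above (P.image fun p => ⟪p, a i⟫) (b i)
  obtain ⟨b', hb', hgen⟩ := exists_generic_shift hg hd a b hi hbhi Finset.univ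
  obtain ⟨u, hu⟩ := exists_forall_notMem_span a
  have hpos : ∀ p ∈ P, ∀ i, b i < ⟪p, a i⟫ → b' i < ⟪p, a i⟫ := fun p hp i h =>
    (hb' i (Finset.mem_univ i)).2.trans_le (hhi i _ (Finset.mem_image_of_mem _ hp) h)
  have hneg : ∀ p : E, ∀ i, ¬ b i < ⟪p, a i⟫ → ⟪p, a i⟫ < b' i := fun p i h =>
    (not_lt.1 h).trans_lt (hb' i (Finset.mem_univ i)).1
  let C : E → Set E := fun p => {x | g x = 0 ∧ ∀ i, (b i < ⟪p, a i⟫ → b' i ≤ ⟪x, a i⟫) ∧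
    (¬ b i < ⟪p, a i⟫ → ⟪x, a i⟫ ≤ b' i)}
  have hC : ∀ p, IsCompact (C p) := by
    intro p
    refine Metric.isCompact_of_isClosed_isBounded ?_ (hbdd.subset fun x hx => hx.1)
    have : C p = {x | g x = 0} ∩ ⋂ i, ({x | b i < ⟪p, a i⟫ → b' i ≤ ⟪x, a i⟫} ∩
        {x | ¬ b i < ⟪p, a i⟫ → ⟪x, a i⟫ ≤ b' i}) := by
      ext x
      simp [C]
    rw [this]
    refine (isClosed_eq hc continuous_const).inter (isClosed_iInter fun i => ?_)
    by_cases h : b i < ⟪p, a i⟫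
    · simp only [h, true_imp_iff, not_true, false_imp_iff, Set.ofPred_true, Set.inter_univ]
      exact isClosed_le continuous_const (by fun_prop)
    · simp only [h, true_imp_iff, not_false_iff, false_imp_iff, Set.ofPred_true, Set.univ_inter]
      exact isClosed_le (by fun_prop) continuous_const
  have hmin : ∀ p ∈ P, ∃ x ∈ C p, ∀ y ∈ C p, ⟪x, u⟫ ≤ ⟪y, u⟫ := by
    intro p hp
    obtain ⟨x, hx, hxm⟩ := (hC p).exists_isMinOn (f := fun x => ⟪x, u⟫)
      ⟨p, hgP p hp, fun i => ⟨fun h => (hpos p hp i h).le, fun h => (hneg p i h).le⟩⟩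
      (by fun_prop)
    exact ⟨x, hx, fun y hy => hxm hy⟩
  choose! x hxC hxmin using hmin
  let J : E → Finset ι := fun p => Finset.univ.filter fun i => ⟪x p, a i⟫ = b' i
  let V : E → Submodule ℝ E := fun p => (Submodule.span ℝ (a '' (J p : Set ι)))ᗮ
  have hmemV : ∀ p y, y - x p ∈ V p ↔ ∀ i ∈ J p, ⟪y, a i⟫ = b' i := by
    intro p y
    simp only [V, mem_orthogonal_span_image]
    refine forall₂_congr fun i hi => ?_
    rw [inner_sub_left, (Finset.mem_filter.1 hi).2, sub_eq_zero]
  have hJcard : ∀ p ∈ P, (J p).card < Module.finrank ℝ E := fun p hp =>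
    (hgen (x p) (hxC p hp).1).2
  have hext : ∀ p ∈ P, (∀ y, y - x p ∈ V p → g y ≤ 0 → ⟪x p, u⟫ ≤ ⟪y, u⟫) ∨
      (∀ y, y - x p ∈ V p → g y ≤ 0 → ⟪y, u⟫ ≤ ⟪x p, u⟫) := by
    intro p hp
    refine forall_le_or_forall_ge_of_local_min hc hg _ u _ (hxC p hp).1 ?_
    have hev : ∀ᶠ y in nhds (x p), ∀ i, i ∉ J p →
        ((b i < ⟪p, a i⟫ → b' i ≤ ⟪y, a i⟫) ∧ (¬ b i < ⟪p, a i⟫ → ⟪y, a i⟫ ≤ b' i)) := by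
      rw [Filter.eventually_all]
      intro i
      by_cases hi : i ∈ J p
      · exact Filter.Eventually.of_forall fun _ h => absurd hi h
      have hne : ⟪x p, a i⟫ ≠ b' i := fun h => hi (Finset.mem_filter.2 ⟨Finset.mem_univ _, h⟩)
      have hcont : ContinuousAt (fun y : E => ⟪y, a i⟫) (x p) := by fun_prop
      by_cases h : b i < ⟪p, a i⟫
      · have hlt := lt_of_le_of_ne (((hxC p hp).2 i).1 h) hne.symm
        filter_upwards [hcont.eventually (lt_mem_nhds hlt)] with y hy _
        exact ⟨fun _ => hy.le, fun h' => absurd h h'⟩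
      · have hlt := lt_of_le_of_ne (((hxC p hp).2 i).2 h) hne
        filter_upwards [hcont.eventually (gt_mem_nhds hlt)] with y hy _
        exact ⟨fun h' => absurd h' h, fun _ => hy.le⟩
    filter_upwards [hev] with y hy hyV hgy
    refine hxmin p hp y ⟨hgy, fun i => ?_⟩
    by_cases hi : i ∈ J p
    · have := (hmemV p y).1 hyV i hi
      exact ⟨fun _ => this.ge, fun _ => this.le⟩
    · exact hy i hi
  let T : E → Finset (ι × Bool) := fun p => (J p).image fun i => (i, decide (b i < ⟪p, a i⟫))
  let F : E → Bool × Finset (ι × Bool) := fun p =>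
    (decide (∀ y, y - x p ∈ V p → g y ≤ 0 → ⟪x p, u⟫ ≤ ⟪y, u⟫), T p)
  let target : Finset (Bool × Finset (ι × Bool)) := Finset.univ ×ˢ
    ((Finset.univ : Finset (ι × Bool)).powerset.filter fun T => T.card ≤ Module.finrank ℝ E - 1)
  have hcard : target.card ≤ 2 * (2 * Fintype.card ι + 1) ^ (Module.finrank ℝ E - 1) := by
    rw [Finset.card_product, Finset.card_univ, Fintype.card_bool]
    refine Nat.mul_le_mul_left _ ((card_filter_card_le _ _).trans ?_)
    rw [Finset.card_univ, Fintype.card_prod, Fintype.card_bool, mul_comm]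
  refine le_trans (Finset.card_le_card_of_injOn F ?_ ?_) hcard
  · intro p hp
    refine Finset.mem_coe.2 (Finset.mem_product.2 ⟨Finset.mem_univ _, Finset.mem_filter.2
      ⟨Finset.mem_powerset.2 (Finset.subset_univ _), ?_⟩⟩)
    have := hJcard p hp
    exact Finset.card_image_le.trans (by omega)
  · intro p hp q hq hpq
    have hp : p ∈ P := hp
    have hq : q ∈ P := hq
    obtain ⟨hkind, hT⟩ := Prod.ext_iff.1 hpq
    have hT : T p = T q := hT
    have hTfst : ∀ p, (T p).image Prod.fst = J p := by
      intro p
      simp only [T, Finset.image_image, Function.comp_def, Finset.image_id']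
    have hJ : J p = J q := by rw [← hTfst p, ← hTfst q, hT]
    have hVV : V p = V q := by simp only [V, hJ]
    have hside : ∀ i ∈ J p, (b i < ⟪p, a i⟫ ↔ b i < ⟪q, a i⟫) := by
      intro i hi
      have : (i, decide (b i < ⟪p, a i⟫)) ∈ T q := hT ▸ Finset.mem_image_of_mem _ hi
      obtain ⟨j, -, hj⟩ := Finset.mem_image.1 this
      obtain ⟨rfl, hj⟩ := Prod.ext_iff.1 hj
      simpa using hj.symm
    have hxx : x q - x p ∈ V p := by
      rw [hmemV]
      intro i hi
      rw [hJ] at hi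
      exact (Finset.mem_filter.1 hi).2
    obtain ⟨w, hw, hwu⟩ : ∃ w ∈ V p, ⟪w, u⟫ ≠ 0 := by
      by_contra! hall
      refine hu (J p) (hJcard p hp) ?_
      rw [← Submodule.orthogonal_orthogonal (Submodule.span ℝ (a '' (J p : Set ι))),
        Submodule.mem_orthogonal]
      exact hall
    have hkind' : (∀ y, y - x p ∈ V p → g y ≤ 0 → ⟪x p, u⟫ ≤ ⟪y, u⟫) ↔
        (∀ y, y - x q ∈ V q → g y ≤ 0 → ⟪x q, u⟫ ≤ ⟪y, u⟫) := by
      simpa [F] using hkind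
    have hxeq : x p = x q := by
      by_cases hk : ∀ y, y - x p ∈ V p → g y ≤ 0 → ⟪x p, u⟫ ≤ ⟪y, u⟫
      · refine eq_of_forall_le_on_flat hc hg (V p) hw hwu (hxC p hp).1.le (hxC q hq).1.le hxx hk ?_
        rw [hVV]
        exact hkind'.1 hk
      · have h1 := (hext p hp).resolve_left hk
        have h2 := (hext q hq).resolve_left fun h => hk (hkind'.2 h)
        refine eq_of_forall_le_on_flat hc hg (V p) (u := -u) hw (by simpa using hwu)
          (hxC p hp).1.le (hxC q hq).1.le hxx ?_ ?_
        · intro y hy hgy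
          simpa using h1 y hy hgy
        · intro y hy hgy
          rw [hVV] at hy
          simpa using h2 y hy hgy
    refine hinj p hp q hq fun i => ?_
    by_cases hi : i ∈ J p
    · exact hside i hi
    · have hne : ⟪x p, a i⟫ ≠ b' i := fun h => hi (Finset.mem_filter.2 ⟨Finset.mem_univ _, h⟩)
      have h1 := (hxC p hp).2 i
      have h2 := (hxC q hq).2 i
      rw [← hxeq] at h2
      constructor
      · intro h
        by_contra h'
        exact hne (le_antisymm (h2.2 h') (h1.1 h))
      · intro h
        by_contra h'
        exact hne (le_antisymm (h1.2 h') (h2.1 h))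

end Geometry

section Packing

theorem sum_fin_succ_bool {M : Type*} [AddCommMonoid M] {s : ℕ} (i : Fin (s + 1))
    (F : (Fin (s + 1) → Bool) → M) :
    ∑ Q, F Q = ∑ R : Fin s → Bool, (F (i.insertNth false R) + F (i.insertNth true R)) := by
  rw [← (Fin.insertNthEquiv (fun _ => Bool) i).sum_comp, Fintype.sum_prod_type_right]
  refine Finset.sum_congr rfl fun R _ => ?_
  rw [Fintype.sum_bool, add_comm]
  rfl

/-- The weighted edge count of the one-inclusion graph is bounded in terms of the size of the
shattered sets. -/
theorem sum_min_flip_le (s : ℕ) (D : ℤ) (w : (Fin s → Bool) → ℕ)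
    (hD : ∀ T : Finset (Fin s), (∀ f : Fin s → Bool, ∃ Q, w Q ≠ 0 ∧ ∀ i ∈ T, Q i = f i) →
      (T.card : ℤ) ≤ D) :
    ∑ i, ∑ Q, (min (w Q) (w (Function.update Q i (!Q i))) : ℤ) ≤ 2 * D * ∑ Q, (w Q : ℤ) := by
  induction s generalizing D with
  | zero =>
    rw [Fin.sum_univ_zero]
    obtain ⟨Q₀, hQ₀⟩ : ∃ Q₀, ∑ Q, (w Q : ℤ) = w Q₀ := ⟨_, Fintype.sum_unique _⟩
    rw [hQ₀]
    by_cases h : w Q₀ = 0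
    · rw [h, Nat.cast_zero, mul_zero]
    · have hD0 : 0 ≤ D := by simpa using hD ∅ fun f => ⟨Q₀, h, by simp⟩
      positivity
  | succ s ih =>
    let w0 : (Fin s → Bool) → ℕ := fun R => w ((0 : Fin (s + 1)).insertNth false R)
    let w1 : (Fin s → Bool) → ℕ := fun R => w ((0 : Fin (s + 1)).insertNth true R)
    have hmax := ih D (fun R => max (w0 R) (w1 R)) ?_
    have hmin := ih (D - 1) (fun R => min (w0 R) (w1 R)) ?_
    · rw [Fin.sum_univ_succ]
      have h0 : ∑ Q, (min (w Q) (w (Function.update Q 0 (!Q 0))) : ℤ)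
          = ∑ R, 2 * (min (w0 R) (w1 R) : ℤ) := by
        rw [sum_fin_succ_bool 0]
        refine Finset.sum_congr rfl fun R _ => ?_
        simp only [Fin.insertNth_zero', Fin.cons_zero, Fin.update_cons_zero, Bool.not_false,
          Bool.not_true, w0, w1]
        rw [min_comm (w (Fin.cons true R) : ℤ)]
        ring
      have hs : ∑ i : Fin s, ∑ Q, (min (w Q) (w (Function.update Q i.succ (!Q i.succ))) : ℤ) ≤
          ∑ i : Fin s, ∑ R, ((min ((max (w0 R) (w1 R) : ℕ) : ℤ)
            ((max (w0 (Function.update R i (!R i))) (w1 (Function.update R i (!R i))) : ℕ) : ℤ)) +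
            (min ((min (w0 R) (w1 R) : ℕ) : ℤ)
            ((min (w0 (Function.update R i (!R i))) (w1 (Function.update R i (!R i))) : ℕ) :
              ℤ))) := by
        refine Finset.sum_le_sum fun i _ => ?_
        rw [sum_fin_succ_bool 0]
        refine Finset.sum_le_sum fun R _ => ?_
        simp only [Fin.insertNth_zero', Fin.cons_succ, ← Fin.cons_update, w0, w1]
        omega
      simp only [Finset.sum_add_distrib] at hs
      have hw : ∑ Q, (w Q : ℤ) = ∑ R, ((max (w0 R) (w1 R) : ℕ) : ℤ)
          + ∑ R, ((min (w0 R) (w1 R) : ℕ) : ℤ) := by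
        rw [sum_fin_succ_bool 0, ← Finset.sum_add_distrib]
        refine Finset.sum_congr rfl fun R _ => ?_
        simp only [w0, w1]
        omega
      rw [h0, hw, ← Finset.mul_sum]
      simp only [Nat.cast_min] at hs hmin ⊢
      linarith
    · intro T hT
      have h := hD (insert 0 (T.map (Fin.succEmb s))) ?_
      · rw [Finset.card_insert_of_notMem (by simp), Finset.card_map] at h
        push_cast at h
        linarith
      · intro f
        obtain ⟨R, hR, hRT⟩ := hT fun i => f i.succ
        refine ⟨Fin.cons (f 0) R, ?_, ?_⟩
        · simp only [w0, w1, Fin.insertNth_zero'] at hR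
          cases f 0
          · intro h; exact hR (by rw [h]; exact Nat.zero_min _)
          · intro h; exact hR (by rw [h]; exact Nat.min_zero _)
        · intro i hi
          rcases Finset.mem_insert.1 hi with rfl | hi
          · rfl
          · obtain ⟨j, hj, rfl⟩ := Finset.mem_map.1 hi
            exact hRT j hj
    · intro T hT
      have h := hD (T.map (Fin.succEmb s)) ?_
      · rwa [Finset.card_map] at h
      · intro f
        obtain ⟨R, hR, hRT⟩ := hT fun i => f i.succ
        have : w0 R ≠ 0 ∨ w1 R ≠ 0 := by omega
        simp only [w0, w1, Fin.insertNth_zero'] at this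
        rcases this with h | h
        · refine ⟨_, h, fun i hi => ?_⟩
          obtain ⟨j, hj, rfl⟩ := Finset.mem_map.1 hi
          exact hRT j hj
        · refine ⟨_, h, fun i hi => ?_⟩
          obtain ⟨j, hj, rfl⟩ := Finset.mem_map.1 hi
          exact hRT j hj

variable {α X : Type*}

theorem le_sum_mul_min_card [Fintype X] (S : α → X → Bool) (w : X → ℝ) (hw : ∀ x, 0 ≤ w x) (δ : ℝ)
    (A : Finset α) (hA : A.Nonempty)
    (hsep : ∀ p ∈ A, ∀ q ∈ A, p ≠ q → δ ≤ ∑ x, if S p x ≠ S q x then w x else 0) :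
    δ * (A.card - 1) ≤ ∑ x, w x * (2 * min ((A.filter fun p => S p x = false).card : ℝ)
      ((A.filter fun p => S p x = true).card)) := by
  have hApos : (0 : ℝ) < A.card := by exact_mod_cast hA.card_pos
  have hpair : ∀ x, ∑ p ∈ A, ∑ q ∈ A, (if S p x ≠ S q x then w x else 0)
      ≤ A.card * (w x * (2 * min ((A.filter fun p => S p x = false).card : ℝ)
        ((A.filter fun p => S p x = true).card))) := by
    intro x
    set m0 := (A.filter fun p => S p x = false).card with hm0
    set m1 := (A.filter fun p => S p x = true).card with hm1
    have hsum : m0 + m1 = A.card := by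
      rw [← Finset.card_filter_add_card_filter_not (s := A) fun p => S p x = false]
      simp [hm0, hm1]
    have hin : ∀ p, ∑ q ∈ A, (if S p x ≠ S q x then w x else 0)
        = (if S p x = false then m1 * w x else 0) + (if S p x = true then m0 * w x else 0) := by
      intro p
      rw [← Finset.sum_filter, Finset.sum_const, nsmul_eq_mul]
      cases h : S p x <;> simp [hm0, hm1]
    simp only [hin, Finset.sum_add_distrib]
    rw [← Finset.sum_filter, ← Finset.sum_filter, Finset.sum_const, Finset.sum_const,
      nsmul_eq_mul, nsmul_eq_mul, ← hm0, ← hm1]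
    have hsum' : (A.card : ℝ) = m0 + m1 := by rw [← hsum]; push_cast; rfl
    have hmul : (m0 : ℝ) * m1 ≤ A.card * min (m0 : ℝ) m1 := by
      rw [hsum']
      have h0 : (0 : ℝ) ≤ m0 := by positivity
      have h1 : (0 : ℝ) ≤ m1 := by positivity
      rcases le_total (m0 : ℝ) m1 with h | h
      · rw [min_eq_left h]; nlinarith
      · rw [min_eq_right h]; nlinarith
    nlinarith [mul_le_mul_of_nonneg_left hmul (hw x)]
  have hlow : (A.card : ℝ) * (δ * (A.card - 1)) ≤
      ∑ p ∈ A, ∑ q ∈ A, ∑ x, (if S p x ≠ S q x then w x else 0) := by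
    rw [← nsmul_eq_mul]
    refine Finset.card_nsmul_le_sum _ _ _ fun p hp => ?_
    rw [← Finset.add_sum_erase _ _ hp]
    have h := Finset.card_nsmul_le_sum (A.erase p)
      (fun q => ∑ x, (if S p x ≠ S q x then w x else 0)) δ
      fun q hq => hsep p hp q (Finset.mem_of_mem_erase hq) (Finset.ne_of_mem_erase hq).symm
    rw [Finset.card_erase_of_mem hp, nsmul_eq_mul, Nat.cast_sub hA.card_pos] at h
    simp only [ne_eq, not_true_eq_false, if_false, Finset.sum_const_zero, zero_add]
    simp only [Nat.cast_one] at h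
    linarith
  have hswap : ∑ p ∈ A, ∑ q ∈ A, ∑ x, (if S p x ≠ S q x then w x else 0)
      = ∑ x, ∑ p ∈ A, ∑ q ∈ A, (if S p x ≠ S q x then w x else 0) := by
    rw [Finset.sum_comm]
    rw [Finset.sum_congr rfl fun q _ => Finset.sum_comm]
    rw [Finset.sum_comm]
    exact Finset.sum_congr rfl fun x _ => Finset.sum_comm
  rw [hswap] at hlow
  have := hlow.trans (Finset.sum_le_sum fun x _ => hpair x)
  rw [← Finset.mul_sum] at this
  exact le_of_mul_le_mul_left this hApos

/-- The number of elements of `P` with a given trace on a sequence. -/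
def traceCount (S : α → X → Bool) (P : Finset α) {s : ℕ} (x : Fin s → X) (Q : Fin s → Bool) : ℕ :=
  (P.filter fun p => (fun j => S p (x j)) = Q).card

theorem sum_traceCount (S : α → X → Bool) (P : Finset α) {s : ℕ} (x : Fin s → X) :
    ∑ Q, traceCount S P x Q = P.card :=
  (Finset.card_eq_sum_card_fiberwise (f := fun p j => S p (x j)) (t := Finset.univ)
    fun _ _ => Finset.mem_coe.2 (Finset.mem_univ _)).symm

theorem le_sum_mul_sum_min_traceCount [Fintype X] (S : α → X → Bool) (P : Finset α) (w : X → ℝ)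
    (hw : ∀ x, 0 ≤ w x) (δ : ℝ)
    (hsep : ∀ p ∈ P, ∀ q ∈ P, p ≠ q → δ ≤ ∑ x, if S p x ≠ S q x then w x else 0)
    {t : ℕ} (i : Fin (t + 1)) (y : Fin t → X) :
    δ * (P.card - (P.image fun p j => S p (y j)).card) ≤
      ∑ v, w v * ∑ Q, (min (traceCount S P (i.insertNth v y) Q)
        (traceCount S P (i.insertNth v y) (Function.update Q i (!Q i))) : ℝ) := by
  have hcount : ∀ v c (R : Fin t → Bool), traceCount S P (i.insertNth v y) (i.insertNth c R)
      = ((P.filter fun p => (fun j => S p (y j)) = R).filter fun p => S p v = c).card := by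
    intro v c R
    rw [traceCount, Finset.filter_filter]
    congr 1
    refine Finset.filter_congr fun p _ => ?_
    rw [Fin.eq_insertNth_iff]
    simp only [Fin.insertNth_apply_same, and_comm (a := S p v = c)]
    have : (i.removeNth fun j => S p (i.insertNth (α := fun _ => X) v y j))
        = fun j => S p (y j) := by
      ext j
      simp [Fin.removeNth]
    rw [this]
  have hupd : ∀ c (R : Fin t → Bool), Function.update
      (i.insertNth c R : Fin (t + 1) → Bool) i (!c) = i.insertNth (!c) R := by
    intro c R
    exact Fin.update_insertNth _ _ _ _
  have hinner : ∀ v, ∑ Q, (min (traceCount S P (i.insertNth v y) Q)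
        (traceCount S P (i.insertNth v y) (Function.update Q i (!Q i))) : ℝ) =
      ∑ R : Fin t → Bool, 2 * min
        (((P.filter fun p => (fun j => S p (y j)) = R).filter fun p => S p v = false).card : ℝ)
        ((P.filter fun p => (fun j => S p (y j)) = R).filter fun p => S p v = true).card := by
    intro v
    rw [sum_fin_succ_bool i]
    refine Finset.sum_congr rfl fun R _ => ?_
    rw [Fin.insertNth_apply_same, Fin.insertNth_apply_same, hupd, hupd, Bool.not_false,
      Bool.not_true, hcount, hcount, two_mul]
    congr 1
    exact min_comm _ _
  simp only [hinner, Finset.mul_sum]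
  rw [Finset.sum_comm]
  set I := P.image fun p j => S p (y j) with hI
  have hcard : (P.card : ℝ) - I.card
      = ∑ R ∈ I, (((P.filter fun p => (fun j => S p (y j)) = R).card : ℝ) - 1) := by
    rw [Finset.sum_sub_distrib, Finset.sum_const, nsmul_eq_mul, mul_one,
      Finset.card_eq_sum_card_image (fun p j => S p (y j)) P]
    push_cast
    rfl
  rw [hcard, Finset.mul_sum]
  refine (Finset.sum_le_sum fun R hR => ?_).trans
    (Finset.sum_le_sum_of_subset_of_nonneg (Finset.subset_univ I) fun R _ _ =>
      Finset.sum_nonneg fun v _ => mul_nonneg (hw v) (by positivity))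
  refine le_sum_mul_min_card S w hw δ _ ?_ ?_
  · obtain ⟨p, hp, rfl⟩ := Finset.mem_image.1 hR
    exact ⟨p, Finset.mem_filter.2 ⟨hp, rfl⟩⟩
  · intro p hp q hq
    exact hsep p (Finset.mem_filter.1 hp).1 q (Finset.mem_filter.1 hq).1

/-- A form of Haussler's packing lemma. -/
theorem packing_bound [Fintype X] (S : α → X → Bool) (P : Finset α) (w : X → ℝ)
    (hw : ∀ x, 0 ≤ w x) (hW : 0 < ∑ x, w x) {δ : ℝ} (hδ : 0 ≤ δ)
    (hsep : ∀ p ∈ P, ∀ q ∈ P, p ≠ q → δ ≤ ∑ x, if S p x ≠ S q x then w x else 0)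
    {t D π : ℕ} (hπ : ∀ y : Fin t → X, (P.image fun p j => S p (y j)).card ≤ π)
    (hD : ∀ (x : Fin (t + 1) → X) (T : Finset (Fin (t + 1))),
      (∀ f : Fin (t + 1) → Bool, ∃ p ∈ P, ∀ i ∈ T, S p (x i) = f i) → T.card ≤ D) :
    (t + 1) * δ * (P.card - π) ≤ 2 * D * P.card * ∑ x, w x := by
  set W := ∑ x, w x with hWdef
  let e : (Fin (t + 1) → X) → Fin (t + 1) → ℝ := fun x i =>
    ∑ Q, (min (traceCount S P x Q) (traceCount S P x (Function.update Q i (!Q i))) : ℝ)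
  have hup : ∀ x, ∑ i, e x i ≤ 2 * D * P.card := by
    intro x
    have := sum_min_flip_le (t + 1) D (traceCount S P x) fun T hT => by
      have h : T.card ≤ D := hD x T fun f => by
        obtain ⟨Q, hQ, hQf⟩ := hT f
        obtain ⟨p, hp⟩ := Finset.card_ne_zero.1 hQ
        obtain ⟨hpP, rfl⟩ := Finset.mem_filter.1 hp
        exact ⟨p, hpP, hQf⟩
      exact_mod_cast h
    rw [← Nat.cast_sum, sum_traceCount] at this
    simp only [e]
    exact_mod_cast this
  have hlow : ∀ i, W ^ t * (δ * (P.card - π)) ≤ ∑ x : Fin (t + 1) → X, (∏ j, w (x j)) * e x i := by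
    intro i
    rw [← (Fin.insertNthEquiv (fun _ => X) i).sum_comp, Fintype.sum_prod_type_right, hWdef,
      Fintype.sum_pow, Finset.sum_mul]
    refine Finset.sum_le_sum fun y _ => ?_
    have h1 := le_sum_mul_sum_min_traceCount S P w hw δ hsep i y
    have h2 : δ * ((P.card : ℝ) - π) ≤ δ * (P.card - (P.image fun p j => S p (y j)).card) := by
      have : ((P.image fun p j => S p (y j)).card : ℝ) ≤ π := by exact_mod_cast hπ y
      exact mul_le_mul_of_nonneg_left (by linarith) hδ
    refine (mul_le_mul_of_nonneg_left (h2.trans h1)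
      (Finset.prod_nonneg fun j _ => hw _)).trans (le_of_eq ?_)
    rw [Finset.mul_sum]
    refine Finset.sum_congr rfl fun v _ => ?_
    rw [Fin.prod_univ_succAbove _ i]
    have hxy : Fin.insertNthEquiv (fun _ => X) i (v, y) = i.insertNth v y := rfl
    simp only [hxy, Fin.insertNth_apply_same, Fin.insertNth_apply_succAbove, e]
    ring
  have hall : ((t : ℝ) + 1) * (W ^ t * (δ * (P.card - π))) ≤ W ^ (t + 1) * (2 * D * P.card) := by
    calc ((t : ℝ) + 1) * (W ^ t * (δ * (P.card - π)))
        = ∑ _i : Fin (t + 1), W ^ t * (δ * (P.card - π)) := by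
          rw [Finset.sum_const, Finset.card_univ, Fintype.card_fin, nsmul_eq_mul]
          push_cast
          rfl
      _ ≤ ∑ i : Fin (t + 1), ∑ x : Fin (t + 1) → X, (∏ j, w (x j)) * e x i :=
          Finset.sum_le_sum fun i _ => hlow i
      _ = ∑ x : Fin (t + 1) → X, (∏ j, w (x j)) * ∑ i, e x i := by
          rw [Finset.sum_comm]
          simp only [Finset.mul_sum]
      _ ≤ ∑ x : Fin (t + 1) → X, (∏ j, w (x j)) * (2 * D * P.card) :=
          Finset.sum_le_sum fun x _ =>
            mul_le_mul_of_nonneg_left (hup x) (Finset.prod_nonneg fun j _ => hw _)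
      _ = W ^ (t + 1) * (2 * D * P.card) := by
          rw [← Finset.sum_mul, ← Fintype.sum_pow]
  have hWt : 0 < W ^ t := pow_pos hW t
  refine le_of_mul_le_mul_left ?_ hWt
  calc W ^ t * ((t + 1) * δ * (P.card - π)) = ((t : ℝ) + 1) * (W ^ t * (δ * (P.card - π))) := by
        ring
    _ ≤ _ := hall
    _ = _ := by rw [pow_succ]; ring

end Packing

section ShortPair

theorem exists_lt_two_pow (k : ℕ) : ∃ D : ℕ, 0 < D ∧ ∀ t, D < t → 2 * (2 * t + 1) ^ k < 2 ^ t := by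
  have h := tendsto_pow_const_div_const_pow_of_one_lt k (one_lt_two : (1 : ℝ) < 2)
  have hev := h.eventually (gt_mem_nhds (show (0 : ℝ) < 1 / (2 * 3 ^ k) by positivity))
  obtain ⟨D, hD⟩ := Filter.eventually_atTop.1 hev
  refine ⟨D + 1, Nat.succ_pos _, fun t ht => ?_⟩
  have ht' := hD t (by omega)
  rw [div_lt_div_iff₀ (by positivity) (by positivity), one_mul] at ht'
  have h3 : t ^ k * (2 * 3 ^ k) < 2 ^ t := by exact_mod_cast ht'
  calc 2 * (2 * t + 1) ^ k ≤ 2 * (3 * t) ^ k := by gcongr; omega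
    _ = t ^ k * (2 * 3 ^ k) := by rw [mul_pow]; ring
    _ < 2 ^ t := h3

variable {E : Type*} [NormedAddCommGroup E] [InnerProductSpace ℝ E]

theorem card_image_halfspace_trace_le [FiniteDimensional ℝ E] {ι : Type*} [Fintype ι]
    (P : Finset E) (hP : ∀ p ∈ P, ∃ v : E, ∀ q ∈ P, q ≠ p → ⟪p, v⟫ < ⟪q, v⟫)
    (hd : 0 < Module.finrank ℝ E) (a : ι → E) (b : ι → ℝ) :
    (P.image fun p i => decide (b i < ⟪p, a i⟫)).card
      ≤ 2 * (2 * Fintype.card ι + 1) ^ (Module.finrank ℝ E - 1) := by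
  obtain ⟨P', hP', hinj, himg⟩ : ∃ P' ⊆ P, Set.InjOn (fun p i => decide (b i < ⟪p, a i⟫))
      (P' : Set E) ∧ P'.image (fun p i => decide (b i < ⟪p, a i⟫))
        = P.image fun p i => decide (b i < ⟪p, a i⟫) := by
    obtain ⟨P', hsub, hbij⟩ :=
      (Set.surjOn_image (fun p i => decide (b i < ⟪p, a i⟫)) (P : Set E)).exists_bijOn_subset
    have hfin : P'.Finite := P.finite_toSet.subset hsub
    refine ⟨hfin.toFinset, by simpa using hsub, by simpa using hbij.injOn, ?_⟩
    rw [← Finset.coe_inj]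
    simpa using hbij.image_eq
  rw [← himg, Finset.card_image_of_injOn hinj]
  refine card_le_of_halfspace_traces_injective P' (fun p hp => ?_) hd a b fun p hp q hq h => ?_
  · obtain ⟨v, hv⟩ := hP p (hP' hp)
    exact ⟨v, fun q hq => hv q (hP' hq)⟩
  · exact hinj hp hq (funext fun i => by simp only [h i])

/-- In a set of `N` points in strictly convex position some pair is separated by a
small weighted fraction of any finite family of halfspaces. -/
theorem exists_pair_few_separating [FiniteDimensional ℝ E] {X : Type*} [Fintype X] {k D : ℕ}
    (hk : 2 ≤ k) (hE : Module.finrank ℝ E = k + 1) (hD0 : 0 < D)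
    (hD : ∀ t, D < t → 2 * (2 * t + 1) ^ k < 2 ^ t)
    (P : Finset E) (hP : ∀ p ∈ P, ∃ v : E, ∀ q ∈ P, q ≠ p → ⟪p, v⟫ < ⟪q, v⟫)
    (hP2 : 2 ≤ P.card) (a : X → E) (b : X → ℝ) (w : X → ℝ) (hw : ∀ x, 0 ≤ w x)
    (hW : 0 < ∑ x, w x) :
    ∃ p ∈ P, ∃ q ∈ P, p ≠ q ∧
      (∑ x, if decide (b x < ⟪p, a x⟫) ≠ decide (b x < ⟪q, a x⟫) then w x else 0)
        ≤ 64 * D * (∑ x, w x) * (P.card : ℝ) ^ (-(1 / (k : ℝ))) := by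
  by_contra! hcon
  set W := ∑ x, w x with hWdef
  set ρ : ℝ := (P.card : ℝ) ^ (1 / (k : ℝ)) with hρdef
  have hN : (0 : ℝ) < P.card := by exact_mod_cast (by omega : 0 < P.card)
  have hρ : 0 < ρ := Real.rpow_pos_of_pos hN _
  have hρk : ρ ^ k = P.card := by
    rw [hρdef, ← Real.rpow_natCast, ← Real.rpow_mul hN.le, one_div,
      inv_mul_cancel₀ (by exact_mod_cast (by omega : k ≠ 0)), Real.rpow_one]
  rw [Real.rpow_neg hN.le, ← hρdef] at hcon
  have hD1 : (1 : ℝ) ≤ D := by exact_mod_cast hD0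
  have hρ64 : 64 < ρ := by
    obtain ⟨p, hp, q, hq, hpq⟩ := Finset.one_lt_card.1 hP2
    have h1 := hcon p hp q hq hpq
    have h2 : (∑ x, if decide (b x < ⟪p, a x⟫) ≠ decide (b x < ⟪q, a x⟫) then w x else 0) ≤ W := by
      refine Finset.sum_le_sum fun x _ => ?_
      split_ifs
      · exact le_rfl
      · exact hw x
    have h3 := h1.trans_le h2
    rw [← div_eq_mul_inv, div_lt_iff₀ hρ] at h3
    have h4 : 64 * (D : ℝ) < ρ := by nlinarith
    linarith
  set t := ⌊ρ / 16⌋₊ with ht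
  have ht1 : (t : ℝ) ≤ ρ / 16 := Nat.floor_le (by positivity)
  have ht2 : ρ / 16 < t + 1 := Nat.lt_floor_add_one _
  have hpack := packing_bound (fun p x => decide (b x < ⟪p, a x⟫)) P w hw hW
    (δ := 64 * D * W * ρ⁻¹) (by positivity)
    (fun p hp q hq hpq => (hcon p hp q hq hpq).le) (t := t) (D := D) (π := 2 * (2 * t + 1) ^ k)
    (by
      intro y
      have := card_image_halfspace_trace_le P hP (by omega) (fun j => a (y j)) fun j => b (y j)
      rwa [hE, Nat.add_sub_cancel, Fintype.card_fin] at this)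
    (by
      intro x T hT
      by_contra! hlt
      have h1 := card_image_halfspace_trace_le P hP (by omega) (fun j : T => a (x j))
        fun j : T => b (x j)
      rw [hE, Nat.add_sub_cancel, Fintype.card_coe] at h1
      have h2 : (P.image fun p (j : T) => decide (b (x j) < ⟪p, a (x j)⟫)) = Finset.univ := by
        refine Finset.eq_univ_of_forall fun f => ?_
        obtain ⟨p, hp, hpf⟩ := hT fun i => if h : i ∈ T then f ⟨i, h⟩ else false
        refine Finset.mem_image.2 ⟨p, hp, funext fun j => ?_⟩
        simpa using hpf j j.2
      rw [h2, Finset.card_univ, Fintype.card_fun, Fintype.card_bool, Fintype.card_coe] at h1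
      exact absurd (hD _ hlt) (not_lt.2 h1))
  have hπ : 2 * ((2 * (2 * t + 1) ^ k : ℕ) : ℝ) < P.card := by
    have h1 : 2 * (2 * (t : ℝ) + 1) < ρ := by linarith
    have h2 : (2 * (2 * (t : ℝ) + 1)) ^ k < ρ ^ k :=
      pow_lt_pow_left₀ h1 (by positivity) (by omega)
    rw [hρk, mul_pow] at h2
    have h3 : (2 : ℝ) ^ 2 ≤ 2 ^ k := pow_le_pow_right₀ one_le_two hk
    have h4 : (0 : ℝ) ≤ (2 * (t : ℝ) + 1) ^ k := by positivity
    push_cast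
    nlinarith
  set π : ℝ := ((2 * (2 * t + 1) ^ k : ℕ) : ℝ) with hπdef
  have hπ0 : 0 ≤ π := by positivity
  have hcoef : 4 * D * W ≤ (t + 1) * (64 * D * W * ρ⁻¹) := by
    calc 4 * D * W = ρ / 16 * (64 * D * W * ρ⁻¹) := by field_simp; norm_num
      _ ≤ _ := by gcongr
  have hDW : 0 < D * W := by positivity
  have h5 : 4 * D * W * (P.card - π) ≤ 2 * D * P.card * W :=
    (mul_le_mul_of_nonneg_right hcoef (by linarith)).trans hpack
  nlinarith

end ShortPair

section Pairing

theorem rpow_sub_one_le_rpow_sub_rpow_sub_two {N α : ℝ} (hN : 2 ≤ N) (h1 : 1 / 2 ≤ α) (h2 : α ≤ 1) :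
    N ^ (α - 1) ≤ N ^ α - (N - 2) ^ α := by
  have hN0 : 0 < N := by linarith
  have hs : -1 ≤ -(2 / N) := by
    have := (div_le_one hN0).2 hN
    linarith
  have hb := rpow_one_add_le_one_add_mul_self hs (by linarith : (0 : ℝ) ≤ α) h2
  have he : N - 2 = N * (1 + -(2 / N)) := by field_simp; ring
  have h3 : (N - 2) ^ α ≤ N ^ α * (1 + α * -(2 / N)) := by
    rw [he, Real.mul_rpow hN0.le (by linarith)]
    gcongr
  have h4 : N ^ α = N ^ (α - 1) * N := by
    rw [Real.rpow_sub_one hN0.ne']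
    field_simp
  have h5 : N ^ α * (1 + α * -(2 / N)) = N ^ α - 2 * α * N ^ (α - 1) := by
    rw [h4]
    field_simp
    ring
  have h6 : 0 < N ^ (α - 1) := Real.rpow_pos_of_pos hN0 _
  nlinarith

variable {α X : Type*}

theorem exists_pairing_sum_le [Fintype X] (S : α → X → Bool) {c β : ℝ} (hc : 0 ≤ c)
    (h1 : 1 / 2 ≤ β) (h2 : β ≤ 1) (N : ℕ) (P : Finset α) (hP : P.card = N) (hN : N ≠ 1)
    (hpair : ∀ A ⊆ P, 2 ≤ A.card → ∀ w : X → ℝ, (∀ x, 0 < w x) →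
      ∃ p ∈ A, ∃ q ∈ A, p ≠ q ∧
        (∑ x, if S p x ≠ S q x then w x else 0) ≤ c * (∑ x, w x) * (A.card : ℝ) ^ (β - 1))
    (w : X → ℝ) (hw : ∀ x, 0 < w x) :
    ∃ (m : ℕ) (parts : Fin m → Finset α),
      (∀ i j, i ≠ j → Disjoint (parts i) (parts j)) ∧
      (∀ p, p ∈ P ↔ ∃ i, p ∈ parts i) ∧
      ((∀ i, (parts i).card = 2) ∨
        (Odd N ∧ ∃ i₀, (parts i₀).card = 3 ∧ ∀ i, i ≠ i₀ → (parts i).card = 2)) ∧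
      (∑ x, w x * 2 ^ (Finset.univ.filter fun i =>
        ∃ p ∈ parts i, ∃ q ∈ parts i, S p x ≠ S q x).card) ≤
        2 * (∑ x, w x) * Real.exp (c * (N : ℝ) ^ β) := by
  induction N using Nat.strong_induction_on generalizing P w with
  | _ N ih =>
  have hW : 0 ≤ ∑ x, w x := Finset.sum_nonneg fun x _ => (hw x).le
  have hexp : 1 ≤ Real.exp (c * (N : ℝ) ^ β) := Real.one_le_exp (by positivity)
  rcases Nat.lt_or_ge N 2 with hN2 | hN2
  · obtain rfl : N = 0 := by omega
    obtain rfl := Finset.card_eq_zero.1 hP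
    refine ⟨0, Fin.elim0, fun i => i.elim0, by simp, Or.inl fun i => i.elim0, ?_⟩
    simp only [Finset.univ_eq_empty, Finset.filter_empty, Finset.card_empty, pow_zero, mul_one]
    nlinarith
  by_cases hN3 : N = 3
  · subst hN3
    refine ⟨1, fun _ => P, fun i j hij => absurd (Subsingleton.elim i j) hij, by simp,
      Or.inr ⟨by decide, 0, hP, fun i hi => absurd (Subsingleton.elim i 0) hi⟩, ?_⟩
    calc _ ≤ ∑ x, w x * 2 := by
          refine Finset.sum_le_sum fun x _ => mul_le_mul_of_nonneg_left ?_ (hw x).le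
          refine (pow_le_pow_right₀ one_le_two (Finset.card_le_univ _)).trans ?_
          simp
      _ = 2 * (∑ x, w x) := by rw [← Finset.sum_mul, mul_comm]
      _ ≤ _ := le_mul_of_one_le_right (by positivity) hexp
  obtain ⟨p, hp, q, hq, hpq, hle⟩ := hpair P subset_rfl (hP ▸ hN2) w hw
  have hsub : {p, q} ⊆ P := by
    intro r hr
    rcases Finset.mem_insert.1 hr with rfl | hr
    · exact hp
    · exact Finset.mem_singleton.1 hr ▸ hq
  have hcard : (P \ {p, q}).card = N - 2 := by
    rw [Finset.card_sdiff_of_subset hsub, hP, Finset.card_pair hpq]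
  set w' : X → ℝ := fun x => w x * 2 ^ (if S p x ≠ S q x then 1 else 0) with hw'
  obtain ⟨m, parts, hdisj, hcov, hsize, hsum⟩ := ih (N - 2) (by omega) (P \ {p, q}) hcard (by omega)
    (fun A hA => hpair A (hA.trans Finset.sdiff_subset)) w' (fun x => by have := hw x; positivity)
  have hnot : ∀ i, Disjoint {p, q} (parts i) := fun i =>
    Finset.disjoint_left.2 fun r hr hri =>
      (Finset.mem_sdiff.1 ((hcov r).2 ⟨i, hri⟩)).2 hr
  refine ⟨m + 1, Fin.cons {p, q} parts, ?_, ?_, ?_, ?_⟩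
  · intro i j hij
    cases i using Fin.cases with
    | zero =>
      cases j using Fin.cases with
      | zero => exact absurd rfl hij
      | succ j => simpa using hnot j
    | succ i =>
      cases j using Fin.cases with
      | zero => simpa using (hnot i).symm
      | succ j => exact hdisj i j fun h => hij (h ▸ rfl)
  · intro r
    rw [Fin.exists_fin_succ]
    simp only [Fin.cons_zero, Fin.cons_succ]
    rw [← hcov r, Finset.mem_sdiff]
    constructor
    · intro hr
      by_cases h : r ∈ ({p, q} : Finset α)
      · exact Or.inl h
      · exact Or.inr ⟨hr, h⟩
    · rintro (h | h)
      · exact hsub h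
      · exact h.1
  · rcases hsize with h | ⟨hodd, i₀, h3, h⟩
    · left
      intro i
      cases i using Fin.cases with
      | zero => exact Finset.card_pair hpq
      | succ i => exact h i
    · right
      refine ⟨by rw [Nat.odd_sub hN2] at hodd; simpa using hodd, i₀.succ, h3, fun i hi => ?_⟩
      cases i using Fin.cases with
      | zero => exact Finset.card_pair hpq
      | succ i => exact h i fun e => hi (e ▸ rfl)
  · have hW' : ∑ x, w' x ≤ (∑ x, w x) * Real.exp (c * (N : ℝ) ^ (β - 1)) := by
      calc ∑ x, w' x = (∑ x, w x) + ∑ x, if S p x ≠ S q x then w x else 0 := by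
            rw [← Finset.sum_add_distrib]
            refine Finset.sum_congr rfl fun x _ => ?_
            simp only [hw']
            split_ifs <;> ring
        _ ≤ (∑ x, w x) * (c * (N : ℝ) ^ (β - 1) + 1) := by
            rw [hP] at hle
            linarith
        _ ≤ _ := by gcongr; exact Real.add_one_le_exp _
    calc _ = ∑ x, w' x * 2 ^ (Finset.univ.filter fun i =>
            ∃ p ∈ parts i, ∃ q ∈ parts i, S p x ≠ S q x).card := by
          refine Finset.sum_congr rfl fun x _ => ?_
          rw [Fin.card_filter_univ_succ]
          have : (∃ r ∈ ({p, q} : Finset α), ∃ s ∈ ({p, q} : Finset α), S r x ≠ S s x) ↔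
              S p x ≠ S q x := by
            simp only [Finset.mem_insert, Finset.mem_singleton, exists_eq_or_imp, exists_eq_left]
            grind
          simp only [Fin.cons_zero, Fin.cons_succ, this, hw']
          split_ifs <;> ring
      _ ≤ 2 * (∑ x, w' x) * Real.exp (c * ((N - 2 : ℕ) : ℝ) ^ β) := hsum
      _ ≤ 2 * ((∑ x, w x) * Real.exp (c * (N : ℝ) ^ (β - 1))) *
            Real.exp (c * ((N - 2 : ℕ) : ℝ) ^ β) := by gcongr
      _ = 2 * (∑ x, w x) * Real.exp (c * ((N : ℝ) ^ (β - 1) + ((N - 2 : ℕ) : ℝ) ^ β)) := by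
          rw [mul_add, Real.exp_add]
          ring
      _ ≤ _ := by
          have hN2' : (2 : ℝ) ≤ N := by exact_mod_cast hN2
          have := rpow_sub_one_le_rpow_sub_rpow_sub_two hN2' h1 h2
          rw [Nat.cast_sub hN2]
          push_cast
          gcongr
          linarith

end Pairing

section Crossing

variable {E : Type*} [NormedAddCommGroup E] [InnerProductSpace ℝ E]

theorem convex_setOf_lt_inner (a : E) (b : ℝ) : Convex ℝ {x : E | b < ⟪x, a⟫} := by
  intro x hx y hy s t hs ht hst
  simp only [Set.mem_ofPred_eq, inner_add_left, real_inner_smul_left] at *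
  have hxb := sub_pos.2 hx
  have hyb := sub_pos.2 hy
  rcases hs.eq_or_lt with rfl | hs
  · have : t = 1 := by linarith
    subst this
    linarith
  · have := mul_pos hs hxb
    have := mul_nonneg ht hyb.le
    have : b = s * b + t * b := by rw [← add_mul, hst, one_mul]
    linarith

theorem convex_setOf_inner_le (a : E) (b : ℝ) : Convex ℝ {x : E | ⟪x, a⟫ ≤ b} := by
  intro x hx y hy s t hs ht hst
  simp only [Set.mem_ofPred_eq, inner_add_left, real_inner_smul_left] at *
  have : b = s * b + t * b := by rw [← add_mul, hst, one_mul]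
  have := mul_le_mul_of_nonneg_left hx hs
  have := mul_le_mul_of_nonneg_left hy ht
  linarith

theorem exists_one_lt_lineMap_mem_of_mem_intrinsicInterior {K : Set E} {x y : E}
    (hx : x ∈ intrinsicInterior ℝ K) (hy : y ∈ K) :
    ∃ t : ℝ, 1 < t ∧ AffineMap.lineMap y x t ∈ K := by
  obtain ⟨x', hx', rfl⟩ := mem_intrinsicInterior.1 hx
  let f : ℝ → affineSpan ℝ K := fun t =>
    ⟨AffineMap.lineMap y (x' : E) t, AffineMap.lineMap_mem t (subset_affineSpan ℝ K hy) x'.2⟩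
  have hf : Continuous f := AffineMap.lineMap_continuous.subtype_mk _
  have h1 : f 1 = x' := Subtype.ext (AffineMap.lineMap_apply_one _ _)
  have hev : ∀ᶠ t in nhds (1 : ℝ), f t ∈ interior ((↑) ⁻¹' K : Set (affineSpan ℝ K)) :=
    hf.continuousAt.eventually_mem (by rw [h1]; exact isOpen_interior.mem_nhds hx')
  obtain ⟨t, ht, ht1⟩ := ((hev.filter_mono nhdsWithin_le_nhds).and
    (self_mem_nhdsWithin : ∀ᶠ t in nhdsWithin (1 : ℝ) (Set.Ioi 1), t ∈ Set.Ioi 1)).exists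
  exact ⟨t, ht1, (interior_subset ht : f t ∈ ((↑) ⁻¹' K : Set (affineSpan ℝ K)))⟩

/-- A hyperplane crossing a set separates two of its points. -/
theorem exists_lt_inner_of_crosses {S : Set E} {a : E} {b : ℝ}
    (h : ({x | ⟪x, a⟫ = b} ∩ intrinsicInterior ℝ (convexHull ℝ S)).Nonempty)
    (hS : ¬ convexHull ℝ S ⊆ {x | ⟪x, a⟫ = b}) :
    ∃ p ∈ S, ∃ q ∈ S, b < ⟪p, a⟫ ∧ ¬ b < ⟪q, a⟫ := by
  obtain ⟨x, hxa, hx⟩ := h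
  rw [Set.mem_ofPred_eq] at hxa
  have hq : ∃ q ∈ S, ¬ b < ⟪q, a⟫ := by
    by_contra! hall
    have : b < ⟪x, a⟫ :=
      convexHull_min hall (convex_setOf_lt_inner a b) (intrinsicInterior_subset hx)
    exact absurd hxa this.ne'
  have hp : ∃ p ∈ S, b < ⟪p, a⟫ := by
    by_contra! hall
    have hle : convexHull ℝ S ⊆ {x | ⟪x, a⟫ ≤ b} := convexHull_min hall (convex_setOf_inner_le a b)
    refine hS fun y hy => ?_
    obtain ⟨t, ht, hmem⟩ := exists_one_lt_lineMap_mem_of_mem_intrinsicInterior hx hy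
    have h1 := hle hmem
    have h2 := hle hy
    simp only [Set.mem_ofPred_eq, AffineMap.lineMap_apply, vsub_eq_sub, vadd_eq_add, inner_add_left,
      real_inner_smul_left, inner_sub_left, hxa] at *
    nlinarith
  obtain ⟨p, hpS, hp⟩ := hp
  obtain ⟨q, hqS, hq⟩ := hq
  exact ⟨p, hpS, q, hqS, hp, hq⟩

/-- The traces of open halfspaces on a finite set. -/
def halfspaceTraces (P : Finset E) : Finset (Finset E) :=
  P.powerset.filter fun T => ∃ (a : E) (b : ℝ), T = P.filter fun p => b < ⟪p, a⟫

theorem card_le_of_shatters_halfspaceTraces [FiniteDimensional ℝ E] {P T : Finset E}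
    (hT : (halfspaceTraces P).Shatters T) : T ⊆ P ∧ T.card ≤ Module.finrank ℝ E + 1 := by
  have hTP : T ⊆ P := by
    obtain ⟨u, hu, hTu⟩ := hT subset_rfl
    have := Finset.mem_powerset.1 (Finset.mem_filter.1 hu).1
    exact (Finset.inter_eq_left.1 hTu).trans this
  refine ⟨hTP, ?_⟩
  by_contra! hlt
  have hdep : ¬ AffineIndependent ℝ ((↑) : T → E) := fun h => by
    have h1 := h.card_le_finrank_succ
    have h2 := Submodule.finrank_le (vectorSpan ℝ (Set.range ((↑) : T → E)))
    rw [Fintype.card_coe] at h1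
    omega
  obtain ⟨I, x, hx1, hx2⟩ := Convex.radon_partition hdep
  obtain ⟨u, hu, hTu⟩ := hT (Finset.filter_subset (fun p => ∃ h : p ∈ T, (⟨p, h⟩ : T) ∈ I) T)
  obtain ⟨-, a, b, rfl⟩ := Finset.mem_filter.1 hu
  have key : ∀ p : T, b < ⟪(p : E), a⟫ ↔ p ∈ I := by
    intro p
    have := congrArg (fun U => (p : E) ∈ U) hTu
    simpa [p.2, hTP p.2] using this
  have h1 : b < ⟪x, a⟫ := convexHull_min
    (by rintro _ ⟨p, hp, rfl⟩; exact (key p).2 hp) (convex_setOf_lt_inner a b) hx1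
  have h2 : ⟪x, a⟫ ≤ b := convexHull_min
    (by rintro _ ⟨p, hp, rfl⟩; exact not_lt.1 fun h => hp ((key p).1 h))
    (convex_setOf_inner_le a b) hx2
  exact absurd h1 h2.not_gt

theorem card_halfspaceTraces_le [FiniteDimensional ℝ E] (P : Finset E) :
    (halfspaceTraces P).card ≤ (P.card + 1) ^ (Module.finrank ℝ E + 1) :=
  (Finset.card_le_card_shatterer _).trans <|
    (Finset.card_le_card fun T hT => by
      obtain ⟨h1, h2⟩ := card_le_of_shatters_halfspaceTraces (Finset.mem_shatterer.1 hT)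
      exact Finset.mem_filter.2 ⟨Finset.mem_powerset.2 h1, h2⟩).trans
    (card_filter_card_le P _)

end Crossing

theorem IsShallowPt.exists_forall_inner_lt {d : ℕ} {P : Finset (EuclideanSpace ℝ (Fin d))}
    {p : EuclideanSpace ℝ (Fin d)} (h : IsShallowPt P 1 p) (hp : p ∈ P) :
    ∃ v, ∀ q ∈ P, q ≠ p → ⟪p, v⟫ < ⟪q, v⟫ := by
  obtain ⟨a, b, -, hpa, hcard⟩ := h
  refine ⟨a, fun q hq hqp => ?_⟩
  by_contra! hle
  exact hqp (Set.ncard_le_one_iff (P.finite_toSet.inter_of_left _) |>.1 hcard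
    ⟨hq, hle.trans hpa⟩ ⟨hp, hpa⟩)

theorem log_add_one_le_four_mul_rpow {n β : ℝ} (hn : 2 ≤ n) (hβ : 1 / 2 ≤ β) :
    Real.log (n + 1) ≤ 4 * n ^ β := by
  have hn0 : 0 < n := by linarith
  calc Real.log (n + 1) ≤ Real.log (n ^ 2) :=
        Real.log_le_log (by linarith) (by nlinarith)
    _ = 2 * Real.log n := by rw [Real.log_pow]; norm_num
    _ ≤ 2 * (n ^ β / β) := by
        gcongr
        exact Real.log_le_rpow_div hn0.le (by linarith)
    _ ≤ 2 * (n ^ β / (1 / 2)) := by gcongr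
    _ = 4 * n ^ β := by ring

theorem le_of_two_pow_le {M n k β c : ℝ} {r : ℕ} (hn : 2 ≤ n) (hβ : 1 / 2 ≤ β) (hM : 0 < M)
    (hk : 0 ≤ k) (hMk : Real.log M ≤ k * Real.log (n + 1))
    (h : (2 : ℝ) ^ r ≤ 2 * M * Real.exp (c * n ^ β)) :
    (r : ℝ) ≤ 2 * (1 + 4 * k + c) * n ^ β := by
  have h1 := Real.log_le_log (by positivity) h
  rw [Real.log_pow, Real.log_mul (by positivity) (Real.exp_pos _).ne', Real.log_exp,
    Real.log_mul two_ne_zero hM.ne'] at h1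
  have h2 := mul_le_mul_of_nonneg_left (log_add_one_le_four_mul_rpow hn hβ) hk
  have h3 : 1 ≤ n ^ β := Real.one_le_rpow (by linarith) (by linarith)
  have h4 := Real.log_two_gt_d9
  have h5 := Real.log_two_lt_d9
  have h6 : (0 : ℝ) ≤ r := Nat.cast_nonneg r
  nlinarith

/-- Corollary 4.8: matching-like partition of a set of `1`-shallow points
with small crossing number, `d ≥ 3`. -/
theorem partition_one_shallow_points_into_pairs (d : ℕ) (hd : 3 ≤ d) :
    ∃ C : ℝ, 0 < C ∧
      ∀ (P : Finset (EuclideanSpace ℝ (Fin d))) (n : ℕ),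
        P.card = n → 4 ≤ n → GenPos P → (∀ p ∈ P, IsShallowPt P 1 p) →
        ∃ (m : ℕ) (parts : Fin m → Finset (EuclideanSpace ℝ (Fin d))),
          (∀ i j, i ≠ j → Disjoint (parts i) (parts j)) ∧
          (∀ p, p ∈ P ↔ ∃ i, p ∈ parts i) ∧
          ((∀ i, (parts i).card = 2) ∨
            (Odd n ∧ ∃ i₀, (parts i₀).card = 3 ∧ ∀ i, i ≠ i₀ → (parts i).card = 2)) ∧
          (∀ (a : EuclideanSpace ℝ (Fin d)) (b : ℝ), a ≠ 0 →
            (({i : Fin m |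
                  (hyperplane a b ∩
                    intrinsicInterior ℝ (convexHull ℝ ↑(parts i))).Nonempty ∧
                  ¬ convexHull ℝ ↑(parts i) ⊆ hyperplane a b}.ncard : ℝ)
              ≤ C * (n : ℝ) ^ (1 - 1 / ((d : ℝ) - 1)) *
                  Real.logb 2 (n : ℝ) ^ (2 / ((d : ℝ) - 1)))) := by
  obtain ⟨k, rfl⟩ : ∃ k, d = k + 1 := ⟨d - 1, by omega⟩
  have hk : 2 ≤ k := by omega
  have hkR : (2 : ℝ) ≤ k := by exact_mod_cast hk
  obtain ⟨D, hD0, hD⟩ := exists_lt_two_pow k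
  have hfin : Module.finrank ℝ (EuclideanSpace ℝ (Fin (k + 1))) = k + 1 := finrank_euclideanSpace_fin
  refine ⟨2 * (1 + 4 * ((k + 2 : ℕ) : ℝ) + 64 * D), by positivity, ?_⟩
  intro P n hPn hn _ hsh
  have hnR : (4 : ℝ) ≤ n := by exact_mod_cast hn
  set β : ℝ := 1 - 1 / (k : ℝ) with hβ
  have hkinv : 1 / (k : ℝ) ≤ 1 / 2 := one_div_le_one_div_of_le two_pos hkR
  have hkinv0 : 0 ≤ 1 / (k : ℝ) := by positivity
  have hβ1 : 1 / 2 ≤ β := by linarith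
  have hβ2 : β ≤ 1 := by linarith
  have htrace : ∀ a b, P.filter (fun p => b < ⟪p, a⟫) ∈ halfspaceTraces P := fun a b =>
    Finset.mem_filter.2 ⟨Finset.mem_powerset.2 (Finset.filter_subset _ _), a, b, rfl⟩
  choose a b hab using fun T : halfspaceTraces P => (Finset.mem_filter.1 T.2).2
  have : Nonempty (halfspaceTraces P) := ⟨⟨_, htrace 0 0⟩⟩
  have hshallow : ∀ A ⊆ P, ∀ p ∈ A, ∃ v, ∀ q ∈ A, q ≠ p → ⟪p, v⟫ < ⟪q, v⟫ := by
    intro A hA p hp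
    obtain ⟨v, hv⟩ := (hsh p (hA hp)).exists_forall_inner_lt (hA hp)
    exact ⟨v, fun q hq => hv q (hA hq)⟩
  obtain ⟨m, parts, hdisj, hcov, hsize, hsum⟩ := exists_pairing_sum_le
    (fun p x => decide (b x < ⟪p, a x⟫)) (c := 64 * D) (by positivity) hβ1 hβ2 n P hPn (by omega)
    (fun A hA hA2 w hw => by
      have := exists_pair_few_separating hk hfin hD0 hD A (hshallow A hA) hA2 a b w
        (fun x => (hw x).le) (Finset.sum_pos (fun x _ => hw x) Finset.univ_nonempty)
      rwa [show -(1 / (k : ℝ)) = β - 1 by rw [hβ]; ring] at this)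
    (fun _ => 1) (fun _ => one_pos)
  refine ⟨m, parts, hdisj, hcov, hsize, fun u s _ => ?_⟩
  set x : halfspaceTraces P := ⟨_, htrace u s⟩ with hx
  have hmem : ∀ p ∈ P, (s < ⟪p, u⟫ ↔ b x < ⟪p, a x⟫) := fun p hp => by
    have := congrArg (p ∈ ·) (hab x)
    simpa [hx, hp] using this
  set R := Finset.univ.filter fun i => ∃ p ∈ parts i, ∃ q ∈ parts i,
    decide (b x < ⟪p, a x⟫) ≠ decide (b x < ⟪q, a x⟫) with hR
  have hcross : {i : Fin m |
      (hyperplane u s ∩ intrinsicInterior ℝ (convexHull ℝ ↑(parts i))).Nonempty ∧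
        ¬ convexHull ℝ ↑(parts i) ⊆ hyperplane u s}.ncard ≤ R.card := by
    rw [← Set.ncard_coe_finset]
    refine Set.ncard_le_ncard (fun i hi => ?_) R.finite_toSet
    obtain ⟨p, hp, q, hq, hps, hqs⟩ := exists_lt_inner_of_crosses hi.1 hi.2
    rw [hmem p ((hcov p).2 ⟨i, hp⟩)] at hps
    rw [hmem q ((hcov q).2 ⟨i, hq⟩)] at hqs
    exact Finset.mem_coe.2 (Finset.mem_filter.2
      ⟨Finset.mem_univ _, p, hp, q, hq, by simp only [hps, hqs]; decide⟩)
  have hM : (0 : ℝ) < (halfspaceTraces P).card := by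
    exact_mod_cast Finset.card_pos.2 ⟨_, htrace u s⟩
  have hlogM : Real.log (halfspaceTraces P).card ≤ ((k + 2 : ℕ) : ℝ) * Real.log (n + 1) := by
    rw [← Real.log_pow]
    refine Real.log_le_log hM ?_
    have := card_halfspaceTraces_le P
    rw [hfin, hPn] at this
    exact_mod_cast this
  have hpow : (2 : ℝ) ^ R.card ≤
      2 * (halfspaceTraces P).card * Real.exp (64 * D * (n : ℝ) ^ β) := by
    simp only [one_mul, Finset.sum_const, Finset.card_univ, Fintype.card_coe, nsmul_eq_mul,
      mul_one] at hsum
    exact (Finset.single_le_sum (f := fun x => (2 : ℝ) ^ (Finset.univ.filter fun i =>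
      ∃ p ∈ parts i, ∃ q ∈ parts i,
        decide (b x < ⟪p, a x⟫) ≠ decide (b x < ⟪q, a x⟫)).card)
      (fun x _ => by positivity) (Finset.mem_univ x)).trans hsum
  have hbound := le_of_two_pow_le (by linarith) hβ1 hM (Nat.cast_nonneg _) hlogM hpow
  have hd1 : ((k + 1 : ℕ) : ℝ) - 1 = k := by push_cast; ring
  have hlogb : 1 ≤ Real.logb 2 n := by
    rw [Real.le_logb_iff_rpow_le one_lt_two (by linarith), Real.rpow_one]
    linarith
  rw [hd1]
  calc _ ≤ (R.card : ℝ) := by exact_mod_cast hcross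
    _ ≤ _ := hbound
    _ ≤ _ := le_mul_of_one_le_right (by positivity) (Real.one_le_rpow hlogb (by positivity))
end
end

section
/- For every integer d ≥ 3 there is a constant C = C(d) with the following property. Let P be a set of n points in ℝ^d in general position, with n even. Then there exists a coloring χ : P → {−1, +1} with exactly n/2 points of each color such that for every closed halfspace H, | ∑_{p ∈ P ∩ H} χ(p) | ≤ C · n^{(d−2)/(2(d−1))} · |P ∩ H|^{1/(2d(d−1))} · (log₂ n)^{(d+1)/(2(d−1))}. -/
open scoped RealInnerProductSpace
open scoped Classical

noncomputable section


/-- The set of indices `i ∈ I` whose halfspace `φ i ≤ 0` contains `x`. -/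
def trace {ι E : Type*} [AddCommGroup E] [Module ℝ E] (φ : ι → E →ᵃ[ℝ] ℝ) (I : Finset ι) (x : E) :
    Finset ι :=
  I.filter fun i => φ i x ≤ 0

/-- The zero set of an affine functional. -/
def zeroLocus {E : Type*} [AddCommGroup E] [Module ℝ E] (f : E →ᵃ[ℝ] ℝ) : AffineSubspace ℝ E :=
  (AffineSubspace.mk' (0 : ℝ) ⊥).comap f

section Geometry

variable {ι E : Type*} [AddCommGroup E] [Module ℝ E]

lemma mem_zeroLocus {f : E →ᵃ[ℝ] ℝ} {x : E} : x ∈ zeroLocus f ↔ f x = 0 := by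
  simp [zeroLocus, AffineSubspace.mem_comap, AffineSubspace.mem_mk']

lemma mem_trace {φ : ι → E →ᵃ[ℝ] ℝ} {I : Finset ι} {x : E} {i : ι} :
    i ∈ trace φ I x ↔ i ∈ I ∧ φ i x ≤ 0 := by
  simp [trace]

lemma trace_subset (φ : ι → E →ᵃ[ℝ] ℝ) (I : Finset ι) (x : E) : trace φ I x ⊆ I :=
  Finset.filter_subset _ _

lemma trace_erase [DecidableEq ι] (φ : ι → E →ᵃ[ℝ] ℝ) (I : Finset ι) (a : ι) (x : E) :
    trace φ (I.erase a) x = (trace φ I x).erase a := by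
  ext i; simp [mem_trace, and_assoc]

/-- If two points of `V` have the same trace but lie on different sides of `f`, then some point
of `V` on the zero set of `f` has that trace as well. -/
lemma exists_mem_zeroLocus_trace_eq {φ : ι → E →ᵃ[ℝ] ℝ} {I : Finset ι} {V : AffineSubspace ℝ E}
    {f : E →ᵃ[ℝ] ℝ} {x y : E} (hx : x ∈ V) (hy : y ∈ V) (hfx : f x ≤ 0) (hfy : 0 < f y)
    (h : trace φ I x = trace φ I y) :
    ∃ z ∈ V ⊓ zeroLocus f, trace φ I z = trace φ I x := by
  have hd : 0 < f y - f x := by linarith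
  obtain ⟨t, ht⟩ : ∃ t, t = -f x / (f y - f x) := ⟨_, rfl⟩
  have ht0 : 0 ≤ t := by rw [ht]; exact div_nonneg (by linarith) hd.le
  have ht1 : t ≤ 1 := by rw [ht, div_le_one hd]; linarith
  have key (g : E →ᵃ[ℝ] ℝ) : g (AffineMap.lineMap x y t) = (1 - t) * g x + t * g y := by
    rw [AffineMap.apply_lineMap, AffineMap.lineMap_apply_module]; simp
  refine ⟨AffineMap.lineMap x y t, ⟨AffineMap.lineMap_mem t hx hy, ?_⟩, ?_⟩
  · refine mem_zeroLocus.2 ?_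
    rw [key, ht]; field_simp; ring
  · ext i
    have hi := Finset.ext_iff.1 h i
    simp only [mem_trace] at hi ⊢
    refine and_congr_right fun hI => ?_
    simp only [hI, true_and] at hi
    rw [key]
    constructor
    · intro hz
      by_contra hxi
      have hyi : ¬ φ i y ≤ 0 := fun hyi => hxi (hi.2 hyi)
      push Not at hxi hyi
      rcases ht0.lt_or_eq with h0 | h0
      · nlinarith [mul_pos h0 hyi, mul_nonneg (sub_nonneg.2 ht1) hxi.le]
      · subst h0; linarith
    · intro hxi
      nlinarith [mul_nonneg ht0 (neg_nonneg.2 (hi.1 hxi)),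
        mul_nonneg (sub_nonneg.2 ht1) (neg_nonneg.2 hxi)]

lemma finrank_direction_inf_zeroLocus_lt [FiniteDimensional ℝ E] {V : AffineSubspace ℝ E}
    {f : E →ᵃ[ℝ] ℝ} {y z : E} (hz : z ∈ V ⊓ zeroLocus f) (hy : y ∈ V) (hfy : 0 < f y) :
    Module.finrank ℝ (V ⊓ zeroLocus f).direction < Module.finrank ℝ V.direction := by
  refine Submodule.finrank_lt_finrank_of_lt (AffineSubspace.direction_lt_of_nonempty ?_ ⟨z, hz⟩)
  refine lt_of_le_of_ne inf_le_left fun h => ?_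
  have : y ∈ V ⊓ zeroLocus f := by rwa [h]
  exact hfy.ne' (mem_zeroLocus.1 this.2)

lemma min_add_min_le (a b c d : ℝ) :
    min a c + min b d ≤ min (max a b) (max c d) + min (min a b) (min c d) := by
  rcases le_total a b with h1 | h1 <;> rcases le_total c d with h2 | h2 <;>
    simp only [max_eq_left, max_eq_right, min_eq_left, min_eq_right, h1, h2]
  · linarith
  · rcases le_total a c with h3 | h3 <;> rcases le_total b d with h4 | h4 <;>
    rcases le_total b c with h5 | h5 <;> rcases le_total a d with h6 | h6 <;>
      simp only [min_eq_left, min_eq_right, h3, h4, h5, h6] <;> linarith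
  · rcases le_total a c with h3 | h3 <;> rcases le_total b d with h4 | h4 <;>
    rcases le_total b c with h5 | h5 <;> rcases le_total a d with h6 | h6 <;>
      simp only [min_eq_left, min_eq_right, h3, h4, h5, h6] <;> linarith
  · linarith

/-- Weighted form of Haussler's bound on the number of edges of the unit distance graph, for
weights supported on the cells of an arrangement in dimension `e`. -/
lemma sum_min_insert_le [DecidableEq ι] [FiniteDimensional ℝ E] (φ : ι → E →ᵃ[ℝ] ℝ) (I : Finset ι) :
    ∀ (e : ℕ) (V : AffineSubspace ℝ E), Module.finrank ℝ V.direction ≤ e →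
    ∀ w : Finset ι → ℝ, (∀ u, 0 ≤ w u) → (∀ u ⊆ I, w u ≠ 0 → ∃ x ∈ V, trace φ I x = u) →
      ∑ b ∈ I, ∑ u ∈ (I.erase b).powerset, min (w u) (w (insert b u))
        ≤ e * ∑ u ∈ I.powerset, w u := by
  induction I using Finset.induction_on with
  | empty =>
    intro e V _ w hw _
    simpa using mul_nonneg (Nat.cast_nonneg (α := ℝ) e) (hw ∅)
  | insert a J ha ih =>
    intro e V hV w hw hsupp
    have herase {x : E} {u : Finset ι} (hu : trace φ (insert a J) x = u) :
        trace φ J x = u.erase a := by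
      rw [← hu, ← trace_erase, Finset.erase_insert ha]
    set w1 : Finset ι → ℝ := fun u => max (w u) (w (insert a u))
    set w2 : Finset ι → ℝ := fun u => min (w u) (w (insert a u))
    have hw1 : ∀ u, 0 ≤ w1 u := fun u => le_max_of_le_left (hw u)
    have hw2 : ∀ u, 0 ≤ w2 u := fun u => le_min (hw u) (hw _)
    have h1 := ih e V hV w1 hw1 (by
      intro u hu hne
      have hau : a ∉ u := fun h => ha (hu h)
      by_cases h0 : w u = 0
      · obtain ⟨x, hx, hxu⟩ := hsupp (insert a u) (Finset.insert_subset_insert a hu) (by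
          intro h; exact hne (by simp [w1, h0, h]))
        exact ⟨x, hx, by rw [herase hxu, Finset.erase_insert hau]⟩
      · obtain ⟨x, hx, hxu⟩ := hsupp u (hu.trans (Finset.subset_insert a J)) h0
        exact ⟨x, hx, by rw [herase hxu, Finset.erase_eq_of_notMem hau]⟩)
    have h2 : (∑ b ∈ J, ∑ u ∈ (J.erase b).powerset, min (w2 u) (w2 (insert b u)))
        + ∑ u ∈ J.powerset, w2 u ≤ e * ∑ u ∈ J.powerset, w2 u := by
      by_cases hz : ∀ u ⊆ J, w2 u = 0
      · have e1 : ∑ u ∈ J.powerset, w2 u = 0 :=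
          Finset.sum_eq_zero fun u hu => hz u (Finset.mem_powerset.1 hu)
        have e2 : ∑ b ∈ J, ∑ u ∈ (J.erase b).powerset, min (w2 u) (w2 (insert b u)) = 0 := by
          refine Finset.sum_eq_zero fun b hb => Finset.sum_eq_zero fun u hu => ?_
          have hu' := (Finset.mem_powerset.1 hu).trans (Finset.erase_subset b J)
          rw [hz u hu', hz _ (Finset.insert_subset hb hu'), min_self]
        rw [e1, e2]; simp
      · have hcross (u : Finset ι) (hu : u ⊆ J) (hne : w2 u ≠ 0) :
            ∃ z ∈ V ⊓ zeroLocus (φ a), trace φ J z = u ∧ ∃ y ∈ V, 0 < φ a y := by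
          have hau : a ∉ u := fun h => ha (hu h)
          have hpos : 0 < w2 u := lt_of_le_of_ne (hw2 u) hne.symm
          obtain ⟨y, hy, hyu⟩ := hsupp u (hu.trans (Finset.subset_insert a J))
            (lt_of_lt_of_le hpos (min_le_left _ _)).ne'
          obtain ⟨x, hx, hxu⟩ := hsupp (insert a u) (Finset.insert_subset_insert a hu)
            (lt_of_lt_of_le hpos (min_le_right _ _)).ne'
          have hxa : φ a x ≤ 0 := (mem_trace.1 (hxu ▸ Finset.mem_insert_self a u)).2
          have hya : 0 < φ a y := by
            by_contra h
            exact hau (hyu ▸ mem_trace.2 ⟨Finset.mem_insert_self a J, not_lt.1 h⟩)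
          have hxJ : trace φ J x = u := by rw [herase hxu, Finset.erase_insert hau]
          have hyJ : trace φ J y = u := by rw [herase hyu, Finset.erase_eq_of_notMem hau]
          obtain ⟨z, hz, hzx⟩ :=
            exists_mem_zeroLocus_trace_eq hx hy hxa hya (hxJ.trans hyJ.symm)
          exact ⟨z, hz, hzx.trans hxJ, y, hy, hya⟩
        push Not at hz
        obtain ⟨u, hu, hne⟩ := hz
        obtain ⟨z, hz, -, y, hy, hya⟩ := hcross u hu hne
        have hlt := (finrank_direction_inf_zeroLocus_lt hz hy hya).trans_le hV
        obtain ⟨e, rfl⟩ : ∃ e', e = e' + 1 := ⟨e - 1, by omega⟩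
        have := ih e (V ⊓ zeroLocus (φ a)) (by omega) w2 hw2 fun u hu hne => by
          obtain ⟨z, hz, hzu, -⟩ := hcross u hu hne
          exact ⟨z, hz, hzu⟩
        push_cast
        linarith
    have h3 : ∑ u ∈ (insert a J).powerset, w u
        = ∑ u ∈ J.powerset, w1 u + ∑ u ∈ J.powerset, w2 u := by
      rw [Finset.sum_powerset_insert ha, ← Finset.sum_add_distrib, ← Finset.sum_add_distrib]
      exact Finset.sum_congr rfl fun u _ => (max_add_min _ _).symm
    have h4 : ∀ b ∈ J, ∑ u ∈ ((insert a J).erase b).powerset, min (w u) (w (insert b u))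
        ≤ (∑ u ∈ (J.erase b).powerset, min (w1 u) (w1 (insert b u)))
          + ∑ u ∈ (J.erase b).powerset, min (w2 u) (w2 (insert b u)) := by
      intro b hb
      have hab : a ≠ b := fun h => ha (h ▸ hb)
      rw [Finset.erase_insert_of_ne hab,
        Finset.sum_powerset_insert (fun h => ha (Finset.mem_of_mem_erase h)),
        ← Finset.sum_add_distrib, ← Finset.sum_add_distrib]
      refine Finset.sum_le_sum fun u _ => ?_
      simp only [w1, w2]
      rw [Finset.insert_comm b a u]
      exact min_add_min_le _ _ _ _
    rw [Finset.sum_insert ha, Finset.erase_insert ha, h3, mul_add]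
    have h5 := Finset.sum_le_sum h4
    rw [Finset.sum_add_distrib] at h5
    linarith

/-- The cells of the arrangement of `φ 0, …, φ (j - 1)` in `V` that lie in at most `l i` of the
first `i` halfspaces, for every `i ≤ j`. -/
def shallowCells (φ : ℕ → E →ᵃ[ℝ] ℝ) (l : ℕ → ℝ) (V : AffineSubspace ℝ E) (j : ℕ) :
    Finset (Finset ℕ) :=
  (Finset.range j).powerset.filter fun u =>
    (∃ x ∈ V, trace φ (Finset.range j) x = u) ∧ ∀ i ≤ j, ((u ∩ Finset.range i).card : ℝ) ≤ l i

lemma mem_shallowCells {φ : ℕ → E →ᵃ[ℝ] ℝ} {l : ℕ → ℝ} {V : AffineSubspace ℝ E} {j : ℕ}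
    {u : Finset ℕ} : u ∈ shallowCells φ l V j ↔ (∃ x ∈ V, trace φ (Finset.range j) x = u) ∧
      ∀ i ≤ j, ((u ∩ Finset.range i).card : ℝ) ≤ l i := by
  refine ⟨fun h => (Finset.mem_filter.1 h).2, fun h => Finset.mem_filter.2 ⟨?_, h⟩⟩
  obtain ⟨⟨x, -, rfl⟩, -⟩ := h
  exact Finset.mem_powerset.2 (trace_subset _ _ _)

lemma card_shallowCells_zero_le (φ : ℕ → E →ᵃ[ℝ] ℝ) (l : ℕ → ℝ) (V : AffineSubspace ℝ E) :
    (shallowCells φ l V 0).card ≤ 1 := by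
  refine (Finset.card_filter_le _ _).trans ?_
  simp

lemma card_shallowCells_succ_le (φ : ℕ → E →ᵃ[ℝ] ℝ) (l : ℕ → ℝ) (V : AffineSubspace ℝ E) (j : ℕ) :
    (shallowCells φ l V (j + 1)).card
      ≤ (shallowCells φ l V j).card +
        if ∃ y ∈ V, 0 < φ j y then (shallowCells φ l (V ⊓ zeroLocus (φ j)) j).card else 0 := by
  set T := shallowCells φ l V (j + 1)
  have hrange : (Finset.range (j + 1)).erase j = Finset.range j := by
    ext i; simp; omega
  have hT {u : Finset ℕ} (hu : u ∈ T) : u.erase j ∈ shallowCells φ l V j := by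
    obtain ⟨⟨x, hx, hxu⟩, hs⟩ := mem_shallowCells.1 hu
    refine mem_shallowCells.2 ⟨⟨x, hx, by rw [← hxu, ← trace_erase, hrange]⟩, fun i hi => ?_⟩
    refine le_trans ?_ (hs i (by omega))
    exact_mod_cast Finset.card_le_card
      (Finset.inter_subset_inter_right (Finset.erase_subset j u))
  set A := T.filter fun u => j ∉ u
  set B := (T.filter fun u => ¬ j ∉ u).image fun u => u.erase j
  have hB : B.card = (T.filter fun u => ¬ j ∉ u).card := by
    refine Finset.card_image_of_injOn fun u hu v hv huv => ?_
    simp only [not_not, Finset.coe_filter, Set.mem_ofPred_eq] at hu hv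
    rw [← Finset.insert_erase hu.2, huv, Finset.insert_erase hv.2]
  have hcard : T.card = A.card + B.card := by
    rw [hB]; exact (Finset.card_filter_add_card_filter_not _).symm
  rw [hcard, ← Finset.card_union_add_card_inter]
  refine add_le_add (Finset.card_le_card ?_) ?_
  · refine Finset.union_subset (fun u hu => ?_) (fun u hu => ?_)
    · obtain ⟨hu, hj⟩ := Finset.mem_filter.1 hu
      simpa [Finset.erase_eq_of_notMem hj] using hT hu
    · obtain ⟨v, hv, rfl⟩ := Finset.mem_image.1 hu
      exact hT (Finset.mem_filter.1 hv).1
  · have hpos {u : Finset ℕ} (hu : u ∈ A) : ∃ y ∈ V, 0 < φ j y ∧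
        trace φ (Finset.range j) y = u ∧ ∀ i ≤ j + 1, ((u ∩ Finset.range i).card : ℝ) ≤ l i := by
      obtain ⟨huT, hju⟩ := Finset.mem_filter.1 hu
      obtain ⟨⟨y, hy, hyu⟩, hs⟩ := mem_shallowCells.1 huT
      refine ⟨y, hy, ?_, ?_, hs⟩
      · by_contra h
        exact hju (hyu ▸ mem_trace.2 ⟨by simp, not_lt.1 h⟩)
      · rw [← hrange, trace_erase, hyu, Finset.erase_eq_of_notMem hju]
    split_ifs with hex
    swap
    · rw [Nat.le_zero, Finset.card_eq_zero]
      refine Finset.eq_empty_of_forall_notMem fun u hu => ?_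
      obtain ⟨y, hy, hyj, -⟩ := hpos (Finset.mem_inter.1 hu).1
      exact hex ⟨y, hy, hyj⟩
    refine Finset.card_le_card fun u hu => ?_
    obtain ⟨huA, huB⟩ := Finset.mem_inter.1 hu
    obtain ⟨y, hy, hyj, hyr, hs⟩ := hpos huA
    obtain ⟨v, hv, hvu⟩ := Finset.mem_image.1 huB
    obtain ⟨hvT, hjv⟩ := Finset.mem_filter.1 hv
    rw [not_not] at hjv
    obtain ⟨⟨x, hx, hxv⟩, -⟩ := mem_shallowCells.1 hvT
    have hxj : φ j x ≤ 0 := (mem_trace.1 (hxv ▸ hjv)).2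
    have hxr : trace φ (Finset.range j) x = u := by rw [← hrange, trace_erase, hxv, hvu]
    obtain ⟨z, hz, hzx⟩ := exists_mem_zeroLocus_trace_eq hx hy hxj hyj (hxr.trans hyr.symm)
    exact mem_shallowCells.2 ⟨⟨z, hz, hzx.trans hxr⟩, fun i hi => hs i (by omega)⟩

/-- An inductive scheme for bounding the number of shallow cells by `F e j` in dimension `e`. -/
lemma card_shallowCells_le_of_rec [FiniteDimensional ℝ E] {φ : ℕ → E →ᵃ[ℝ] ℝ} {l : ℕ → ℝ}
    {F : ℕ → ℕ → ℝ} {e₀ : ℕ}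
    (hbase : ∀ V : AffineSubspace ℝ E, Module.finrank ℝ V.direction ≤ e₀ →
      ∀ j, ((shallowCells φ l V j).card : ℝ) ≤ F e₀ j)
    (hzero : ∀ e, e₀ ≤ e → 1 ≤ F e 0) (hnonneg : ∀ e, e₀ ≤ e → ∀ j, 0 ≤ F e j)
    (hrec : ∀ e, e₀ ≤ e → ∀ j, F (e + 1) j + F e j ≤ F (e + 1) (j + 1)) (e : ℕ) (he : e₀ ≤ e) :
    ∀ V : AffineSubspace ℝ E, Module.finrank ℝ V.direction ≤ e →
      ∀ j, ((shallowCells φ l V j).card : ℝ) ≤ F e j := by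
  induction e, he using Nat.le_induction with
  | base => exact hbase
  | succ e he ih =>
    intro V hV j
    induction j with
    | zero => exact le_trans (by exact_mod_cast card_shallowCells_zero_le φ l V) (hzero _ (by omega))
    | succ j ihj =>
      have hsucc := card_shallowCells_succ_le φ l V j
      have hle : ((if ∃ y ∈ V, 0 < φ j y then
          (shallowCells φ l (V ⊓ zeroLocus (φ j)) j).card else 0 : ℕ) : ℝ) ≤ F e j := by
        split_ifs with hex
        swap
        · simpa using hnonneg e he j
        obtain ⟨y, hy, hyj⟩ := hex
        rcases (shallowCells φ l (V ⊓ zeroLocus (φ j)) j).eq_empty_or_nonempty with h0 | ⟨u, hu⟩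
        · simpa [h0] using hnonneg e he j
        · obtain ⟨⟨z, hz, -⟩, -⟩ := mem_shallowCells.1 hu
          have := finrank_direction_inf_zeroLocus_lt hz hy hyj
          exact ih _ (by omega) j
      refine le_trans ?_ (hrec e he j)
      refine le_trans (by exact_mod_cast hsucc) (add_le_add ihj hle)

end Geometry

section CellCounting

variable {E : Type*} [AddCommGroup E] [Module ℝ E] [FiniteDimensional ℝ E]

lemma card_shallowCells_le_of_finrank_le_one (φ : ℕ → E →ᵃ[ℝ] ℝ) {l : ℕ → ℝ}
    {V : AffineSubspace ℝ E} (hV : Module.finrank ℝ V.direction ≤ 1) (j : ℕ) (hl : 0 ≤ l j) :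
    ((shallowCells φ l V j).card : ℝ) ≤ 2 * l j + 1 := by
  rcases (V : Set E).eq_empty_or_nonempty with h0 | ⟨p, hp⟩
  · have : shallowCells φ l V j = ∅ := by
      refine Finset.eq_empty_of_forall_notMem fun u hu => ?_
      obtain ⟨⟨x, hx, -⟩, -⟩ := mem_shallowCells.1 hu
      exact (Set.eq_empty_iff_forall_notMem.1 h0) x hx
    rw [this]; simp; linarith
  obtain ⟨v, hv⟩ := finrank_le_one_iff.1 hV
  have hpar {x : E} (hx : x ∈ V) : ∃ c : ℝ, ∀ i, φ i x = c * (φ i).linear v + φ i p := by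
    obtain ⟨c, hc⟩ := hv ⟨x -ᵥ p, AffineSubspace.vsub_mem_direction hx hp⟩
    refine ⟨c, fun i => ?_⟩
    have hc' : c • (v : E) = x -ᵥ p := congrArg Subtype.val hc
    have : x = c • (v : E) +ᵥ p := by rw [hc']; simp
    rw [this, AffineMap.map_vadd]; simp
  set val : Finset ℕ → ℤ := fun u => ((u.filter fun i => (φ i).linear v ≤ 0).card : ℤ)
    - (u.filter fun i => ¬ (φ i).linear v ≤ 0).card
  have hinj : Set.InjOn val (shallowCells φ l V j) := by
    have key {x x' : E} {c c' : ℝ} (hc : ∀ i, φ i x = c * (φ i).linear v + φ i p)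
        (hc' : ∀ i, φ i x' = c' * (φ i).linear v + φ i p) (hcc : c ≤ c')
        (h : val (trace φ (Finset.range j) x) = val (trace φ (Finset.range j) x')) :
        trace φ (Finset.range j) x = trace φ (Finset.range j) x' := by
      set u := trace φ (Finset.range j) x
      set u' := trace φ (Finset.range j) x'
      have h1 : (u.filter fun i => (φ i).linear v ≤ 0) ⊆ u'.filter fun i => (φ i).linear v ≤ 0 := by
        intro i hi
        obtain ⟨hi, hs⟩ := Finset.mem_filter.1 hi
        obtain ⟨hj, hx⟩ := mem_trace.1 hi
        refine Finset.mem_filter.2 ⟨mem_trace.2 ⟨hj, ?_⟩, hs⟩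
        rw [hc] at hx; rw [hc']
        nlinarith
      have h2 : (u'.filter fun i => ¬ (φ i).linear v ≤ 0)
          ⊆ u.filter fun i => ¬ (φ i).linear v ≤ 0 := by
        intro i hi
        obtain ⟨hi, hs⟩ := Finset.mem_filter.1 hi
        obtain ⟨hj, hx⟩ := mem_trace.1 hi
        refine Finset.mem_filter.2 ⟨mem_trace.2 ⟨hj, ?_⟩, hs⟩
        rw [hc'] at hx; rw [hc]
        nlinarith
      have c1 := Finset.card_le_card h1
      have c2 := Finset.card_le_card h2
      simp only [val] at h
      have e1 := Finset.eq_of_subset_of_card_le h1 (by omega)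
      have e2 := Finset.eq_of_subset_of_card_le h2 (by omega)
      rw [← Finset.filter_union_filter_not_eq (fun i => (φ i).linear v ≤ 0) u, e1, ← e2,
        Finset.filter_union_filter_not_eq]
    intro u hu u' hu' h
    obtain ⟨⟨x, hx, rfl⟩, -⟩ := mem_shallowCells.1 hu
    obtain ⟨⟨x', hx', rfl⟩, -⟩ := mem_shallowCells.1 hu'
    obtain ⟨c, hc⟩ := hpar hx
    obtain ⟨c', hc'⟩ := hpar hx'
    rcases le_total c c' with hcc | hcc
    · exact key hc hc' hcc h
    · exact (key hc' hc hcc h.symm).symm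
  have hmaps : ∀ u ∈ shallowCells φ l V j, val u ∈ Finset.Icc (-(⌊l j⌋₊ : ℤ)) ⌊l j⌋₊ := by
    intro u hu
    obtain ⟨⟨x, hx, hxu⟩, hs⟩ := mem_shallowCells.1 hu
    have hcard := hs j le_rfl
    rw [Finset.inter_eq_left.2 (hxu ▸ trace_subset _ _ _)] at hcard
    have hu := Nat.le_floor hcard
    have h1 := Finset.card_filter_le u fun i => (φ i).linear v ≤ 0
    have h2 := Finset.card_filter_le u fun i => ¬ (φ i).linear v ≤ 0
    simp only [Finset.mem_Icc, val]
    omega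
  have hle := Finset.card_le_card_of_injOn val hmaps hinj
  rw [Int.card_Icc] at hle
  have hle' : (shallowCells φ l V j).card ≤ 2 * ⌊l j⌋₊ + 1 := by omega
  have : ((shallowCells φ l V j).card : ℝ) ≤ 2 * ⌊l j⌋₊ + 1 := by exact_mod_cast hle'
  linarith [Nat.floor_le hl]

lemma card_shallowCells_le (φ : ℕ → E →ᵃ[ℝ] ℝ) {l y : ℕ → ℝ} {c N : ℝ} {d : ℕ} (hd : 1 ≤ d)
    (hE : Module.finrank ℝ E ≤ d) (hy : Monotone y) (hy1 : ∀ i, 1 ≤ y i) (hN : 0 < N)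
    (hc : 1 ≤ c) (hl0 : ∀ j, 0 ≤ l j)
    (hl : ∀ j, 2 * l j + 1 ≤ c * (1 + (∑ i ∈ Finset.range j, y i ^ d) / N)) (j : ℕ) :
    ((shallowCells φ l ⊤ j).card : ℝ)
      ≤ c * (((j : ℝ) + 1) ^ (d - 1) + (∑ i ∈ Finset.range j, y i) ^ d / N) := by
  set Y : ℕ → ℝ := fun j => ∑ i ∈ Finset.range j, y i
  have hy0 : ∀ i, 0 ≤ y i := fun i => zero_le_one.trans (hy1 i)
  have hY0 : ∀ j, 0 ≤ Y j := fun j => Finset.sum_nonneg fun i _ => hy0 i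
  set F : ℕ → ℕ → ℝ := fun e j =>
    c * (((j : ℝ) + 1) ^ (e - 1) + Y j ^ e * y j ^ (d - e) / N)
  have hterm (e j : ℕ) : 0 ≤ Y j ^ e * y j ^ (d - e) / N :=
    div_nonneg (mul_nonneg (pow_nonneg (hY0 j) _) (pow_nonneg (hy0 j) _)) hN.le
  have main := card_shallowCells_le_of_rec (φ := φ) (l := l) (F := F) (e₀ := 1) ?_ ?_ ?_ ?_ d hd ⊤
    (by rwa [AffineSubspace.direction_top, finrank_top]) j
  · simpa [F, Y] using main
  · intro V hV j
    refine (card_shallowCells_le_of_finrank_le_one φ hV j (hl0 j)).trans ((hl j).trans ?_)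
    simp only [F, Nat.sub_self, pow_zero, pow_one]
    gcongr
    rw [Finset.sum_mul]
    refine Finset.sum_le_sum fun i hi => ?_
    have hij : y i ≤ y j := hy (Finset.mem_range.1 hi).le
    obtain ⟨d, rfl⟩ : ∃ k, d = k + 1 := ⟨d - 1, by omega⟩
    rw [pow_succ', Nat.add_sub_cancel]
    exact mul_le_mul_of_nonneg_left (pow_le_pow_left₀ (hy0 i) hij _) (hy0 i)
  · intro e he
    have := hterm e 0
    simp only [F, Nat.cast_zero, zero_add, one_pow]
    nlinarith
  · intro e he j
    have := hterm e j
    simp only [F]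
    positivity
  · intro e he j
    obtain ⟨e, rfl⟩ : ∃ k, e = k + 1 := ⟨e - 1, by omega⟩
    simp only [F, Nat.add_sub_cancel]
    rw [← mul_add]
    refine mul_le_mul_of_nonneg_left ?_ (by linarith)
    have h1 : ((j : ℝ) + 1) ^ (e + 1) + ((j : ℝ) + 1) ^ e ≤ (((j + 1 : ℕ) : ℝ) + 1) ^ (e + 1) := by
      calc ((j : ℝ) + 1) ^ (e + 1) + ((j : ℝ) + 1) ^ e
          = ((j : ℝ) + 1) ^ e * ((j : ℝ) + 1 + 1) := by ring
        _ ≤ ((j : ℝ) + 1 + 1) ^ e * ((j : ℝ) + 1 + 1) := by gcongr; linarith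
        _ = _ := by push_cast; ring
    have h2 : Y j ^ (e + 1 + 1) * y j ^ (d - (e + 1 + 1)) + Y j ^ (e + 1) * y j ^ (d - (e + 1))
        ≤ Y (j + 1) ^ (e + 1 + 1) * y (j + 1) ^ (d - (e + 1 + 1)) := by
      have hYs : Y (j + 1) = Y j + y j := Finset.sum_range_succ _ _
      have hYle : Y j ≤ Y (j + 1) := by rw [hYs]; linarith [hy0 j]
      have hpow : y j ^ (d - (e + 1)) ≤ y j ^ (d - (e + 1 + 1)) * y j := by
        rw [← pow_succ]
        exact pow_le_pow_right₀ (hy1 j) (by omega)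
      calc _ ≤ Y j ^ (e + 1 + 1) * y j ^ (d - (e + 1 + 1))
            + Y j ^ (e + 1) * (y j ^ (d - (e + 1 + 1)) * y j) := by
              gcongr
              exact pow_nonneg (hY0 j) _
        _ = Y j ^ (e + 1) * Y (j + 1) * y j ^ (d - (e + 1 + 1)) := by rw [hYs]; ring
        _ ≤ Y (j + 1) ^ (e + 1) * Y (j + 1) * y (j + 1) ^ (d - (e + 1 + 1)) := by
              have := hY0 j; have := hY0 (j + 1); have := hy0 j
              gcongr
              exact hy (Nat.le_succ j)
        _ = _ := by ring
    have h3 := div_le_div_of_nonneg_right h2 hN.le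
    rw [add_div] at h3
    linarith

end CellCounting

/-- A set of points that are pairwise separated by the halfspaces `φ 0, …, φ (s - 1)` and contains
most of `Q` is small if the halfspaces contain few points of `Q`. -/
lemma card_le_of_injOn_trace {E : Type*} [AddCommGroup E] [Module ℝ E] [FiniteDimensional ℝ E]
    {d : ℕ} (hd : 1 ≤ d) (hE : Module.finrank ℝ E ≤ d) (φ : ℕ → E →ᵃ[ℝ] ℝ) {y : ℕ → ℝ}
    {Q Q' : Finset E} (hy : Monotone y) (hy1 : ∀ i, 1 ≤ y i)
    (hcount : ∀ i, ((Q.filter fun p => φ i p ≤ 0).card : ℝ) ≤ y i ^ d)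
    (hyQ : ∀ i, y i ^ d ≤ Q.card) {s : ℕ} (hs : 1 ≤ s) (hQ' : Q' ⊆ Q)
    (hcard : 3 / 4 * (Q.card : ℝ) ≤ Q'.card)
    (hinj : Set.InjOn (trace φ (Finset.range s)) Q') :
    (Q.card : ℝ) / 2 ≤ (8 * Real.log (s + 1) + 1) *
      (((s : ℝ) + 1) ^ (d - 1) + (∑ i ∈ Finset.range s, y i) ^ d / Q.card) := by
  have hN : (0 : ℝ) < Q.card := lt_of_lt_of_le (by have := one_le_pow₀ (n := d) (hy1 0); linarith)
    (hyQ 0)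
  set N : ℝ := (Q.card : ℝ)
  set lam : ℕ → ℝ := fun j => (∑ i ∈ Finset.range j, y i ^ d) / N
  have hyd : ∀ i, 0 ≤ y i ^ d := fun i => pow_nonneg (zero_le_one.trans (hy1 i)) _
  have hlam0 : ∀ j, 0 ≤ lam j := fun j => div_nonneg (Finset.sum_nonneg fun i _ => hyd i) hN.le
  have hlamS : ∀ j, lam (j + 1) = lam j + y j ^ d / N := fun j => by
    simp only [lam, Finset.sum_range_succ, add_div]
  have hlam_mono : Monotone lam := monotone_nat_of_le_succ fun j => by
    rw [hlamS]; linarith [div_nonneg (hyd j) hN.le]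
  have hlog : 0 < Real.log ((s : ℝ) + 1) := Real.log_pos (by
    have : (1 : ℝ) ≤ s := by exact_mod_cast hs
    linarith)
  set T : ℝ := 4 * Real.log (s + 1)
  set Z : E → ℝ := fun p => ∑ i ∈ trace φ (Finset.range s) p, (lam (i + 1) + 1)⁻¹
  have hZsum : ∑ p ∈ Q, Z p ≤ N * Real.log (s + 1) := by
    have h1 : ∑ p ∈ Q, Z p = ∑ i ∈ Finset.range s,
        ((Q.filter fun p => φ i p ≤ 0).card : ℝ) * (lam (i + 1) + 1)⁻¹ := by
      simp only [Z, trace, Finset.sum_filter]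
      rw [Finset.sum_comm]
      refine Finset.sum_congr rfl fun i _ => ?_
      rw [← Finset.sum_filter, Finset.sum_const, nsmul_eq_mul]
    have h2 : ∀ i ∈ Finset.range s,
        ((Q.filter fun p => φ i p ≤ 0).card : ℝ) * (lam (i + 1) + 1)⁻¹
          ≤ N * (Real.log (lam (i + 1) + 1) - Real.log (lam i + 1)) := by
      intro i _
      have p1 : 0 < lam (i + 1) + 1 := by linarith [hlam0 (i + 1)]
      have p0 : 0 < lam i + 1 := by linarith [hlam0 i]
      have h3 := Real.log_le_sub_one_of_pos (div_pos p0 p1)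
      rw [Real.log_div p0.ne' p1.ne'] at h3
      have h4 : y i ^ d = N * (lam (i + 1) - lam i) := by rw [hlamS]; field_simp; ring
      calc _ ≤ y i ^ d * (lam (i + 1) + 1)⁻¹ :=
            mul_le_mul_of_nonneg_right (hcount i) (inv_nonneg.2 p1.le)
        _ = N * (1 - (lam i + 1) / (lam (i + 1) + 1)) := by rw [h4]; field_simp; ring
        _ ≤ _ := mul_le_mul_of_nonneg_left (by linarith) hN.le
    rw [h1]
    refine (Finset.sum_le_sum h2).trans ?_
    rw [← Finset.mul_sum, Finset.sum_range_sub fun i => Real.log (lam i + 1)]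
    have h5 : lam s ≤ s := by
      rw [div_le_iff₀ hN]
      refine (Finset.sum_le_sum fun i _ => hyQ i).trans ?_
      simp [N]
    have h6 : lam 0 = 0 := by simp [lam]
    rw [h6, zero_add, Real.log_one, sub_zero]
    refine mul_le_mul_of_nonneg_left (Real.log_le_log ?_ (by linarith)) hN.le
    linarith [hlam0 s]
  have hZ0 : ∀ p, 0 ≤ Z p := fun p => Finset.sum_nonneg fun i _ =>
    inv_nonneg.2 (by linarith [hlam0 (i + 1)])
  have hbad : ((Q'.filter fun p => ¬ Z p ≤ T).card : ℝ) ≤ N / 4 := by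
    have h1 : ((Q'.filter fun p => ¬ Z p ≤ T).card : ℝ) * T ≤ N * Real.log (s + 1) := by
      refine le_trans ?_ hZsum
      rw [← nsmul_eq_mul]
      refine (Finset.card_nsmul_le_sum _ Z T fun p hp => ?_).trans
        (Finset.sum_le_sum_of_subset_of_nonneg ((Finset.filter_subset _ _).trans hQ')
          fun p _ _ => hZ0 p)
      exact (not_le.1 (Finset.mem_filter.1 hp).2).le
    have h2 : N * Real.log (s + 1) = N / 4 * T := by simp only [T]; ring
    rw [h2] at h1
    exact le_of_mul_le_mul_right h1 (by positivity)
  have hgood : (Q'.filter fun p => Z p ≤ T).card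
      ≤ (shallowCells φ (fun j => T * (lam j + 1)) ⊤ s).card := by
    refine Finset.card_le_card_of_injOn (trace φ (Finset.range s)) (fun p hp => ?_)
      (hinj.mono (Finset.coe_subset.2 (Finset.filter_subset _ _)))
    have hZp : Z p ≤ T := (Finset.mem_filter.1 hp).2
    refine mem_shallowCells.2 ⟨⟨p, AffineSubspace.mem_top _ _ _, rfl⟩, fun j hj => ?_⟩
    have pj : 0 < lam j + 1 := by linarith [hlam0 j]
    have h1 : (((trace φ (Finset.range s) p ∩ Finset.range j).card : ℕ) : ℝ) * (lam j + 1)⁻¹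
        ≤ Z p := by
      rw [← nsmul_eq_mul]
      refine (Finset.card_nsmul_le_sum _ (fun i => (lam (i + 1) + 1)⁻¹) _ fun i hi => ?_).trans
        (Finset.sum_le_sum_of_subset_of_nonneg Finset.inter_subset_left fun i _ _ =>
          inv_nonneg.2 (by linarith [hlam0 (i + 1)]))
      have hij : i + 1 ≤ j := Finset.mem_range.1 (Finset.mem_inter.1 hi).2
      have := hlam_mono hij
      exact inv_anti₀ (by linarith [hlam0 (i + 1)]) (by linarith)
    rw [mul_inv_le_iff₀ pj] at h1
    exact h1.trans (mul_le_mul_of_nonneg_right hZp pj.le)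
  have hcells := card_shallowCells_le φ (l := fun j => T * (lam j + 1)) (c := 2 * T + 1) hd hE hy
    hy1 hN (by simp only [T]; linarith)
    (fun j => mul_nonneg (by simp only [T]; linarith) (by linarith [hlam0 j]))
    (fun j => by
      have : (1 : ℝ) + (∑ i ∈ Finset.range j, y i ^ d) / N = lam j + 1 := add_comm _ _
      rw [this]
      linarith [hlam0 j]) s
  have hsplit : ((Q'.filter fun p => Z p ≤ T).card : ℝ) + (Q'.filter fun p => ¬ Z p ≤ T).card
      = Q'.card := by
    exact_mod_cast Finset.card_filter_add_card_filter_not _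
  have hgood' : ((Q'.filter fun p => Z p ≤ T).card : ℝ)
      ≤ (shallowCells φ (fun j => T * (lam j + 1)) ⊤ s).card := by exact_mod_cast hgood
  have hT : 2 * T + 1 = 8 * Real.log (s + 1) + 1 := by simp only [T]; ring
  rw [hT] at hcells
  linarith

section Sampling

lemma sum_insertNth {H : Type*} [Fintype H] {s : ℕ} (b : Fin (s + 1)) (F : (Fin (s + 1) → H) → ℝ) :
    ∑ A, F A = ∑ A' : Fin s → H, ∑ a, F (b.insertNth a A') := by
  rw [← (Fin.insertNthEquiv (fun _ => H) b).sum_comp, Fintype.sum_prod_type, Finset.sum_comm]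
  rfl

lemma sum_prod_eq_one {H : Type*} [Fintype H] {μ : H → ℝ} (hμ : ∑ h, μ h = 1) (s : ℕ) :
    ∑ A : Fin s → H, ∏ i, μ (A i) = 1 := by
  have := Finset.prod_univ_sum (fun _ : Fin s => (Finset.univ : Finset H)) fun _ h => μ h
  rw [Fintype.piFinset_univ] at this
  rw [← this, hμ, Finset.prod_const_one]

lemma sum_prod_mul_sum {H : Type*} [Fintype H] {μ : H → ℝ} (hμ : ∑ h, μ h = 1) (g : H → ℝ) (s : ℕ) :
    ∑ A : Fin s → H, (∏ i, μ (A i)) * ∑ i, g (A i) = s * ∑ h, μ h * g h := by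
  simp only [Finset.mul_sum]
  rw [Finset.sum_comm]
  have key (i : Fin s) : ∑ A : Fin s → H, (∏ j, μ (A j)) * g (A i) = ∑ h, μ h * g h := by
    obtain ⟨s, rfl⟩ : ∃ k, s = k + 1 := ⟨s - 1, by have := i.pos; omega⟩
    rw [sum_insertNth i]
    simp only [Fin.prod_univ_succAbove _ i, Fin.insertNth_apply_same,
      Fin.insertNth_apply_succAbove]
    have (A' : Fin s → H) : ∑ a, μ a * (∏ j, μ (A' j)) * g a
        = (∏ j, μ (A' j)) * ∑ a, μ a * g a := by
      rw [Finset.mul_sum]; exact Finset.sum_congr rfl fun a _ => by ring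
    simp only [this]
    rw [← Finset.sum_mul, sum_prod_eq_one hμ, one_mul]
  rw [Finset.sum_congr rfl fun i _ => key i]
  simp [Finset.mul_sum]

variable {E H : Type*} [AddCommGroup E] [Module ℝ E]

/-- The affine functional `f` defines a halfspace containing exactly one of `p` and `q`. -/
def Separates (f : E →ᵃ[ℝ] ℝ) (p q : E) : Prop :=
  ¬ (f p ≤ 0 ↔ f q ≤ 0)

/-- The points of `Q` in the same cell as `p`. -/
def cellmates {ι : Type*} [Fintype ι] [DecidableEq ι] (ψ : ι → E →ᵃ[ℝ] ℝ) (Q : Finset E) (p : E) : Finset E :=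
  Q.filter fun q => trace ψ Finset.univ q = trace ψ Finset.univ p

/-- A lower bound for the weight of the edges between cells that are separated by `f` only. -/
def splitWeight {ι : Type*} [Fintype ι] [DecidableEq ι] (ψ : ι → E →ᵃ[ℝ] ℝ) (Q : Finset E) (f : E →ᵃ[ℝ] ℝ) : ℝ :=
  1 / 2 * ∑ p ∈ Q, (((cellmates ψ Q p).filter fun q => Separates f p q).card : ℝ)
    / (cellmates ψ Q p).card

lemma trace_eq_trace_iff {ι : Type*} {ψ : ι → E →ᵃ[ℝ] ℝ} {I : Finset ι} {p q : E} :
    trace ψ I p = trace ψ I q ↔ ∀ i ∈ I, (ψ i p ≤ 0 ↔ ψ i q ≤ 0) := by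
  simp only [Finset.ext_iff, mem_trace]
  exact forall_congr' fun i => ⟨fun h hi => by simpa [hi] using h,
    fun h => and_congr_right h⟩

lemma sum_inv_card_fiber {α β : Type*} [DecidableEq β] (Q : Finset α) (τ : α → β) :
    ∑ p ∈ Q, ((Q.filter fun q => τ q = τ p).card : ℝ)⁻¹ = (Q.image τ).card := by
  rw [← Finset.sum_fiberwise_of_maps_to (g := τ) (t := Q.image τ)
    fun p hp => Finset.mem_image_of_mem τ hp]
  rw [Finset.card_eq_sum_ones, Nat.cast_sum]
  refine Finset.sum_congr rfl fun u hu => ?_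
  obtain ⟨p, hp, rfl⟩ := Finset.mem_image.1 hu
  have hne : ((Q.filter fun q => τ q = τ p).card : ℝ) ≠ 0 := by
    have hmem : p ∈ Q.filter fun q => τ q = τ p := by simp [hp]
    exact Nat.cast_ne_zero.2 (Finset.card_pos.2 ⟨p, hmem⟩).ne'
  rw [Finset.sum_congr rfl (g := fun _ => ((Q.filter fun q => τ q = τ p).card : ℝ)⁻¹)
    fun q hq => by rw [(Finset.mem_filter.1 hq).2]]
  rw [Finset.sum_const, nsmul_eq_mul, mul_inv_cancel₀ hne, Nat.cast_one]

lemma splitWeight_le {s : ℕ} (φ : H → E →ᵃ[ℝ] ℝ) (Q : Finset E) (b : Fin (s + 1)) (a : H)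
    (A : Fin s → H) (w : Finset (Fin (s + 1)) → ℝ)
    (hw : ∀ u, w u = ((Q.filter fun p =>
      trace (fun i => φ (b.insertNth (α := fun _ => H) a A i)) Finset.univ p = u).card : ℝ)) :
    splitWeight (fun i => φ (A i)) Q (φ a)
      ≤ ∑ u ∈ (Finset.univ.erase b).powerset, min (w u) (w (insert b u)) := by
  set ψ : Fin (s + 1) → E →ᵃ[ℝ] ℝ := fun i => φ (b.insertNth (α := fun _ => H) a A i)
  set τ : E → Finset (Fin (s + 1)) := trace ψ (Finset.univ.erase b)
  have hψb : ψ b = φ a := by simp [ψ]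
  have hrel (p q : E) : trace (fun i => φ (A i)) Finset.univ q
      = trace (fun i => φ (A i)) Finset.univ p ↔ τ q = τ p := by
    simp only [τ, trace_eq_trace_iff]
    constructor
    · intro h i hi
      obtain ⟨j, rfl⟩ := Fin.exists_succAbove_eq (Finset.ne_of_mem_erase hi)
      simpa [ψ] using h j (Finset.mem_univ j)
    · intro h j _
      simpa [ψ] using h (b.succAbove j) (by simp [Fin.succAbove_ne])
  have hmates (p : E) : cellmates (fun i => φ (A i)) Q p = Q.filter fun q => τ q = τ p :=
    Finset.filter_congr fun q _ => hrel p q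
  have hin (u : Finset (Fin (s + 1))) (hu : u ⊆ Finset.univ.erase b) :
      (Q.filter fun p => trace ψ Finset.univ p = insert b u)
        = (Q.filter fun p => τ p = u).filter fun p => φ a p ≤ 0 := by
    have hbu : b ∉ u := fun h => by simpa using hu h
    rw [Finset.filter_filter]
    refine Finset.filter_congr fun p _ => ?_
    simp only [τ, trace_erase]
    constructor
    · intro h
      refine ⟨by rw [h, Finset.erase_insert hbu], ?_⟩
      have : b ∈ trace ψ Finset.univ p := h ▸ Finset.mem_insert_self b u
      simpa [mem_trace, hψb] using this
    · rintro ⟨h, hp⟩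
      rw [← h, Finset.insert_erase (mem_trace.2 ⟨Finset.mem_univ b, by rwa [hψb]⟩)]
  have hout (u : Finset (Fin (s + 1))) (hu : u ⊆ Finset.univ.erase b) :
      (Q.filter fun p => trace ψ Finset.univ p = u)
        = (Q.filter fun p => τ p = u).filter fun p => ¬ φ a p ≤ 0 := by
    have hbu : b ∉ u := fun h => by simpa using hu h
    rw [Finset.filter_filter]
    refine Finset.filter_congr fun p _ => ?_
    simp only [τ, trace_erase]
    constructor
    · intro h
      refine ⟨by rw [h, Finset.erase_eq_of_notMem hbu], fun hp => hbu ?_⟩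
      rw [← h]
      exact mem_trace.2 ⟨Finset.mem_univ b, by rwa [hψb]⟩
    · rintro ⟨h, hp⟩
      rw [← h, Finset.erase_eq_of_notMem fun hb => hp (hψb ▸ (mem_trace.1 hb).2)]
  unfold splitWeight
  rw [Finset.mul_sum, ← Finset.sum_fiberwise_of_maps_to (g := τ)
    (t := (Finset.univ.erase b).powerset) fun p _ => Finset.mem_powerset.2 (trace_subset _ _ _)]
  refine Finset.sum_le_sum fun u hu => ?_
  have hu := Finset.mem_powerset.1 hu
  set G := Q.filter fun p => τ p = u
  have hmatesG {p : E} (hp : p ∈ G) : cellmates (fun i => φ (A i)) Q p = G := by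
    rw [hmates, (Finset.mem_filter.1 hp).2]
  have hx : w (insert b u) = (G.filter fun p => φ a p ≤ 0).card := by rw [hw, hin u hu]
  have hy : w u = (G.filter fun p => ¬ φ a p ≤ 0).card := by rw [hw, hout u hu]
  have hm : (G.card : ℝ) = w (insert b u) + w u := by
    rw [hx, hy]; exact_mod_cast (Finset.card_filter_add_card_filter_not _).symm
  rw [Finset.sum_congr rfl (g := fun p => 1 / 2 *
    ((if φ a p ≤ 0 then w u else w (insert b u)) / G.card)) fun p hp => ?_]
  · rw [← Finset.sum_filter_add_sum_filter_not G fun p => φ a p ≤ 0]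
    rw [Finset.sum_congr rfl (g := fun _ => 1 / 2 * (w u / G.card))
      fun p hp => by rw [if_pos (Finset.mem_filter.1 hp).2]]
    rw [Finset.sum_congr (s₁ := G.filter fun p => ¬ φ a p ≤ 0) rfl
      (g := fun _ => 1 / 2 * (w (insert b u) / G.card))
      fun p hp => by rw [if_neg (Finset.mem_filter.1 hp).2]]
    rw [Finset.sum_const, Finset.sum_const, nsmul_eq_mul, nsmul_eq_mul, ← hx, ← hy, hm]
    have hx0 : 0 ≤ w (insert b u) := hx ▸ Nat.cast_nonneg _
    have hy0 : 0 ≤ w u := hy ▸ Nat.cast_nonneg _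
    rcases (add_nonneg hx0 hy0).eq_or_lt with h0 | h0
    · rw [← h0]; simpa using ⟨hy0, hx0⟩
    · have : w (insert b u) * (1 / 2 * (w u / (w (insert b u) + w u)))
          + w u * (1 / 2 * (w (insert b u) / (w (insert b u) + w u)))
          = w u * w (insert b u) / (w (insert b u) + w u) := by ring
      rw [this]
      refine le_min ?_ ?_ <;> rw [div_le_iff₀ h0] <;> nlinarith
  · rw [hmatesG hp]
    split_ifs with hpa
    · rw [hy]
      congr 4
      exact Finset.filter_congr fun q _ => by simp [Separates, hpa]
    · rw [hx]
      congr 4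
      exact Finset.filter_congr fun q _ => by simp [Separates, hpa]

variable [Fintype H]

lemma le_sum_mul_splitWeight {s : ℕ} (φ : H → E →ᵃ[ℝ] ℝ) (Q : Finset E) {μ : H → ℝ} {ε : ℝ}
    (hsep : ∀ p ∈ Q, ∀ q ∈ Q, p ≠ q → ε ≤ ∑ h with Separates (φ h) p q, μ h) (A : Fin s → H) :
    ε / 2 * (Q.card - (Q.image (trace (fun i => φ (A i)) Finset.univ)).card)
      ≤ ∑ a, μ a * splitWeight (fun i => φ (A i)) Q (φ a) := by
  set M : E → Finset E := cellmates (fun i => φ (A i)) Q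
  have hswap : ∑ a, μ a * splitWeight (fun i => φ (A i)) Q (φ a)
      = 1 / 2 * ∑ p ∈ Q, (∑ q ∈ M p, ∑ h with Separates (φ h) p q, μ h) / (M p).card := by
    simp only [splitWeight, Finset.mul_sum]
    rw [Finset.sum_comm]
    refine Finset.sum_congr rfl fun p _ => ?_
    have : ∑ q ∈ M p, ∑ h with Separates (φ h) p q, μ h
        = ∑ a, μ a * (((M p).filter fun q => Separates (φ a) p q).card : ℝ) := by
      simp only [Finset.sum_filter]
      rw [Finset.sum_comm]
      refine Finset.sum_congr rfl fun a _ => ?_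
      rw [← Finset.sum_filter, Finset.sum_const, nsmul_eq_mul, mul_comm]
    rw [this, Finset.sum_div, Finset.mul_sum]
    exact Finset.sum_congr rfl fun a _ => by simp only [M]; ring
  have hterm : ∀ p ∈ Q, ε * (1 - ((M p).card : ℝ)⁻¹)
      ≤ (∑ q ∈ M p, ∑ h with Separates (φ h) p q, μ h) / (M p).card := by
    intro p hp
    have hpM : p ∈ M p := Finset.mem_filter.2 ⟨hp, rfl⟩
    have hpos : (0 : ℝ) < (M p).card := by exact_mod_cast Finset.card_pos.2 ⟨p, hpM⟩
    rw [le_div_iff₀ hpos, ← Finset.add_sum_erase _ _ hpM]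
    have h0 : ∑ h with Separates (φ h) p p, μ h = 0 := by simp [Separates]
    have h1 : (((M p).erase p).card : ℝ) * ε
        ≤ ∑ q ∈ (M p).erase p, ∑ h with Separates (φ h) p q, μ h := by
      rw [← nsmul_eq_mul]
      refine Finset.card_nsmul_le_sum _ _ _ fun q hq => ?_
      obtain ⟨hqp, hq⟩ := Finset.mem_erase.1 hq
      exact hsep p hp q (Finset.mem_filter.1 hq).1 hqp.symm
    rw [Finset.card_erase_of_mem hpM, Nat.cast_sub (Finset.card_pos.2 ⟨p, hpM⟩)] at h1
    rw [h0, zero_add]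
    refine le_trans (le_of_eq ?_) h1
    field_simp
    simp
  have hsum := Finset.sum_le_sum hterm
  rw [← Finset.mul_sum, Finset.sum_sub_distrib, Finset.sum_const, nsmul_eq_mul, mul_one] at hsum
  have hcl := sum_inv_card_fiber Q (trace (fun i => φ (A i)) Finset.univ)
  simp only [M, cellmates] at hsum
  rw [hcl] at hsum
  rw [hswap]
  simp only [M, cellmates]
  linarith

/-- Haussler's sampling lemma: if any two points of `Q` are separated by a set of halfspaces of
measure `ε`, then a random sample of `O(d / ε)` halfspaces separates most of `Q`. -/
lemma card_mul_le_sum_card_image [FiniteDimensional ℝ E] {d s : ℕ} (hd : 1 ≤ d) (hE : Module.finrank ℝ E ≤ d)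
    (φ : H → E →ᵃ[ℝ] ℝ) (Q : Finset E) {μ : H → ℝ} {ε : ℝ} (hμ0 : ∀ h, 0 ≤ μ h)
    (hμ : ∑ h, μ h = 1)
    (hsep : ∀ p ∈ Q, ∀ q ∈ Q, p ≠ q → ε ≤ ∑ h with Separates (φ h) p q, μ h)
    (hs : 16 * d ≤ (s + 1) * ε) :
    7 / 8 * (Q.card : ℝ) ≤ ∑ A : Fin s → H, (∏ i, μ (A i)) *
      (Q.image (trace (fun i => φ (A i)) Finset.univ)).card := by
  set w : (Fin (s + 1) → H) → Finset (Fin (s + 1)) → ℝ := fun A u =>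
    ((Q.filter fun p => trace (fun i => φ (A i)) Finset.univ p = u).card : ℝ)
  set R : Fin (s + 1) → (Fin (s + 1) → H) → ℝ := fun b A =>
    ∑ u ∈ (Finset.univ.erase b).powerset, min (w A u) (w A (insert b u))
  have hR (A : Fin (s + 1) → H) : ∑ b, R b A ≤ d * Q.card := by
    have h1 := sum_min_insert_le (fun i => φ (A i)) Finset.univ d ⊤
      (by rwa [AffineSubspace.direction_top, finrank_top]) (w A) (fun u => Nat.cast_nonneg _) (by
        intro u _ hu
        obtain ⟨p, hp⟩ := Finset.card_ne_zero.1 (Nat.cast_ne_zero.1 hu)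
        exact ⟨p, AffineSubspace.mem_top _ _ _, (Finset.mem_filter.1 hp).2⟩)
    refine h1.trans (mul_le_mul_of_nonneg_left (le_of_eq ?_) (Nat.cast_nonneg d))
    simp only [w]
    exact_mod_cast (Finset.card_eq_sum_card_fiberwise fun p _ =>
      Finset.mem_coe.2 (Finset.mem_powerset.2 (Finset.subset_univ _))).symm
  have hupper : ∑ b, ∑ A : Fin (s + 1) → H, (∏ i, μ (A i)) * R b A ≤ d * Q.card := by
    rw [Finset.sum_comm]
    simp only [← Finset.mul_sum]
    refine (Finset.sum_le_sum fun A _ => mul_le_mul_of_nonneg_left (hR A)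
      (Finset.prod_nonneg fun i _ => hμ0 _)).trans ?_
    rw [← Finset.sum_mul, sum_prod_eq_one hμ, one_mul]
  set X := ∑ A : Fin s → H, (∏ i, μ (A i)) *
      ((Q.image (trace (fun i => φ (A i)) Finset.univ)).card : ℝ)
  have hlower (b : Fin (s + 1)) :
      ε / 2 * (Q.card - X) ≤ ∑ A : Fin (s + 1) → H, (∏ i, μ (A i)) * R b A := by
    rw [sum_insertNth b]
    have h1 : ε / 2 * (Q.card - X) = ∑ A : Fin s → H, (∏ i, μ (A i)) * (ε / 2 * (Q.card -
        ((Q.image (trace (fun i => φ (A i)) Finset.univ)).card : ℝ))) := by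
      simp only [mul_sub, Finset.sum_sub_distrib]
      rw [← Finset.sum_mul, sum_prod_eq_one hμ, one_mul]
      simp only [X, Finset.mul_sum]
      congr 1
      exact Finset.sum_congr rfl fun A _ => by ring
    rw [h1]
    refine Finset.sum_le_sum fun A _ => ?_
    simp only [Fin.prod_univ_succAbove _ b, Fin.insertNth_apply_same,
      Fin.insertNth_apply_succAbove]
    refine (mul_le_mul_of_nonneg_left (le_sum_mul_splitWeight φ Q hsep A)
      (Finset.prod_nonneg fun i _ => hμ0 _)).trans ?_
    rw [Finset.mul_sum]
    refine Finset.sum_le_sum fun a _ => ?_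
    have h2 : splitWeight (fun i => φ (A i)) Q (φ a) ≤ R b (b.insertNth a A) :=
      splitWeight_le φ Q b a A _ fun u => rfl
    calc _ = μ a * (∏ i, μ (A i)) * splitWeight (fun i => φ (A i)) Q (φ a) := by ring
      _ ≤ _ := mul_le_mul_of_nonneg_left h2
        (mul_nonneg (hμ0 a) (Finset.prod_nonneg fun i _ => hμ0 _))
  have htotal := (Finset.sum_le_sum fun b (_ : b ∈ Finset.univ) => hlower b).trans hupper
  rw [Finset.sum_const, Finset.card_univ, Fintype.card_fin, nsmul_eq_mul] at htotal
  push_cast at htotal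
  by_contra! hlt
  have hd' : (1 : ℝ) ≤ d := by exact_mod_cast hd
  have hQ0 : (0 : ℝ) ≤ Q.card := Nat.cast_nonneg _
  have hgap : (Q.card : ℝ) / 8 < Q.card - X := by linarith
  nlinarith [mul_le_mul_of_nonneg_right hs (by linarith : (0 : ℝ) ≤ Q.card - X)]

/-- A sample as in `card_mul_le_sum_card_image` whose total cost is at most twice the mean. -/
lemma exists_sample [FiniteDimensional ℝ E] {d s : ℕ} (hd : 1 ≤ d) (hE : Module.finrank ℝ E ≤ d)
    (φ : H → E →ᵃ[ℝ] ℝ) (Q : Finset E) {μ : H → ℝ} {ε : ℝ} (hμ0 : ∀ h, 0 ≤ μ h)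
    (hμ : ∑ h, μ h = 1)
    (hsep : ∀ p ∈ Q, ∀ q ∈ Q, p ≠ q → ε ≤ ∑ h with Separates (φ h) p q, μ h)
    (hs : 16 * d ≤ (s + 1) * ε) (hQ : Q.Nonempty) (g : H → ℝ) {M : ℝ} (hM : 0 < M)
    (hg0 : ∀ h, 0 ≤ g h) (hg : s * ∑ h, μ h * g h ≤ M) :
    ∃ A : Fin s → H,
      3 / 4 * (Q.card : ℝ) ≤ (Q.image (trace (fun i => φ (A i)) Finset.univ)).card ∧
        ∑ i, g (A i) ≤ 2 * M := by
  have hQ0 : (0 : ℝ) < Q.card := by exact_mod_cast hQ.card_pos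
  have h1 := card_mul_le_sum_card_image hd hE φ Q hμ0 hμ hsep hs
  have h2 := sum_prod_mul_sum hμ g s
  by_contra hcon
  push Not at hcon
  set T : (Fin s → H) → ℝ := fun A =>
    (Q.image (trace (fun i => φ (A i)) Finset.univ)).card - Q.card / (8 * M) * ∑ i, g (A i)
  have hc : 0 < (Q.card : ℝ) / (8 * M) := by positivity
  have hT (A : Fin s → H) : T A < 3 / 4 * Q.card := by
    have hgA : 0 ≤ ∑ i, g (A i) := Finset.sum_nonneg fun i _ => hg0 _
    rcases lt_or_ge ((Q.image (trace (fun i => φ (A i)) Finset.univ)).card : ℝ)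
      (3 / 4 * (Q.card : ℝ)) with hlt | hge
    · have := mul_nonneg hc.le hgA
      simp only [T]; linarith
    · have h4 := mul_lt_mul_of_pos_left (hcon A hge) hc
      have h5 : (Q.card : ℝ) / (8 * M) * (2 * M) = Q.card / 4 := by field_simp; norm_num
      have h6 : ((Q.image (trace (fun i => φ (A i)) Finset.univ)).card : ℝ) ≤ Q.card := by
        exact_mod_cast Finset.card_image_le
      simp only [T]; linarith
  have hprod (A : Fin s → H) : 0 ≤ ∏ i, μ (A i) := Finset.prod_nonneg fun i _ => hμ0 _
  have hlt : ∑ A : Fin s → H, (∏ i, μ (A i)) * T A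
      < ∑ A : Fin s → H, (∏ i, μ (A i)) * (3 / 4 * Q.card) := by
    obtain ⟨A, -, hA⟩ := Finset.exists_ne_zero_of_sum_ne_zero
      (show ∑ A : Fin s → H, ∏ i, μ (A i) ≠ 0 by rw [sum_prod_eq_one hμ]; exact one_ne_zero)
    exact Finset.sum_lt_sum (fun A _ => mul_le_mul_of_nonneg_left (hT A).le (hprod A))
      ⟨A, Finset.mem_univ A, mul_lt_mul_of_pos_left (hT A) ((hprod A).lt_of_ne' hA)⟩
  rw [← Finset.sum_mul, sum_prod_eq_one hμ, one_mul] at hlt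
  have hge : ∑ A : Fin s → H, (∏ i, μ (A i)) * T A
      = ∑ A : Fin s → H, (∏ i, μ (A i)) *
          ((Q.image (trace (fun i => φ (A i)) Finset.univ)).card : ℝ)
        - Q.card / (8 * M) * ∑ A : Fin s → H, (∏ i, μ (A i)) * ∑ i, g (A i) := by
    simp only [T, mul_sub, Finset.sum_sub_distrib]
    congr 1
    rw [Finset.mul_sum]
    exact Finset.sum_congr rfl fun A _ => by ring
  have h7 : (Q.card : ℝ) / (8 * M) * (s * ∑ h, μ h * g h) ≤ Q.card / 8 := by
    refine (mul_le_mul_of_nonneg_left hg hc.le).trans (le_of_eq ?_)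
    field_simp
  rw [h2] at hge
  linarith

end Sampling

section SeparatedPair

lemma mul_pow_add_lt {d : ℕ} (hd : 2 ≤ d) {n a Lam L X s l : ℝ} (ha : a ^ (d - 1) = n)
    (hLam : Lam ^ (d - 1) = L) (hLam1 : 1 ≤ Lam) (ha1 : 1 ≤ a) (hs1 : 1 ≤ s) (hsX : s ≤ X)
    (hlL : l ≤ L) (hX : X ≤ a / (60 * Lam)) :
    (8 * l + 1) * ((s + 1) ^ (d - 1) + X ^ d / a) < n / 2 := by
  have hL1 : 1 ≤ L := hLam ▸ one_le_pow₀ hLam1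
  have hn1 : 1 ≤ n := ha ▸ one_le_pow₀ ha1
  have hX0 : 0 ≤ X := by linarith
  have hpow {t c : ℝ} (hc : 1 ≤ c) (ht0 : 0 ≤ t) (ht : t ≤ a / (c * Lam)) :
      t ^ (d - 1) ≤ n / (c * L) := by
    calc t ^ (d - 1) ≤ (a / (c * Lam)) ^ (d - 1) := pow_le_pow_left₀ ht0 ht _
      _ = n / (c ^ (d - 1) * L) := by rw [div_pow, mul_pow, ha, hLam]
      _ ≤ n / (c * L) := by
        gcongr
        exact le_self_pow₀ hc (by omega)
  have h1 : (s + 1) ^ (d - 1) ≤ n / (30 * L) := by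
    refine hpow (by norm_num) (by linarith) ?_
    have : a / (30 * Lam) = 2 * (a / (60 * Lam)) := by field_simp; norm_num
    linarith
  have h2 : X ^ d / a ≤ n / (60 * L) := by
    have hXa : X / a ≤ 1 := by
      rw [div_le_one (by linarith)]
      refine hX.trans (div_le_self (by linarith) (by linarith))
    have h3 := hpow (by norm_num) hX0 hX
    have h4 : X ^ d / a = X ^ (d - 1) * (X / a) := by
      rw [← pow_sub_one_mul (by omega : d ≠ 0) X]; ring
    rw [h4]
    exact (mul_le_of_le_one_right (pow_nonneg hX0 _) hXa).trans h3
  have h5 : n / (30 * L) + n / (60 * L) = n / (20 * L) := by field_simp; norm_num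
  have h6 : 0 < n / (20 * L) := by positivity
  calc (8 * l + 1) * ((s + 1) ^ (d - 1) + X ^ d / a) ≤ (9 * L) * (n / (20 * L)) := by
        refine mul_le_mul (by linarith) (by linarith) ?_ (by linarith)
        positivity
    _ = 9 / 20 * n := by field_simp
    _ < n / 2 := by linarith

variable {E H : Type*} [AddCommGroup E] [Module ℝ E]

/-- The number of points of `Q` in the halfspace `f ≤ 0`, or one if there is none. -/
def depth (Q : Finset E) (f : E →ᵃ[ℝ] ℝ) : ℝ :=
  max 1 ((Q.filter fun p => f p ≤ 0).card : ℝ)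

lemma one_le_depth (Q : Finset E) (f : E →ᵃ[ℝ] ℝ) : 1 ≤ depth Q f :=
  le_max_left _ _

lemma depth_mono {Q Q' : Finset E} (h : Q ⊆ Q') (f : E →ᵃ[ℝ] ℝ) : depth Q f ≤ depth Q' f :=
  max_le_max le_rfl (by exact_mod_cast Finset.card_le_card (Finset.filter_subset_filter _ h))

lemma depth_le_card {Q : Finset E} (hQ : Q.Nonempty) (f : E →ᵃ[ℝ] ℝ) : depth Q f ≤ Q.card :=
  max_le (by exact_mod_cast hQ.card_pos) (by exact_mod_cast Finset.card_filter_le _ _)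

/-- A multiset of halfspaces separating most of `Q` has large total cost. -/
lemma lt_sum_depth_rpow [FiniteDimensional ℝ E] {d s : ℕ} (hd : 2 ≤ d)
    (hE : Module.finrank ℝ E ≤ d) (φ : H → E →ᵃ[ℝ] ℝ) {Q : Finset E} (hQ : 2 ≤ Q.card)
    (hs : 1 ≤ s) (A : Fin s → H)
    (hA : 3 / 4 * (Q.card : ℝ) ≤ (Q.image (trace (fun i => φ (A i)) Finset.univ)).card) :
    (Q.card : ℝ) ^ (1 / ((d : ℝ) - 1)) / (60 * Real.logb 2 Q.card ^ (1 / ((d : ℝ) - 1)))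
      < ∑ i, depth Q (φ (A i)) ^ (1 / ((d : ℝ) * (d - 1))) := by
  have hd1 : (0 : ℝ) < (d : ℝ) - 1 := by
    have : (2 : ℝ) ≤ d := by exact_mod_cast hd
    linarith
  have hd0 : (0 : ℝ) < d := by linarith
  have hn2 : (2 : ℝ) ≤ Q.card := by exact_mod_cast hQ
  have hQne : Q.Nonempty := Finset.card_pos.1 (by omega)
  set n : ℝ := (Q.card : ℝ)
  have hn0 : 0 < n := by linarith
  have hcast : ((d - 1 : ℕ) : ℝ) = (d : ℝ) - 1 := by rw [Nat.cast_sub (by omega)]; simp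
  have hroot {x : ℝ} (hx : 0 ≤ x) : (x ^ (1 / ((d : ℝ) - 1))) ^ (d - 1) = x := by
    rw [← Real.rpow_natCast, ← Real.rpow_mul hx, hcast, one_div_mul_cancel hd1.ne', Real.rpow_one]
  have hL1 : 1 ≤ Real.logb 2 n := by
    rw [Real.le_logb_iff_rpow_le (by norm_num) hn0]; simpa using hn2
  set L := Real.logb 2 n
  set a := n ^ (1 / ((d : ℝ) - 1))
  set Lam := L ^ (1 / ((d : ℝ) - 1))
  have ha1 : 1 ≤ a := Real.one_le_rpow (by linarith) (by positivity)
  have hLam1 : 1 ≤ Lam := Real.one_le_rpow hL1 (by positivity)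
  set k : H → ℝ := fun h => depth Q (φ h)
  have hk1 (h : H) : 1 ≤ k h := one_le_depth _ _
  have hk0 (h : H) : 0 ≤ k h := zero_le_one.trans (hk1 h)
  have hkn (h : H) : k h ≤ n := depth_le_card hQne _
  by_contra! hX
  set X := ∑ i, k (A i) ^ (1 / ((d : ℝ) * (d - 1)))
  have hsX : (s : ℝ) ≤ X := by
    have : ∑ _i : Fin s, (1 : ℝ) ≤ X :=
      Finset.sum_le_sum fun i _ => Real.one_le_rpow (hk1 _) (by positivity)
    simpa using this
  have hs1 : (1 : ℝ) ≤ s := by exact_mod_cast hs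
  -- enumerate the sample by increasing depth
  set σ := Tuple.sort (k ∘ A)
  have hσ : Monotone ((k ∘ A) ∘ σ) := Tuple.monotone_sort _
  set f : ℕ → H := fun i => A (σ ⟨min i (s - 1), by omega⟩)
  have hf (i : Fin s) : f i = A (σ i) := by
    have : min (i : ℕ) (s - 1) = i := by omega
    simp only [f, this]
  have hfk : Monotone fun i => k (f i) := fun i j hij =>
    hσ (Fin.mk_le_mk.2 (min_le_min_right _ hij))
  have hsum (F : H → ℝ) : ∑ i ∈ Finset.range s, F (f i) = ∑ i, F (A i) := by
    rw [Finset.sum_range]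
    exact (Finset.sum_congr rfl fun i _ => by rw [hf]).trans (Equiv.sum_comp σ fun i => F (A i))
  have hyd (h : H) : (k h ^ (1 / (d : ℝ))) ^ d = k h := by
    rw [← Real.rpow_natCast, ← Real.rpow_mul (hk0 h), one_div_mul_cancel hd0.ne', Real.rpow_one]
  obtain ⟨Q', hQ', hinj, himg⟩ : ∃ Q' ⊆ Q,
      Set.InjOn (trace (fun i => φ (A i)) Finset.univ) (Q' : Set E) ∧
      Q'.image (trace (fun i => φ (A i)) Finset.univ)
        = Q.image (trace (fun i => φ (A i)) Finset.univ) :=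
    Finset.exists_subset_injOn_image_eq_of_surjOn (Q : Set E) _
      (by rw [Finset.coe_image]; exact Set.surjOn_image _ _)
  have hcardQ' : 3 / 4 * (Q.card : ℝ) ≤ Q'.card := by
    rwa [← himg, Finset.card_image_of_injOn hinj] at hA
  have main := card_le_of_injOn_trace (by omega : 1 ≤ d) hE (fun i => φ (f i))
    (y := fun i => k (f i) ^ (1 / (d : ℝ))) (Q := Q) (Q' := Q')
    (fun i j hij => Real.rpow_le_rpow (hk0 _) (hfk hij) (by positivity))
    (fun i => Real.one_le_rpow (hk1 _) (by positivity))
    (fun i => by rw [hyd]; exact le_max_right _ _) (fun i => by rw [hyd]; exact hkn _) hs hQ'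
    hcardQ' (by
      intro p hp q hq hpq
      refine hinj hp hq (trace_eq_trace_iff.2 fun i _ => ?_)
      have := trace_eq_trace_iff.1 hpq (σ.symm i) (Finset.mem_range.2 (σ.symm i).2)
      simpa [hf] using this)
  rw [hsum fun h => k h ^ (1 / (d : ℝ))] at main
  set r := n ^ (1 / (d : ℝ) - 1 / ((d : ℝ) * (d - 1)))
  have hY0 : 0 ≤ ∑ i, k (A i) ^ (1 / (d : ℝ)) :=
    Finset.sum_nonneg fun i _ => Real.rpow_nonneg (hk0 _) _
  have hY : ∑ i, k (A i) ^ (1 / (d : ℝ)) ≤ X * r := by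
    rw [Finset.sum_mul]
    refine Finset.sum_le_sum fun i _ => ?_
    have h0 : 0 ≤ 1 / (d : ℝ) - 1 / ((d : ℝ) * (d - 1)) := by
      have : 1 / (d : ℝ) - 1 / ((d : ℝ) * (d - 1)) = (d - 2) / (d * (d - 1)) := by
        field_simp; ring
      rw [this]
      have : (2 : ℝ) ≤ d := by exact_mod_cast hd
      exact div_nonneg (by linarith) (by positivity)
    calc k (A i) ^ (1 / (d : ℝ)) = k (A i) ^ (1 / ((d : ℝ) * (d - 1)))
          * k (A i) ^ (1 / (d : ℝ) - 1 / ((d : ℝ) * (d - 1))) := by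
            rw [← Real.rpow_add (by linarith [hk1 (A i)])]; congr 1; ring
      _ ≤ _ := mul_le_mul_of_nonneg_left (Real.rpow_le_rpow (hk0 _) (hkn _) h0)
            (Real.rpow_nonneg (hk0 _) _)
  have hr : r ^ d = n / a := by
    rw [← Real.rpow_natCast, ← Real.rpow_mul hn0.le]
    have : (1 / (d : ℝ) - 1 / ((d : ℝ) * (d - 1))) * d = 1 - 1 / ((d : ℝ) - 1) := by
      field_simp
    rw [this, Real.rpow_sub hn0, Real.rpow_one]
  have hYd : (∑ i, k (A i) ^ (1 / (d : ℝ))) ^ d / n ≤ X ^ d / a := by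
    rw [div_le_iff₀ hn0]
    refine (pow_le_pow_left₀ hY0 hY d).trans (le_of_eq ?_)
    rw [mul_pow, hr]; ring
  have han : a ≤ n := by
    have := le_self_pow₀ ha1 (by omega : d - 1 ≠ 0)
    rwa [hroot hn0.le] at this
  have hlog : Real.log (s + 1) ≤ L := by
    have h1 : X ≤ a / 60 := hX.trans (by gcongr; linarith)
    have h2 : Real.log (s + 1) ≤ Real.log n := Real.log_le_log (by linarith) (by linarith)
    refine h2.trans ?_
    have h3 : Real.log 2 ≤ 1 := by linarith [Real.log_two_lt_d9]
    simp only [L, Real.logb]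
    rw [le_div_iff₀ (Real.log_pos (by norm_num))]
    exact mul_le_of_le_one_right (Real.log_nonneg (by linarith)) h3
  have hfinal := mul_pow_add_lt hd (hroot hn0.le) (hroot (zero_le_one.trans hL1)) hLam1 ha1 hs1 hsX
    hlog hX
  have h8 : 0 ≤ 8 * Real.log ((s : ℝ) + 1) + 1 := by
    linarith [Real.log_nonneg (by linarith : (1 : ℝ) ≤ (s : ℝ) + 1)]
  have := main.trans (mul_le_mul_of_nonneg_left (add_le_add le_rfl hYd) h8)
  linarith

/-- Any weighted family of halfspaces has a pair of points of `Q` that is separated by few of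
them, where shallow halfspaces count for less. -/
lemma exists_pair_sum_separates_le [Fintype H] [FiniteDimensional ℝ E] {d : ℕ} (hd : 2 ≤ d)
    (hE : Module.finrank ℝ E ≤ d) (φ : H → E →ᵃ[ℝ] ℝ) {Q : Finset E} (hQ : 2 ≤ Q.card)
    {w : H → ℝ} (hw : ∀ h, 0 ≤ w h) :
    ∃ p ∈ Q, ∃ q ∈ Q, p ≠ q ∧ ∑ h with Separates (φ h) p q, w h ≤
      2040 * d * Real.logb 2 Q.card ^ (1 / ((d : ℝ) - 1)) / (Q.card : ℝ) ^ (1 / ((d : ℝ) - 1)) *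
        ∑ h, w h * depth Q (φ h) ^ (1 / ((d : ℝ) * (d - 1))) := by
  have hd1 : (0 : ℝ) < (d : ℝ) - 1 := by
    have : (2 : ℝ) ≤ d := by exact_mod_cast hd
    linarith
  have hd0 : (0 : ℝ) < d := by linarith
  have hn2 : (2 : ℝ) ≤ Q.card := by exact_mod_cast hQ
  have hn0 : (0 : ℝ) < Q.card := by linarith
  have hQne : Q.Nonempty := Finset.card_pos.1 (by omega)
  have hLpos : 0 < Real.logb 2 Q.card := Real.logb_pos (by norm_num) (by linarith)
  set a := (Q.card : ℝ) ^ (1 / ((d : ℝ) - 1))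
  set Lam := Real.logb 2 Q.card ^ (1 / ((d : ℝ) - 1))
  have ha : 0 < a := Real.rpow_pos_of_pos hn0 _
  have hLam : 0 < Lam := Real.rpow_pos_of_pos hLpos _
  set g : H → ℝ := fun h => depth Q (φ h) ^ (1 / ((d : ℝ) * (d - 1)))
  have hg1 (h : H) : 1 ≤ g h := Real.one_le_rpow (one_le_depth _ _) (by positivity)
  set W := ∑ h, w h
  set S := ∑ h, w h * g h
  have hWS : W ≤ S := Finset.sum_le_sum fun h _ => le_mul_of_one_le_right (hw h) (hg1 h)
  by_contra! hcon
  set δ := 2040 * d * Lam / a * S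
  have hS0 : 0 ≤ S := Finset.sum_nonneg fun h _ => mul_nonneg (hw h) (zero_le_one.trans (hg1 h))
  have hδ0 : 0 ≤ δ := by positivity
  have hδW : δ < W := by
    obtain ⟨p, hp, q, hq, hpq⟩ := Finset.one_lt_card.1 (by omega : 1 < Q.card)
    refine (hcon p hp q hq hpq).trans_le ?_
    exact Finset.sum_le_sum_of_subset_of_nonneg (Finset.filter_subset _ _) fun h _ _ => hw h
  have hW : 0 < W := hδ0.trans_lt hδW
  have hS : 0 < S := hW.trans_le hWS
  have hδ : 0 < δ := by positivity
  set ε := δ / W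
  have hε : 0 < ε := div_pos hδ hW
  have hε1 : ε ≤ 1 := (div_le_one hW).2 hδW.le
  set s := ⌈16 * d / ε⌉₊
  have hs1 : 1 ≤ s := Nat.ceil_pos.2 (by positivity)
  have hsle : (s : ℝ) ≤ 17 * d / ε := by
    have h1 := (Nat.ceil_lt_add_one (by positivity : 0 ≤ 16 * d / ε)).le
    have h2 : 1 ≤ d / ε := by
      rw [le_div_iff₀ hε]; linarith
    have h3 : 17 * d / ε = 16 * d / ε + d / ε := by ring
    rw [h3]; exact h1.trans (by linarith)
  have hsε : 16 * d ≤ ((s : ℝ) + 1) * ε := by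
    have := (div_le_iff₀ hε).1 (Nat.le_ceil (16 * d / ε))
    nlinarith
  obtain ⟨A, hA, hcost⟩ := exists_sample (by omega : 1 ≤ d) hE φ Q (μ := fun h => w h / W) (ε := ε)
    (s := s) (fun h => div_nonneg (hw h) hW.le) (by rw [← Finset.sum_div]; exact div_self hW.ne')
    (fun p hp q hq hpq => by
      rw [← Finset.sum_div]
      exact div_le_div_of_nonneg_right (hcon p hp q hq hpq).le hW.le)
    hsε hQne g (M := 17 * d * S / δ) (by positivity) (fun h => zero_le_one.trans (hg1 h)) (by
      have h1 : ∑ h, w h / W * g h = S / W := by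
        rw [Finset.sum_div]; exact Finset.sum_congr rfl fun h _ => by ring
      rw [h1]
      refine (mul_le_mul_of_nonneg_right hsle (by positivity)).trans (le_of_eq ?_)
      simp only [ε]; field_simp)
  have hlow := lt_sum_depth_rpow hd hE φ hQ hs1 A hA
  have hM : 2 * (17 * d * S / δ) = a / (60 * Lam) := by
    simp only [δ]; field_simp; norm_num
  rw [hM] at hcost
  exact absurd hcost (not_le.2 hlow)

end SeparatedPair

section Matching

lemma sum_inv_rpow_le {ν : ℝ} (hν0 : 0 ≤ ν) (hν : ν ≤ 1 / 2) (t : ℕ) :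
    ∑ j ∈ Finset.range t, 1 / (2 * ((j : ℝ) + 1)) ^ ν ≤ (2 * (t : ℝ)) ^ (1 - ν) := by
  induction t with
  | zero => simpa using Real.rpow_nonneg le_rfl _
  | succ t ih =>
    rw [Finset.sum_range_succ]
    push_cast
    set x : ℝ := 2 * ((t : ℝ) + 1)
    have ht : (0 : ℝ) ≤ t := t.cast_nonneg
    have hx : 2 ≤ x := by simp only [x]; linarith
    have hx0 : 0 < x := by linarith
    have hle : -1 ≤ -2 / x := by rw [le_div_iff₀ hx0]; linarith
    have h1 := rpow_one_add_le_one_add_mul_self hle (p := 1 - ν) (by linarith) (by linarith)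
    have h2 : (2 * (t : ℝ)) ^ (1 - ν) = x ^ (1 - ν) * (1 + -2 / x) ^ (1 - ν) := by
      rw [← Real.mul_rpow hx0.le (by linarith)]
      congr 1
      field_simp
      simp only [x]; ring
    have h3 : x ^ (1 - ν) = x * (1 / x ^ ν) := by
      rw [Real.rpow_sub hx0, Real.rpow_one]; ring
    have h4 : 0 < 1 / x ^ ν := by positivity
    have h5 : x ^ (1 - ν) * (1 + (1 - ν) * (-2 / x)) = x ^ (1 - ν) - 2 * (1 - ν) * (1 / x ^ ν) := by
      rw [h3]; field_simp; ring
    have h6 := mul_le_mul_of_nonneg_left h1 (Real.rpow_nonneg hx0.le (1 - ν))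
    rw [← h2, h5] at h6
    nlinarith

variable {E H : Type*} [AddCommGroup E] [Module ℝ E] [Fintype H]

/-- `Q` has balanced signings whose sum over the `h`-th halfspace behaves like a sum of `cross h`
random signs. -/
def HasSignings (φ : H → E →ᵃ[ℝ] ℝ) (Q : Finset E) (cross : H → ℕ) : Prop :=
  ∀ α lam : H → ℝ, (∀ h, 0 ≤ α h) → ∃ χ : E → ℤ, (∀ p ∈ Q, χ p = 1 ∨ χ p = -1) ∧
    ∑ p ∈ Q, χ p = 0 ∧
    ∑ h, α h * Real.cosh (lam h * (∑ p ∈ Q with φ h p ≤ 0, χ p : ℤ)) ≤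
      ∑ h, α h * Real.exp (lam h ^ 2 * cross h / 2)

lemma hasSignings_empty (φ : H → E →ᵃ[ℝ] ℝ) : HasSignings φ ∅ 0 :=
  fun _ _ _ => ⟨fun _ => 1, by simp, by simp, by simp⟩

lemma HasSignings.insert_pair {φ : H → E →ᵃ[ℝ] ℝ} {Q : Finset E} {cross : H → ℕ}
    (hQ : HasSignings φ Q cross) {p q : E} (hpq : p ≠ q) (hp : p ∉ Q) (hq : q ∉ Q) :
    HasSignings φ (insert p (insert q Q))
      (fun h => cross h + if Separates (φ h) p q then 1 else 0) := by
  intro α lam hα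
  set c : H → ℤ := fun h => (if φ h p ≤ 0 then 1 else 0) - (if φ h q ≤ 0 then 1 else 0)
  obtain ⟨χ, hχ, hχ0, hsum⟩ := hQ (fun h => α h * Real.cosh (lam h * c h)) lam
    fun h => mul_nonneg (hα h) (Real.cosh_pos _).le
  have hp' : p ∉ insert q Q := by simp [hpq, hp]
  set χ' : ℤ → E → ℤ := fun e => Function.update (Function.update χ p e) q (-e)
  have hχ'p (e : ℤ) : χ' e p = e := by simp [χ', hpq]
  have hχ'q (e : ℤ) : χ' e q = -e := by simp [χ']
  have hχ'Q (e : ℤ) {x : E} (hx : x ∈ Q) : χ' e x = χ x := by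
    have h1 : x ≠ p := fun h => hp (h ▸ hx)
    have h2 : x ≠ q := fun h => hq (h ▸ hx)
    simp [χ', h1, h2]
  have hS (e : ℤ) (h : H) : ∑ x ∈ insert p (insert q Q) with φ h x ≤ 0, χ' e x
      = ∑ x ∈ Q with φ h x ≤ 0, χ x + e * c h := by
    rw [Finset.sum_filter, Finset.sum_insert hp', Finset.sum_insert hq, hχ'p, hχ'q,
      Finset.sum_filter]
    rw [Finset.sum_congr rfl fun x hx => by rw [hχ'Q e hx]]
    simp only [c]
    split_ifs <;> ring
  have hsign (e : ℤ) (he : e = 1 ∨ e = -1) :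
      ∀ x ∈ insert p (insert q Q), χ' e x = 1 ∨ χ' e x = -1 := by
    intro x hx
    rcases Finset.mem_insert.1 hx with rfl | hx
    · rwa [hχ'p]
    rcases Finset.mem_insert.1 hx with rfl | hx
    · rw [hχ'q]; omega
    · rw [hχ'Q e hx]; exact hχ x hx
  have hzero (e : ℤ) : ∑ x ∈ insert p (insert q Q), χ' e x = 0 := by
    rw [Finset.sum_insert hp', Finset.sum_insert hq, hχ'p, hχ'q,
      Finset.sum_congr rfl fun x hx => hχ'Q e hx, hχ0]
    ring
  set F : ℤ → ℝ := fun e => ∑ h, α h * Real.cosh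
    (lam h * (∑ x ∈ insert p (insert q Q) with φ h x ≤ 0, χ' e x : ℤ))
  have havg : F 1 + F (-1) ≤
      2 * ∑ h, α h * Real.exp (lam h ^ 2 *
        ((cross h + if Separates (φ h) p q then 1 else 0 : ℕ) : ℝ) / 2) := by
    have h1 : F 1 + F (-1) = 2 * ∑ h, α h * Real.cosh (lam h * c h) *
        Real.cosh (lam h * (∑ x ∈ Q with φ h x ≤ 0, χ x : ℤ)) := by
      rw [← Finset.sum_add_distrib, Finset.mul_sum]
      refine Finset.sum_congr rfl fun h _ => ?_
      rw [hS, hS]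
      push_cast
      rw [one_mul, neg_one_mul, mul_add, mul_add, Real.cosh_add, Real.cosh_add, mul_neg,
        Real.cosh_neg, Real.sinh_neg]
      ring
    rw [h1]
    refine mul_le_mul_of_nonneg_left (hsum.trans (Finset.sum_le_sum fun h _ => ?_)) zero_le_two
    have h2 : ((c h : ℝ)) ^ 2 = if Separates (φ h) p q then 1 else 0 := by
      simp only [c, Separates]
      by_cases hp0 : φ h p ≤ 0 <;> by_cases hq0 : φ h q ≤ 0 <;> simp [hp0, hq0]
    rw [mul_assoc]
    refine mul_le_mul_of_nonneg_left ?_ (hα h)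
    refine (mul_le_mul_of_nonneg_right (Real.cosh_le_exp_half_sq _) (Real.exp_pos _).le).trans ?_
    rw [← Real.exp_add, mul_pow, h2]
    refine Real.exp_le_exp.2 (le_of_eq ?_)
    push_cast
    ring
  rcases le_total (F 1) (F (-1)) with hF | hF
  · exact ⟨χ' 1, hsign 1 (.inl rfl), hzero 1, by change F 1 ≤ _; linarith⟩
  · exact ⟨χ' (-1), hsign (-1) (.inr rfl), hzero (-1), by change F (-1) ≤ _; linarith⟩

/-- Pairing up `Q` by multiplicative weights. -/
lemma exists_hasSignings [FiniteDimensional ℝ E] {d : ℕ} (hd : 2 ≤ d)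
    (hE : Module.finrank ℝ E ≤ d) (φ : H → E →ᵃ[ℝ] ℝ) (P : Finset E) (t : ℕ) :
    ∀ Q ⊆ P, Q.card = 2 * t → ∀ Φ : H → ℝ, (∀ h, 0 ≤ Φ h) →
      ∃ cross : H → ℕ, HasSignings φ Q cross ∧
        ∑ h, Φ h * (1 + (depth P (φ h) ^ (1 / ((d : ℝ) * (d - 1))))⁻¹) ^ cross h ≤
          (∑ h, Φ h) * Real.exp (2040 * d * Real.logb 2 P.card ^ (1 / ((d : ℝ) - 1)) *
            ∑ j ∈ Finset.range t, 1 / (2 * ((j : ℝ) + 1)) ^ (1 / ((d : ℝ) - 1))) := by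
  have hd1 : (0 : ℝ) < (d : ℝ) - 1 := by
    have : (2 : ℝ) ≤ d := by exact_mod_cast hd
    linarith
  have hd0 : (0 : ℝ) < d := by linarith
  set g : H → ℝ := fun h => depth P (φ h) ^ (1 / ((d : ℝ) * (d - 1)))
  have hg1 (h : H) : 1 ≤ g h := Real.one_le_rpow (one_le_depth _ _) (by positivity)
  have hg0 (h : H) : 0 < g h := zero_lt_one.trans_le (hg1 h)
  induction t with
  | zero =>
    intro Q _ hcard Φ _
    obtain rfl : Q = ∅ := Finset.card_eq_zero.1 (by omega)
    exact ⟨0, hasSignings_empty φ, by simp⟩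
  | succ t ih =>
    intro Q hQP hcard Φ hΦ
    obtain ⟨p, hp, q, hq, hpq, hsep⟩ := exists_pair_sum_separates_le hd hE φ (Q := Q)
      (by omega) (w := fun h => Φ h * (g h)⁻¹) fun h => mul_nonneg (hΦ h) (inv_nonneg.2 (hg0 h).le)
    set Q' := (Q.erase p).erase q
    have hqe : q ∈ Q.erase p := Finset.mem_erase.2 ⟨hpq.symm, hq⟩
    have hQ : insert p (insert q Q') = Q := by
      rw [Finset.insert_erase hqe, Finset.insert_erase hp]
    have hcard' : Q'.card = 2 * t := by
      rw [Finset.card_erase_of_mem hqe, Finset.card_erase_of_mem hp]; omega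
    set Ψ : H → ℝ := fun h => Φ h * (1 + (g h)⁻¹) ^ (if Separates (φ h) p q then 1 else 0)
    have hΨ (h : H) : 0 ≤ Ψ h :=
      mul_nonneg (hΦ h) (pow_nonneg (add_nonneg zero_le_one (inv_nonneg.2 (hg0 h).le)) _)
    obtain ⟨cross, hcross, hpot⟩ := ih Q'
      (((Finset.erase_subset _ _).trans (Finset.erase_subset _ _)).trans hQP) hcard' Ψ hΨ
    refine ⟨fun h => cross h + if Separates (φ h) p q then 1 else 0, ?_, ?_⟩
    · rw [← hQ]
      exact hcross.insert_pair hpq (by simp [Q']) (by simp [Q'])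
    set Lam := Real.logb 2 P.card ^ (1 / ((d : ℝ) - 1))
    set u := 1 / (2 * ((t : ℝ) + 1)) ^ (1 / ((d : ℝ) - 1))
    have hu : 0 ≤ u := by positivity
    have hc : (Q.card : ℝ) = 2 * ((t : ℝ) + 1) := by rw [hcard]; push_cast; ring
    have hΨsum : ∑ h, Ψ h ≤ (∑ h, Φ h) * Real.exp (2040 * d * Lam * u) := by
      have h1 : ∑ h, Ψ h = ∑ h, Φ h + ∑ h with Separates (φ h) p q, Φ h * (g h)⁻¹ := by
        rw [Finset.sum_filter, ← Finset.sum_add_distrib]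
        refine Finset.sum_congr rfl fun h _ => ?_
        simp only [Ψ]
        split_ifs <;> ring
      have h2 : ∑ h, Φ h * (g h)⁻¹ * depth Q (φ h) ^ (1 / ((d : ℝ) * (d - 1))) ≤ ∑ h, Φ h := by
        refine Finset.sum_le_sum fun h _ => ?_
        rw [mul_assoc]
        refine mul_le_of_le_one_right (hΦ h) ?_
        rw [inv_mul_le_one₀ (hg0 h)]
        exact Real.rpow_le_rpow (zero_le_one.trans (one_le_depth _ _)) (depth_mono hQP _)
          (by positivity)
      have h3 : Real.logb 2 Q.card ^ (1 / ((d : ℝ) - 1)) ≤ Lam := by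
        have h1Q : (1 : ℝ) ≤ Q.card := by exact_mod_cast (by omega : 1 ≤ Q.card)
        refine Real.rpow_le_rpow (Real.logb_nonneg (by norm_num) h1Q) ?_ (by positivity)
        exact Real.logb_le_logb_of_le (by norm_num) (by linarith)
          (by exact_mod_cast Finset.card_le_card hQP)
      have h0 : 0 ≤ ∑ h, Φ h := Finset.sum_nonneg fun h _ => hΦ h
      rw [hc] at hsep
      have h4 : ∑ h with Separates (φ h) p q, Φ h * (g h)⁻¹ ≤ 2040 * d * Lam * u * ∑ h, Φ h := by
        refine hsep.trans ?_
        rw [div_eq_mul_one_div]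
        have hL0 : 0 ≤ Real.logb 2 (2 * ((t : ℝ) + 1)) ^ (1 / ((d : ℝ) - 1)) := by
          refine Real.rpow_nonneg (Real.logb_nonneg (by norm_num) ?_) _
          linarith [(t.cast_nonneg : (0 : ℝ) ≤ t)]
        rw [hc] at h3
        refine mul_le_mul ?_ h2 ?_ ?_
        · exact mul_le_mul_of_nonneg_right (mul_le_mul_of_nonneg_left h3 (by positivity)) hu
        · refine Finset.sum_nonneg fun h _ => mul_nonneg (mul_nonneg (hΦ h)
            (inv_nonneg.2 (hg0 h).le)) (Real.rpow_nonneg (zero_le_one.trans (one_le_depth _ _)) _)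
        · have := hL0.trans h3
          positivity
      rw [h1]
      have h5 := mul_le_mul_of_nonneg_left (Real.add_one_le_exp (2040 * d * Lam * u)) h0
      linarith
    rw [Finset.sum_range_succ, mul_add, Real.exp_add]
    calc ∑ h, Φ h * (1 + (g h)⁻¹) ^ (cross h + if Separates (φ h) p q then 1 else 0)
        = ∑ h, Ψ h * (1 + (g h)⁻¹) ^ cross h := by
          refine Finset.sum_congr rfl fun h _ => ?_
          simp only [Ψ]; rw [pow_add]; ring
      _ ≤ _ := hpot
      _ ≤ (∑ h, Φ h) * Real.exp (2040 * d * Lam * u) * _ :=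
          mul_le_mul_of_nonneg_right hΨsum (Real.exp_pos _).le
      _ = _ := by ring

lemma abs_le_sqrt_of_exp_mul_cosh_le {B S M lam : ℝ} (hB : 0 < B) (hM : 1 ≤ M)
    (hlam : lam = √(2 * Real.log (2 * M) / B))
    (h : Real.exp (-(lam ^ 2 * B / 2)) * Real.cosh (lam * S) ≤ M) :
    |S| ≤ √(2 * B * Real.log (2 * M)) := by
  have hlog : 0 < Real.log (2 * M) := Real.log_pos (by linarith)
  have hlam0 : 0 < lam := hlam ▸ Real.sqrt_pos.2 (by positivity)
  have hsq : lam ^ 2 * B = 2 * Real.log (2 * M) := by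
    rw [hlam, Real.sq_sqrt (by positivity)]; field_simp
  have h1 : Real.exp (lam * |S|) ≤ 2 * Real.cosh (lam * S) := by
    rw [← Real.cosh_abs, abs_mul, abs_of_pos hlam0, Real.cosh_eq]
    linarith [Real.exp_pos (-(lam * |S|))]
  have h2 : Real.exp (lam * |S| - lam ^ 2 * B / 2) ≤ 2 * M := by
    rw [sub_eq_neg_add, Real.exp_add]
    nlinarith [Real.exp_pos (-(lam ^ 2 * B / 2))]
  have h3 := (Real.le_log_iff_exp_le (by linarith)).2 h2
  have h4 : lam * |S| ≤ lam ^ 2 * B := by linarith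
  have h5 : |S| ≤ lam * B := by
    refine le_of_mul_le_mul_left (h4.trans (le_of_eq ?_)) hlam0; ring
  refine h5.trans (Real.le_sqrt_of_sq_le (le_of_eq ?_))
  calc (lam * B) ^ 2 = lam ^ 2 * B * B := by ring
    _ = _ := by rw [hsq]; ring

/-- A balanced coloring with small discrepancy on a finite family of halfspaces. -/
lemma exists_balanced_coloring [Nonempty H] [FiniteDimensional ℝ E] {d : ℕ} (hd : 3 ≤ d)
    (hE : Module.finrank ℝ E ≤ d) (φ : H → E →ᵃ[ℝ] ℝ) {P : Finset E} (hP : 2 ≤ P.card)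
    (heven : Even P.card) :
    ∃ χ : E → ℤ, (∀ p ∈ P, χ p = 1 ∨ χ p = -1) ∧ ∑ p ∈ P, χ p = 0 ∧
      ∀ h, |((∑ p ∈ P with φ h p ≤ 0, χ p : ℤ) : ℝ)| ≤
        √(4 * depth P (φ h) ^ (1 / ((d : ℝ) * (d - 1))) *
          (Real.log (Fintype.card H) + 2040 * d * Real.logb 2 P.card ^ (1 / ((d : ℝ) - 1)) *
            (P.card : ℝ) ^ (1 - 1 / ((d : ℝ) - 1))) * Real.log (2 * Fintype.card H)) := by
  have hd2 : (2 : ℝ) ≤ (d : ℝ) - 1 := by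
    have : (3 : ℝ) ≤ d := by exact_mod_cast hd
    linarith
  have hd0 : (0 : ℝ) < d := by linarith
  have hd1 : (0 : ℝ) < (d : ℝ) - 1 := by linarith
  have hn2 : (2 : ℝ) ≤ P.card := by exact_mod_cast hP
  have hn0 : (0 : ℝ) < P.card := by linarith
  have hL0 : 0 < Real.logb 2 P.card := Real.logb_pos (by norm_num) (by linarith)
  set N : ℝ := (Fintype.card H : ℝ)
  have hN : 1 ≤ N := Nat.one_le_cast.2 Fintype.card_pos
  obtain ⟨t, ht⟩ := heven
  obtain ⟨cross, hcross, hpot⟩ := exists_hasSignings (by omega : 2 ≤ d) hE φ P t P subset_rfl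
    (by omega) (fun _ => 1) fun _ => zero_le_one
  set g : H → ℝ := fun h => depth P (φ h) ^ (1 / ((d : ℝ) * (d - 1)))
  have hg1 (h : H) : 1 ≤ g h := Real.one_le_rpow (one_le_depth _ _) (by positivity)
  have hg0 (h : H) : 0 < g h := zero_lt_one.trans_le (hg1 h)
  set Lam := Real.logb 2 P.card ^ (1 / ((d : ℝ) - 1))
  have hLam : 0 < Lam := Real.rpow_pos_of_pos hL0 _
  set R := 2040 * d * Lam * (P.card : ℝ) ^ (1 - 1 / ((d : ℝ) - 1))
  have hR : 0 < R := by positivity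
  have hlogN : 0 ≤ Real.log N := Real.log_nonneg hN
  have hpot' (h : H) : (1 + (g h)⁻¹) ^ cross h ≤ N * Real.exp R := by
    have hnn (h : H) : 0 ≤ (1 + (g h)⁻¹) ^ cross h :=
      pow_nonneg (add_nonneg zero_le_one (inv_nonneg.2 (hg0 h).le)) _
    refine (Finset.single_le_sum (f := fun h => (1 + (g h)⁻¹) ^ cross h) (fun h _ => hnn h)
      (Finset.mem_univ h)).trans ?_
    simp only [one_mul] at hpot
    refine hpot.trans ?_
    have hcard : ∑ _h : H, (1 : ℝ) = N := by simp [N]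
    rw [hcard]
    refine mul_le_mul_of_nonneg_left (Real.exp_le_exp.2 ?_) (by linarith)
    refine mul_le_mul_of_nonneg_left ?_ (by positivity)
    have h2t : (P.card : ℝ) = 2 * (t : ℝ) := by rw [ht]; push_cast; ring
    rw [h2t]
    exact sum_inv_rpow_le (by positivity) (one_div_le_one_div_of_le (by norm_num) hd2) t
  set B : H → ℝ := fun h => 2 * g h * (Real.log N + R)
  have hB (h : H) : 0 < B h := mul_pos (mul_pos two_pos (hg0 h)) (by linarith)
  have hcB (h : H) : (cross h : ℝ) ≤ B h := by
    have h1 := Real.log_le_log (pow_pos (add_pos zero_lt_one (inv_pos.2 (hg0 h))) _) (hpot' h)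
    rw [Real.log_pow, Real.log_mul (by linarith) (Real.exp_pos _).ne', Real.log_exp] at h1
    have h2 : (g h)⁻¹ / 2 ≤ Real.log (1 + (g h)⁻¹) := by
      have hη0 : 0 < (g h)⁻¹ := inv_pos.2 (hg0 h)
      have hη1 : (g h)⁻¹ ≤ 1 := inv_le_one_of_one_le₀ (hg1 h)
      have := Real.one_sub_inv_le_log_of_pos (add_pos zero_lt_one hη0)
      refine le_trans ?_ this
      rw [le_sub_comm, inv_le_iff_one_le_mul₀ (by linarith)]
      nlinarith
    have h3 := (mul_le_mul_of_nonneg_left h2 (Nat.cast_nonneg (cross h))).trans h1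
    have h4 : (cross h : ℝ) * ((g h)⁻¹ / 2) = cross h / (2 * g h) := by field_simp
    rw [h4, div_le_iff₀ (by linarith [hg0 h])] at h3
    simp only [B]; linarith
  set lam : H → ℝ := fun h => √(2 * Real.log (2 * N) / B h)
  obtain ⟨χ, hχ, hχ0, hsum⟩ := hcross (fun h => Real.exp (-(lam h ^ 2 * B h / 2))) lam
    fun h => (Real.exp_pos _).le
  refine ⟨χ, hχ, hχ0, fun h => ?_⟩
  have hle : Real.exp (-(lam h ^ 2 * B h / 2)) *
      Real.cosh (lam h * (∑ p ∈ P with φ h p ≤ 0, χ p : ℤ)) ≤ N := by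
    refine (Finset.single_le_sum (f := fun h => Real.exp (-(lam h ^ 2 * B h / 2)) *
      Real.cosh (lam h * (∑ p ∈ P with φ h p ≤ 0, χ p : ℤ)))
      (fun h _ => mul_nonneg (Real.exp_pos _).le (Real.cosh_pos _).le)
      (Finset.mem_univ h)).trans (hsum.trans ?_)
    have hone : ∑ _h : H, (1 : ℝ) = N := by simp [N]
    rw [← hone]
    refine Finset.sum_le_sum fun h _ => ?_
    rw [← Real.exp_add, Real.exp_le_one_iff]
    have := mul_le_mul_of_nonneg_left (hcB h) (sq_nonneg (lam h))
    linarith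
  refine (abs_le_sqrt_of_exp_mul_cosh_le (hB h) hN rfl hle).trans (le_of_eq ?_)
  simp only [B]
  congr 1
  ring

end Matching

section HalfspaceTraces

/-- A finite family of halfspaces cuts space into polynomially many cells. -/
lemma card_traces_le {ι F : Type*} [Inhabited ι] [AddCommGroup F] [Module ℝ F]
    [FiniteDimensional ℝ F] {d : ℕ} (hd : 1 ≤ d) (hF : Module.finrank ℝ F ≤ d)
    (ψ : ι → F →ᵃ[ℝ] ℝ) (P : Finset ι) :
    ((P.powerset.filter fun u => ∃ x, trace ψ P x = u).card : ℝ) ≤ 4 * ((P.card : ℝ) + 1) ^ d := by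
  set n := P.card
  obtain ⟨f, hf⟩ : ∃ f : ℕ → ι, (Finset.range n).image f = P := by
    refine ⟨fun i => P.toList.getD i default, ?_⟩
    ext p
    rw [Finset.mem_image, ← Finset.mem_toList, List.mem_iff_getElem]
    constructor
    · rintro ⟨i, hi, rfl⟩
      have hi' : i < P.toList.length := by simpa [n] using hi
      exact ⟨i, hi', (List.getD_eq_getElem _ _ hi').symm⟩
    · rintro ⟨i, hi, rfl⟩
      exact ⟨i, by simpa [n] using hi, List.getD_eq_getElem _ _ hi⟩
  have hfP {i : ℕ} (hi : i ∈ Finset.range n) : f i ∈ P := hf ▸ Finset.mem_image_of_mem f hi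
  set G : Finset ι → Finset ℕ := fun u => (Finset.range n).filter fun i => f i ∈ u
  have hcells : (P.powerset.filter fun u => ∃ x, trace ψ P x = u).card
      ≤ (shallowCells (fun i => ψ (f i)) (fun i => (i : ℝ)) ⊤ n).card := by
    refine Finset.card_le_card_of_injOn G ?_ ?_
    · intro u hu
      obtain ⟨x, rfl⟩ := (Finset.mem_filter.1 hu).2
      refine mem_shallowCells.2 ⟨⟨x, AffineSubspace.mem_top ℝ F x, ?_⟩, fun i _ => ?_⟩
      · ext i
        simp only [G, mem_trace, Finset.mem_filter]
        exact ⟨fun h => ⟨h.1, hfP h.1, h.2⟩, fun h => ⟨h.1, h.2.2⟩⟩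
      · have := Finset.card_le_card
          (Finset.inter_subset_right : G (trace ψ P x) ∩ Finset.range i ⊆ _)
        rw [Finset.card_range] at this
        exact_mod_cast this
    · intro u hu v hv huv
      have himage {u : Finset ι} (hu : u ⊆ P) : (G u).image f = u := by
        ext p
        simp only [G, Finset.mem_image, Finset.mem_filter]
        constructor
        · rintro ⟨i, hi, rfl⟩; exact hi.2
        · intro hp
          obtain ⟨i, hi, rfl⟩ := Finset.mem_image.1 (hf.symm ▸ hu hp : p ∈ (Finset.range n).image f)
          exact ⟨i, ⟨hi, hp⟩, rfl⟩
      rw [← himage (Finset.mem_powerset.1 (Finset.mem_filter.1 hu).1),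
        ← himage (Finset.mem_powerset.1 (Finset.mem_filter.1 hv).1)]
      exact congrArg (Finset.image f) huv
  have hmain := card_shallowCells_le (fun i => ψ (f i)) (l := fun i => (i : ℝ)) (y := fun _ => 1)
    (c := 2) (N := 1) hd hF monotone_const (fun _ => le_rfl) one_pos one_le_two
    (fun j => j.cast_nonneg) (fun j => by simp; linarith) n
  have h1 : ((n : ℝ) + 1) ^ (d - 1) ≤ ((n : ℝ) + 1) ^ d :=
    pow_le_pow_right₀ (by linarith [(n.cast_nonneg : (0 : ℝ) ≤ n)]) (by omega)
  have h2 : (n : ℝ) ^ d ≤ ((n : ℝ) + 1) ^ d :=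
    pow_le_pow_left₀ n.cast_nonneg (by linarith) d
  simp only [Finset.sum_const, Finset.card_range, nsmul_eq_mul, mul_one, div_one] at hmain
  have h3 : ((P.powerset.filter fun u => ∃ x, trace ψ P x = u).card : ℝ)
      ≤ (shallowCells (fun i => ψ (f i)) (fun i => (i : ℝ)) ⊤ n).card := by exact_mod_cast hcells
  linarith

variable {d : ℕ}

/-- The affine functional `x ↦ ⟪x, a⟫ - b`. -/
def innerSub (a : EuclideanSpace ℝ (Fin d)) (b : ℝ) : EuclideanSpace ℝ (Fin d) →ᵃ[ℝ] ℝ :=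
  (innerₗ _ a).toAffineMap - AffineMap.const ℝ _ b

lemma innerSub_apply (a x : EuclideanSpace ℝ (Fin d)) (b : ℝ) : innerSub a b x = ⟪x, a⟫ - b := by
  simp [innerSub, real_inner_comm]

/-- The affine functional `(a, b) ↦ ⟪x, a⟫ - b`. -/
def innerSubDual (x : EuclideanSpace ℝ (Fin d)) : EuclideanSpace ℝ (Fin d) × ℝ →ᵃ[ℝ] ℝ :=
  ((innerₗ _ x) ∘ₗ LinearMap.fst ℝ _ ℝ - LinearMap.snd ℝ _ ℝ).toAffineMap

lemma innerSubDual_apply (x a : EuclideanSpace ℝ (Fin d)) (b : ℝ) :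
    innerSubDual x (a, b) = ⟪x, a⟫ - b := by
  simp [innerSubDual]

/-- Finitely many halfspaces suffice to cut out every subset of `P` cut out by a halfspace. -/
lemma exists_innerSub_family (P : Finset (EuclideanSpace ℝ (Fin d))) :
    ∃ T : Finset (Finset (EuclideanSpace ℝ (Fin d))), T.Nonempty ∧
      (T.card : ℝ) ≤ 4 * ((P.card : ℝ) + 1) ^ (d + 1) ∧
      ∃ φ : T → EuclideanSpace ℝ (Fin d) →ᵃ[ℝ] ℝ,
        ∀ a b, ∃ h, P.filter (fun p => φ h p ≤ 0) = P.filter fun p => ⟪p, a⟫ ≤ b := by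
  refine ⟨P.powerset.filter fun u => ∃ x, trace innerSubDual P x = u, ?_,
    card_traces_le (by omega) (by simp) innerSubDual P, ?_⟩
  · exact ⟨_, Finset.mem_filter.2 ⟨Finset.mem_powerset.2 (trace_subset _ _ 0), 0, rfl⟩⟩
  · have hex (u : P.powerset.filter fun u => ∃ x, trace innerSubDual P x = u) :
        ∃ x, trace innerSubDual P x = u.1 := (Finset.mem_filter.1 u.2).2
    choose x hx using hex
    refine ⟨fun u => innerSub (x u).1 (x u).2, fun a b => ?_⟩
    refine ⟨⟨_, Finset.mem_filter.2 ⟨Finset.mem_powerset.2 (trace_subset _ _ (a, b)), _, rfl⟩⟩, ?_⟩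
    set u : P.powerset.filter fun u => ∃ x, trace innerSubDual P x = u :=
      ⟨_, Finset.mem_filter.2 ⟨Finset.mem_powerset.2 (trace_subset _ _ (a, b)), _, rfl⟩⟩
    have h1 (y : EuclideanSpace ℝ (Fin d) × ℝ) :
        trace innerSubDual P y = P.filter fun p => ⟪p, y.1⟫ - y.2 ≤ 0 :=
      Finset.filter_congr fun p _ => by rw [← innerSubDual_apply]
    have h2 := hx u
    rw [h1] at h2
    simp only [innerSub_apply]
    rw [h2]
    simp only [u, h1, sub_nonpos]

end HalfspaceTraces

lemma card_filter_eq_one_of_sum_eq_zero {ι : Type*} {P : Finset ι} {χ : ι → ℤ}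
    (hχ : ∀ p ∈ P, χ p = 1 ∨ χ p = -1) (h0 : ∑ p ∈ P, χ p = 0) :
    (P.filter fun p => χ p = 1).card = P.card / 2 := by
  have h1 : ∑ p ∈ P, χ p = ∑ p ∈ P, ((2 : ℤ) * (if χ p = 1 then 1 else 0) - 1) := by
    refine Finset.sum_congr rfl fun p hp => ?_
    rcases hχ p hp with h | h <;> simp [h]
  rw [Finset.sum_sub_distrib, ← Finset.mul_sum, Finset.sum_boole, Finset.sum_const,
    nsmul_eq_mul, mul_one, h0] at h1
  omega

lemma logb_two_le_self {x : ℝ} (hx : 0 < x) : Real.logb 2 x ≤ x := by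
  have h1 : Real.log x ≤ x * Real.log 2 := by
    have h := Real.log_le_sub_one_of_pos (half_pos hx)
    rw [Real.log_div hx.ne' two_ne_zero] at h
    nlinarith [Real.log_two_gt_d9, Real.log_two_lt_d9]
  exact (div_le_iff₀ (Real.log_pos one_lt_two)).2 h1

lemma log_two_mul_le {d : ℕ} {n N : ℝ} (hn : 2 ≤ n) (hN : 1 ≤ N)
    (h : N ≤ 4 * (n + 1) ^ (d + 1)) : Real.log (2 * N) ≤ (2 * d + 5) * Real.logb 2 n := by
  have hlog : 0 ≤ Real.log n := Real.log_nonneg (by linarith)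
  have h1 : Real.log (2 * N) ≤ Real.log (n ^ (2 * d + 5)) := by
    refine Real.log_le_log (by linarith) ?_
    calc 2 * N ≤ 2 ^ 3 * (n + 1) ^ (d + 1) := by linarith
      _ ≤ n ^ 3 * (n ^ 2) ^ (d + 1) := by gcongr; nlinarith
      _ = n ^ (2 * d + 5) := by rw [← pow_mul, ← pow_add]; congr 1; ring
  rw [Real.log_pow] at h1
  push_cast at h1
  refine h1.trans (mul_le_mul_of_nonneg_left ?_ (by positivity))
  rw [Real.logb, le_div_iff₀ (Real.log_pos one_lt_two)]
  exact mul_le_of_le_one_right hlog (by linarith [Real.log_two_lt_d9])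

lemma sqrt_le_discrepancy_bound {d : ℕ} (hd : 3 ≤ d) {n k l L : ℝ} (hn : 2 ≤ n) (hk : 1 ≤ k)
    (hL : L = Real.logb 2 n) (hl0 : 0 ≤ l) (hl : l ≤ (2 * d + 5) * L) {l' : ℝ} (hl' : l' ≤ l) :
    √(4 * k ^ (1 / ((d : ℝ) * (d - 1))) *
      (l' + 2040 * d * L ^ (1 / ((d : ℝ) - 1)) * n ^ (1 - 1 / ((d : ℝ) - 1))) * l) ≤
    √(4 * (2042 * d + 5) * (2 * d + 5)) * n ^ (((d : ℝ) - 2) / (2 * ((d : ℝ) - 1))) *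
      k ^ (1 / (2 * (d : ℝ) * ((d : ℝ) - 1))) * L ^ (((d : ℝ) + 1) / (2 * ((d : ℝ) - 1))) := by
  have hd3 : (3 : ℝ) ≤ d := by exact_mod_cast hd
  have hd1 : (0 : ℝ) < (d : ℝ) - 1 := by linarith
  have hd0 : (0 : ℝ) < d := by linarith
  have hn0 : 0 < n := by linarith
  have hk0 : 0 < k := by linarith
  have hL1 : 1 ≤ L := by
    rw [hL, Real.le_logb_iff_rpow_le one_lt_two hn0]; simpa using hn
  have hL0 : 0 < L := by linarith
  have hLn : L ≤ n := hL ▸ logb_two_le_self hn0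
  set ν := 1 / ((d : ℝ) - 1)
  have hν1 : ν ≤ 1 := by
    simp only [ν]; rw [div_le_one hd1]; linarith
  have hsq {x : ℝ} (hx : 0 ≤ x) (e : ℝ) : (x ^ e) ^ 2 = x ^ (e * 2) := by
    rw [← Real.rpow_natCast, ← Real.rpow_mul hx]; norm_cast
  have hLL : L ≤ L ^ ν * n ^ (1 - ν) := by
    calc L = L ^ ν * L ^ (1 - ν) := by rw [← Real.rpow_add hL0]; simp
      _ ≤ _ := by gcongr
  have hbr : l' + 2040 * d * L ^ ν * n ^ (1 - ν) ≤ (2042 * d + 5) * (L ^ ν * n ^ (1 - ν)) := by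
    have := mul_le_mul_of_nonneg_left hLL (by positivity : (0 : ℝ) ≤ 2 * d + 5)
    linarith
  have hk2 : (k ^ (1 / (2 * (d : ℝ) * ((d : ℝ) - 1)))) ^ 2 = k ^ (1 / ((d : ℝ) * (d - 1))) := by
    rw [hsq hk0.le]; congr 1; field_simp
  have hn2 : (n ^ (((d : ℝ) - 2) / (2 * ((d : ℝ) - 1)))) ^ 2 = n ^ (1 - ν) := by
    rw [hsq hn0.le]; congr 1; simp only [ν]; field_simp; ring
  have hL2 : L ^ ν * L ≤ (L ^ (((d : ℝ) + 1) / (2 * ((d : ℝ) - 1)))) ^ 2 := by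
    rw [hsq hL0.le, ← Real.rpow_add_one hL0.ne']
    refine Real.rpow_le_rpow_of_exponent_le hL1 ?_
    have h1 : ν + 1 = d / ((d : ℝ) - 1) := by simp only [ν]; field_simp; ring
    have h2 : ((d : ℝ) + 1) / (2 * ((d : ℝ) - 1)) * 2 = (d + 1) / ((d : ℝ) - 1) := by field_simp
    rw [h1, h2]
    gcongr
    linarith
  refine Real.sqrt_le_iff.2 ⟨by positivity, ?_⟩
  rw [mul_pow, mul_pow, mul_pow, Real.sq_sqrt (by positivity), hk2, hn2]
  calc _ ≤ 4 * k ^ (1 / ((d : ℝ) * (d - 1))) * ((2042 * d + 5) * (L ^ ν * n ^ (1 - ν))) *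
        ((2 * d + 5) * L) := by gcongr
    _ = 4 * (2042 * d + 5) * (2 * d + 5) * n ^ (1 - ν) * k ^ (1 / ((d : ℝ) * (d - 1))) *
        (L ^ ν * L) := by ring
    _ ≤ _ := by gcongr

/-- Lemma 5.4: low-discrepancy balanced coloring with respect to
halfspaces, `d ≥ 3`. -/
theorem low_discrepancy_coloring (d : ℕ) (hd : 3 ≤ d) :
    ∃ C : ℝ, 0 < C ∧
      ∀ (P : Finset (EuclideanSpace ℝ (Fin d))) (n : ℕ),
        P.card = n → Even n → GenPos P →
        ∃ χ : EuclideanSpace ℝ (Fin d) → ℤ,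
          (∀ p ∈ P, χ p = 1 ∨ χ p = -1) ∧
          (P.filter (fun p => χ p = 1)).card = n / 2 ∧
          ∀ (a : EuclideanSpace ℝ (Fin d)) (b : ℝ), a ≠ 0 →
            |∑ p ∈ P.filter (fun p => p ∈ halfspace a b), (χ p : ℝ)|
              ≤ C * (n : ℝ) ^ (((d : ℝ) - 2) / (2 * ((d : ℝ) - 1))) *
                  (((P : Set (EuclideanSpace ℝ (Fin d))) ∩ halfspace a b).ncard : ℝ) ^
                    (1 / (2 * (d : ℝ) * ((d : ℝ) - 1))) *
                  Real.logb 2 (n : ℝ) ^ (((d : ℝ) + 1) / (2 * ((d : ℝ) - 1))) := by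
  refine ⟨√(4 * (2042 * d + 5) * (2 * d + 5)), Real.sqrt_pos.2 (by positivity), ?_⟩
  rintro P _ rfl heven -
  have hlogb : 0 ≤ Real.logb 2 (P.card : ℝ) := by
    rcases Nat.eq_zero_or_pos P.card with h | h
    · simp [h]
    · exact Real.logb_nonneg one_lt_two (by exact_mod_cast h)
  rcases P.eq_empty_or_nonempty with rfl | hne
  · refine ⟨fun _ => 1, by simp, by simp, fun a b _ => ?_⟩
    rw [Finset.filter_empty, Finset.sum_empty, abs_zero]
    positivity
  have hP : 2 ≤ P.card := by
    have := hne.card_pos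
    obtain ⟨t, ht⟩ := heven
    omega
  have hn2 : (2 : ℝ) ≤ P.card := by exact_mod_cast hP
  obtain ⟨T, hT, hTcard, φ, hφ⟩ := exists_innerSub_family P
  have : Nonempty T := hT.to_subtype
  obtain ⟨χ, hχ, hχ0, hdisc⟩ := exists_balanced_coloring hd (by simp) φ hP heven
  refine ⟨χ, hχ, card_filter_eq_one_of_sum_eq_zero hχ hχ0, fun a b _ => ?_⟩
  obtain ⟨h, hh⟩ := hφ a b
  have hcard : ((P : Set (EuclideanSpace ℝ (Fin d))) ∩ halfspace a b).ncard
      = (P.filter fun p => φ h p ≤ 0).card := by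
    rw [hh, ← Set.ncard_coe_finset, Finset.coe_filter]
    rfl
  have hfilter : P.filter (fun p => p ∈ halfspace a b) = P.filter fun p => φ h p ≤ 0 := hh.symm
  rw [hcard, hfilter]
  rcases (P.filter fun p => φ h p ≤ 0).eq_empty_or_nonempty with hem | hne'
  · rw [hem, Finset.sum_empty, abs_zero]
    positivity
  have hk : depth P (φ h) = ((P.filter fun p => φ h p ≤ 0).card : ℝ) :=
    max_eq_right (by exact_mod_cast hne'.card_pos)
  have hN1 : (1 : ℝ) ≤ Fintype.card T := by exact_mod_cast Fintype.card_pos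
  have hlog := log_two_mul_le hn2 hN1 (by rwa [Fintype.card_coe])
  have hmono : Real.log (Fintype.card T) ≤ Real.log (2 * Fintype.card T) :=
    Real.log_le_log (by linarith) (by linarith)
  have hbound := sqrt_le_discrepancy_bound hd hn2 (one_le_depth P (φ h)) rfl
    (Real.log_nonneg (by linarith)) hlog hmono
  rw [hk] at hbound
  have hS := hdisc h
  rw [hk] at hS
  push_cast at hS
  exact hS.trans hbound
end
end

section
/- Let d ≥ 2, let P be a finite set in ℝ^d, let R ⊆ P, and let k', t ≥ 0 be integers. Assume that no hyperplane in ℝ^d contains more than d points of R, and that every closed halfspace H with |H ∩ R| ≤ t + d satisfies |H ∩ P| ≤ k'. Let K be the interior of the intersection of all closed halfspaces that contain at least |R| − t points of R. Then every point p ∈ P ∖ K is k'-shallow in P, i.e., there exists a closed halfspace containing p and containing at most k' points of P. -/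
open scoped RealInnerProductSpace
open scoped Classical

noncomputable section

/-- The interior of the intersection of all closed halfspaces containing at least
`|R| - t` points of `R`. -/
def Kset {d : ℕ} (R : Finset (EuclideanSpace ℝ (Fin d))) (t : ℕ) :
    Set (EuclideanSpace ℝ (Fin d)) :=
  interior (⋂ (a : EuclideanSpace ℝ (Fin d)) (b : ℝ)
    (_ : a ≠ 0 ∧ R.card - t ≤ ((R : Set (EuclideanSpace ℝ (Fin d))) ∩ halfspace a b).ncard),
    halfspace a b)

open Filter Topology

theorem ncard_inter_eq_card_filter {α : Type*} (R : Finset α) (s : Set α) :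
    ((R : Set α) ∩ s).ncard = (R.filter (· ∈ s)).card := by
  rw [← Set.ncard_coe_finset, Finset.coe_filter]
  rfl

/-- Outside the intersection of the halfspaces missing at most `t` points of `R`, some unit
direction has at most `t` points of `R` at least as far out. -/
theorem exists_unit_card_filter_le {d : ℕ} {R : Finset (EuclideanSpace ℝ (Fin d))} {t : ℕ}
    {q : EuclideanSpace ℝ (Fin d)}
    (hq : q ∉ ⋂ (a : EuclideanSpace ℝ (Fin d)) (b : ℝ)
      (_ : a ≠ 0 ∧ R.card - t ≤ ((R : Set (EuclideanSpace ℝ (Fin d))) ∩ halfspace a b).ncard),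
      halfspace a b) :
    ∃ u ∈ Metric.sphere (0 : EuclideanSpace ℝ (Fin d)) 1,
      (R.filter fun x => ⟪q, u⟫ ≤ ⟪x, u⟫).card ≤ t := by
  simp only [Set.mem_iInter, not_forall] at hq
  obtain ⟨a, b, ⟨ha, hab⟩, hqa⟩ := hq
  have hqb : b < ⟪q, a⟫ := not_le.mp hqa
  have hpos : 0 < ‖a‖⁻¹ := inv_pos.mpr (norm_pos_iff.mpr ha)
  refine ⟨‖a‖⁻¹ • a, by simp [norm_smul, ha], ?_⟩
  rw [ncard_inter_eq_card_filter] at hab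
  have hsum := Finset.card_filter_add_card_filter_not (s := R) (· ∈ halfspace a b)
  have hsub : (R.filter fun x => ⟪q, ‖a‖⁻¹ • a⟫ ≤ ⟪x, ‖a‖⁻¹ • a⟫) ⊆
      R.filter (· ∉ halfspace a b) := by
    refine Finset.monotone_filter_right R fun x _ hx => ?_
    simp only [real_inner_smul_right] at hx
    exact not_le.mpr (hqb.trans_le (le_of_mul_le_mul_left hx hpos))
  have := Finset.card_le_card hsub
  omega

/-- Through every point outside `Kset R t` there is a hyperplane with at most `t` points of `R`
strictly on one side. -/
theorem exists_card_filter_lt_le_of_notMem_Kset {d : ℕ}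
    {R : Finset (EuclideanSpace ℝ (Fin d))} {t : ℕ} {p : EuclideanSpace ℝ (Fin d)}
    (hp : p ∉ Kset R t) :
    ∃ a : EuclideanSpace ℝ (Fin d), a ≠ 0 ∧ (R.filter fun x => ⟪p, a⟫ < ⟪x, a⟫).card ≤ t := by
  rw [Kset, ← Set.mem_compl_iff, ← closure_compl, mem_closure_iff_seq_limit] at hp
  obtain ⟨q, hq, hqp⟩ := hp
  choose u hu hcard using fun n => exists_unit_card_filter_le (hq n)
  obtain ⟨a, ha, φ, hφ, hua⟩ := (isCompact_sphere _ _).tendsto_subseq hu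
  refine ⟨a, ne_zero_of_mem_unit_sphere ⟨a, ha⟩, ?_⟩
  have hev : ∀ᶠ n in atTop, ∀ x ∈ R.filter fun x => ⟪p, a⟫ < ⟪x, a⟫,
      ⟪q (φ n), u (φ n)⟫ < ⟪x, u (φ n)⟫ := by
    rw [Filter.eventually_all_finset]
    intro x hx
    exact ((hqp.comp hφ.tendsto_atTop).inner hua).eventually_lt
      (tendsto_const_nhds.inner hua) (Finset.mem_filter.mp hx).2
  obtain ⟨n, hn⟩ := hev.exists
  refine (Finset.card_le_card fun x hx => ?_).trans (hcard (φ n))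
  exact Finset.mem_filter.mpr ⟨(Finset.mem_filter.mp hx).1, (hn x hx).le⟩

/-- Lemma 6.3(iii): every point of `P` outside `K` is `k'`-shallow in `P`. -/
theorem points_outside_K_are_shallow (d : ℕ) (hd : 2 ≤ d)
    (P R : Finset (EuclideanSpace ℝ (Fin d))) (hR : R ⊆ P) (k' t : ℕ)
    (hgen : ∀ (a : EuclideanSpace ℝ (Fin d)) (b : ℝ), a ≠ 0 →
      ((R : Set (EuclideanSpace ℝ (Fin d))) ∩ hyperplane a b).ncard ≤ d)
    (hnet : ∀ (a : EuclideanSpace ℝ (Fin d)) (b : ℝ), a ≠ 0 →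
      ((R : Set (EuclideanSpace ℝ (Fin d))) ∩ halfspace a b).ncard ≤ t + d →
      ((P : Set (EuclideanSpace ℝ (Fin d))) ∩ halfspace a b).ncard ≤ k') :
    ∀ p ∈ P, p ∉ Kset R t → IsShallowPt P k' p := by
  intro p _ hpK
  obtain ⟨a, ha, hcard⟩ := exists_card_filter_lt_le_of_notMem_Kset hpK
  refine ⟨-a, -⟪p, a⟫, neg_ne_zero.mpr ha, by simp [halfspace], ?_⟩
  refine hnet _ _ (neg_ne_zero.mpr ha) ?_
  have hsub : (R : Set (EuclideanSpace ℝ (Fin d))) ∩ halfspace (-a) (-⟪p, a⟫) ⊆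
      ((R : Set (EuclideanSpace ℝ (Fin d))) ∩ {x | ⟪p, a⟫ < ⟪x, a⟫}) ∪
        ((R : Set (EuclideanSpace ℝ (Fin d))) ∩ hyperplane a ⟪p, a⟫) := by
    rintro x ⟨hxR, hx⟩
    simp only [halfspace, Set.mem_ofPred_eq, inner_neg_right, neg_le_neg_iff] at hx
    exact hx.lt_or_eq.imp (fun h => ⟨hxR, h⟩) fun h => ⟨hxR, h.symm⟩
  have hfin := R.finite_toSet
  refine (Set.ncard_le_ncard hsub ((hfin.inter_of_left _).union (hfin.inter_of_left _))).trans
    ((Set.ncard_union_le _ _).trans (add_le_add ?_ (hgen a _ ha)))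
  rw [ncard_inter_eq_card_filter]
  exact hcard
end
end
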